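/- arXiv:2410.15599 — 4 statements merged into one kernel-verified Lean document; each statement's English description precedes it below -/
import Mathlib

section
/- For every η > 0 and every α with 0 < α ≤ 1/2: (1) there exists a unique λ_∞^hc ∈ Pr₁(X₀) such that T_∞^hc(λ_∞^hc) = λ_∞^hc; (2) as N → ∞, N^{−1} log ν^{⊗N}(𝔓_{G_N}) converges in L¹ to P_∞^hc(λ_∞^hc). -/
open MeasureTheory Filter
open scoped ENNReal NNReal ProbabilityTheory

namespace ContinuousHardcore

/-- Lebesgue measure on the unit interval `[0,1]` (as a subtype). -/
noncomputable def volI : Measure ↥(Set.Icc (0:ℝ) 1) :=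
  (volume : Measure ℝ).comap Subtype.val

/-- The normalizing constant `υ₀ = ∫₀¹ η^x dx`. -/
noncomputable def upsilon (η : ℝ) : ℝ := ∫ x : ↥(Set.Icc (0:ℝ) 1), η ^ (x : ℝ) ∂volI

/-- The fugacity measure `ν(B) = υ₀⁻¹ ∫_B η^x dx` on `[0,1]`. -/
noncomputable def fugMeasure (η : ℝ) : Measure ↥(Set.Icc (0:ℝ) 1) :=
  (ENNReal.ofReal (upsilon η))⁻¹ •
    volI.withDensity (fun x => ENNReal.ofReal (η ^ (x : ℝ)))

/-- The cumulative distribution function `F(u) = ∫_0^u f(x) dx` of `f : [0,1] → ℝ`. -/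
noncomputable def cdf (f : C(↥(Set.Icc (0:ℝ) 1), ℝ)) (u : ℝ) : ℝ :=
  ∫ x in {y : ↥(Set.Icc (0:ℝ) 1) | (y : ℝ) ≤ u}, f x ∂volI

/-- Membership in `X₀`: a nonnegative continuous density on `[0,1]`. -/
def InX0 (f : C(↥(Set.Icc (0:ℝ) 1), ℝ)) : Prop :=
  (∀ t, 0 ≤ f t) ∧ (∫ x, f x ∂volI) = 1

/-- Membership in `Pr₁(X₀)`: a Borel probability measure on `X₀` with finite first moment
(viewed as a measure on `C([0,1],ℝ)` concentrated on `X₀`). -/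
def MemPr1X0 [MeasurableSpace C(↥(Set.Icc (0:ℝ) 1), ℝ)]
    (lam : Measure C(↥(Set.Icc (0:ℝ) 1), ℝ)) : Prop :=
  IsProbabilityMeasure lam ∧ Integrable (fun f => ‖f‖) lam ∧ lam {f | InX0 f} = 1

/-- The value at `t` of the random density `η^t Π_k F_k(1-t) / ∫₀¹ η^s Π_k F_k(1-s) ds`. -/
noncomputable def hcVal (η : ℝ) {r : ℕ} (fv : Fin r → C(↥(Set.Icc (0:ℝ) 1), ℝ))
    (t : ↥(Set.Icc (0:ℝ) 1)) : ℝ :=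
  (η ^ (t : ℝ) * ∏ k, cdf (fv k) (1 - (t : ℝ))) /
    ∫ s : ↥(Set.Icc (0:ℝ) 1), (η ^ (s : ℝ) * ∏ k, cdf (fv k) (1 - (s : ℝ))) ∂volI

/-- `T` is (a version of) the hardcore operator `T_∞^hc`: for `λ ∈ Pr₁(X₀)`, `T λ` is the
law of `t ↦ η^t Π_{k ≤ π(2α)} F_k(1-t) / ∫₀¹ η^s Π_{k ≤ π(2α)} F_k(1-s) ds` where
`π(2α) ∼ Pois(2α)` and the `f_k` are i.i.d. with law `λ`, independent of `π(2α)`. -/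
def IsHcOp (η : ℝ) (α : ℝ≥0) [MeasurableSpace C(↥(Set.Icc (0:ℝ) 1), ℝ)]
    (T : Measure C(↥(Set.Icc (0:ℝ) 1), ℝ) → Measure C(↥(Set.Icc (0:ℝ) 1), ℝ)) : Prop :=
  ∀ lam, MemPr1X0 lam → ∀ A : Set C(↥(Set.Icc (0:ℝ) 1), ℝ), MeasurableSet A →
    T lam A = ∑' r : ℕ, (ProbabilityTheory.poissonMeasure (2 * α)) {r} *
      (Measure.pi fun _ : Fin r => lam)
        {q | (fun t => hcVal η q t) ∈ DFunLike.coe '' A}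

/-- The hardcore functional `P_∞^hc(λ) = -log υ₀ + E log ∫₀¹ η^t Π_{k≤π(2α)} F_k(1-t) dt
- α E log ∫₀¹ F₁(1-t) f₂(t) dt`. -/
noncomputable def hcFunctional (η : ℝ) (α : ℝ≥0)
    [MeasurableSpace C(↥(Set.Icc (0:ℝ) 1), ℝ)]
    (lam : Measure C(↥(Set.Icc (0:ℝ) 1), ℝ)) : ℝ :=
  -Real.log (upsilon η)
    + (∑' r : ℕ, ((ProbabilityTheory.poissonMeasure (2 * α)) {r}).toReal *
        ∫ q : Fin r → C(↥(Set.Icc (0:ℝ) 1), ℝ),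
          Real.log (∫ t : ↥(Set.Icc (0:ℝ) 1),
            (η ^ (t : ℝ) * ∏ k, cdf (q k) (1 - (t : ℝ))) ∂volI)
          ∂(Measure.pi fun _ : Fin r => lam))
    - (α : ℝ) * ∫ q : C(↥(Set.Icc (0:ℝ) 1), ℝ) × C(↥(Set.Icc (0:ℝ) 1), ℝ),
        Real.log (∫ t : ↥(Set.Icc (0:ℝ) 1), cdf q.1 (1 - (t : ℝ)) * q.2 t ∂volI)
        ∂(lam.prod lam)

/-- The hardcore polytope `𝔓_{G_N}` of the random graph with `π(αN)` edges. -/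
def polytope {Ω : Type*} (N : ℕ) (K : Ω → ℕ) (E : ℕ → Ω → (Fin 2 → Fin N)) (ω : Ω) :
    Set (Fin N → ↥(Set.Icc (0:ℝ) 1)) :=
  {σ | ∀ k < K ω, (σ (E k ω 0) : ℝ) + (σ (E k ω 1) : ℝ) ≤ 1}


section BernoulliSubsets

variable {ε : Type*}

/-- Expectation of `F A` when `A ⊆ S` contains each element independently with probability `p`. -/
noncomputable def bernExp (p : ℝ) (S : Finset ε) (F : Finset ε → ℝ) : ℝ :=
  ∑ A ∈ S.powerset, p ^ A.card * (1 - p) ^ (S.card - A.card) * F A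

lemma bernExp_empty (p : ℝ) (F : Finset ε → ℝ) : bernExp p ∅ F = F ∅ := by
  simp [bernExp]

lemma bernExp_congr {p : ℝ} {S : Finset ε} {F G : Finset ε → ℝ} (h : ∀ A ⊆ S, F A = G A) :
    bernExp p S F = bernExp p S G :=
  Finset.sum_congr rfl fun A hA => by rw [h A (Finset.mem_powerset.1 hA)]

lemma bernExp_add (p : ℝ) (S : Finset ε) (F G : Finset ε → ℝ) :
    bernExp p S (fun A => F A + G A) = bernExp p S F + bernExp p S G := by
  simp [bernExp, mul_add, Finset.sum_add_distrib]

lemma bernExp_sub (p : ℝ) (S : Finset ε) (F G : Finset ε → ℝ) :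
    bernExp p S (fun A => F A - G A) = bernExp p S F - bernExp p S G := by
  simp [bernExp, mul_sub, Finset.sum_sub_distrib]

lemma bernExp_const_mul (p : ℝ) (S : Finset ε) (c : ℝ) (F : Finset ε → ℝ) :
    bernExp p S (fun A => c * F A) = c * bernExp p S F := by
  simp only [bernExp, Finset.mul_sum]
  exact Finset.sum_congr rfl fun A _ => by ring

lemma bernExp_sum {κ : Type*} (p : ℝ) (S : Finset ε) (W : Finset κ) (F : κ → Finset ε → ℝ) :
    bernExp p S (fun A => ∑ w ∈ W, F w A) = ∑ w ∈ W, bernExp p S (F w) := by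
  simp only [bernExp, Finset.mul_sum]
  exact Finset.sum_comm

lemma bernExp_mono {p : ℝ} (h0 : 0 ≤ p) (h1 : p ≤ 1) {S : Finset ε} {F G : Finset ε → ℝ}
    (h : ∀ A ⊆ S, F A ≤ G A) : bernExp p S F ≤ bernExp p S G := by
  have h2 : 0 ≤ 1 - p := by linarith
  exact Finset.sum_le_sum fun A hA =>
    mul_le_mul_of_nonneg_left (h A (Finset.mem_powerset.1 hA)) (by positivity)

variable [DecidableEq ε]

lemma bernExp_insert (p : ℝ) {S : Finset ε} {e : ε} (he : e ∉ S) (F : Finset ε → ℝ) :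
    bernExp p (insert e S) F
      = (1 - p) * bernExp p S F + p * bernExp p S (fun A => F (insert e A)) := by
  unfold bernExp
  rw [Finset.sum_powerset_insert he, Finset.mul_sum, Finset.mul_sum]
  congr 1
  · refine Finset.sum_congr rfl fun A hA => ?_
    have hle := Finset.card_le_card (Finset.mem_powerset.1 hA)
    rw [Finset.card_insert_of_notMem he, Nat.succ_sub hle, pow_succ]
    ring
  · refine Finset.sum_congr rfl fun A hA => ?_
    have heA : e ∉ A := fun h => he (Finset.mem_powerset.1 hA h)
    rw [Finset.card_insert_of_notMem he, Finset.card_insert_of_notMem heA,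
      Nat.add_sub_add_right, pow_succ]
    ring

lemma bernExp_const (p : ℝ) (S : Finset ε) (c : ℝ) : bernExp p S (fun _ => c) = c := by
  induction S using Finset.induction_on with
  | empty => exact bernExp_empty p _
  | insert e S he ih => rw [bernExp_insert p he, ih]; ring

lemma bernExp_nonneg {p : ℝ} (h0 : 0 ≤ p) (h1 : p ≤ 1) {S : Finset ε} {F : Finset ε → ℝ}
    (h : ∀ A ⊆ S, 0 ≤ F A) : 0 ≤ bernExp p S F := by
  simpa [bernExp_const] using bernExp_mono h0 h1 (F := fun _ => 0) h

lemma bernExp_union (p : ℝ) {S T : Finset ε} (hST : Disjoint S T) (F : Finset ε → ℝ) :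
    bernExp p (S ∪ T) F = bernExp p S (fun A => bernExp p T (fun B => F (A ∪ B))) := by
  induction S using Finset.induction_on generalizing F with
  | empty => simp [bernExp_empty]
  | insert e S he ih =>
    rw [Finset.disjoint_insert_left] at hST
    have heST : e ∉ S ∪ T := by simp [he, hST.1]
    rw [Finset.insert_union, bernExp_insert p heST, bernExp_insert p he, ih hST.2, ih hST.2]
    simp only [Finset.insert_union]

lemma bernExp_image {κ : Type*} [DecidableEq κ] (p : ℝ) {f : κ → ε} (hf : Function.Injective f)
    (S : Finset κ) (F : Finset ε → ℝ) :
    bernExp p (S.image f) F = bernExp p S (fun A => F (A.image f)) := by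
  induction S using Finset.induction_on generalizing F with
  | empty => simp [bernExp_empty]
  | insert e S he ih =>
    have he' : f e ∉ S.image f := by
      simpa [hf.eq_iff] using he
    rw [Finset.image_insert, bernExp_insert p he', bernExp_insert p he, ih, ih]
    simp only [Finset.image_insert]

lemma bernExp_card (p : ℝ) (S : Finset ε) : bernExp p S (fun A => (A.card : ℝ)) = S.card * p := by
  induction S using Finset.induction_on with
  | empty => simp [bernExp_empty]
  | insert e S he ih =>
    rw [bernExp_insert p he, ih, bernExp_congr (G := fun A => (A.card : ℝ) + 1),
      bernExp_add, ih, bernExp_const, Finset.card_insert_of_notMem he]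
    · push_cast; ring
    · intro A hA
      rw [Finset.card_insert_of_notMem fun h => he (hA h)]; push_cast; ring

/-- Efron–Stein bound for a function of independent Bernoulli variables. -/
lemma bernExp_variance_le {p C : ℝ} (h0 : 0 ≤ p) (h1 : p ≤ 1) (S : Finset ε)
    (F : Finset ε → ℝ) (hF : ∀ A e, |F (insert e A) - F A| ≤ C) :
    bernExp p S (fun A => F A ^ 2) - bernExp p S F ^ 2 ≤ S.card * p * C ^ 2 := by
  induction S using Finset.induction_on generalizing F with
  | empty => simp [bernExp_empty]
  | insert e S he ih =>
    have hFe : ∀ A e', |F (insert e (insert e' A)) - F (insert e A)| ≤ C := fun A e' => by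
      rw [Finset.insert_comm]; exact hF _ _
    have ih1 := ih F hF
    have ih2 := ih (fun A => F (insert e A)) hFe
    rw [bernExp_insert p he, bernExp_insert p he, Finset.card_insert_of_notMem he]
    set a := bernExp p S F
    set b := bernExp p S (fun A => F (insert e A))
    set a2 := bernExp p S (fun A => F A ^ 2)
    set b2 := bernExp p S (fun A => F (insert e A) ^ 2)
    have hab : |b - a| ≤ C := by
      rw [← bernExp_sub]
      refine abs_le.2 ⟨?_, ?_⟩
      · rw [← bernExp_const p S (-C)]
        exact bernExp_mono h0 h1 fun A _ => (abs_le.1 (hF A e)).1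
      · rw [← bernExp_const p S C]
        exact bernExp_mono h0 h1 fun A _ => (abs_le.1 (hF A e)).2
    have hab2 : (b - a) ^ 2 ≤ C ^ 2 := sq_le_sq' (abs_le.1 hab).1 (abs_le.1 hab).2
    have h2 : 0 ≤ 1 - p := by linarith
    have e1 := mul_le_mul_of_nonneg_left ih1 h2
    have e2 := mul_le_mul_of_nonneg_left ih2 h0
    have e3 := mul_le_mul_of_nonneg_left hab2 h0
    have e4 := mul_le_mul_of_nonneg_left hab2 (mul_nonneg h0 h0)
    have e5 : 0 ≤ p * p * (b - a) ^ 2 := by positivity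
    push_cast
    nlinarith

/-- Russo's formula. -/
lemma hasDerivAt_bernExp (S : Finset ε) (F : Finset ε → ℝ) (p : ℝ) :
    HasDerivAt (fun q => bernExp q S F)
      (∑ e ∈ S, bernExp p S (fun A => F (insert e A) - F (A.erase e))) p := by
  induction S using Finset.induction_on generalizing F with
  | empty => simpa [bernExp_empty] using hasDerivAt_const p (F ∅)
  | insert e S he ih =>
    have h := (((hasDerivAt_id p).const_sub 1).mul (ih F)).add
      ((hasDerivAt_id p).mul (ih (fun A => F (insert e A))))
    have hfun : (fun q => bernExp q (insert e S) F)
        = ((fun x => 1 - id x) * fun q => bernExp q S F)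
          + (id * fun q => bernExp q S (fun A => F (insert e A))) := by
      funext q; simp [bernExp_insert q he]
    rw [hfun]
    refine h.congr_deriv ?_
    rw [Finset.sum_insert he, bernExp_insert p he]
    have hS : ∀ e' ∈ S, bernExp p (insert e S) (fun A => F (insert e' A) - F (A.erase e'))
        = (1 - p) * bernExp p S (fun A => F (insert e' A) - F (A.erase e'))
          + p * bernExp p S (fun A => F (insert e (insert e' A)) - F (insert e (A.erase e'))) := by
      intro e' he'
      have hne : e ≠ e' := fun h => he (h ▸ he')
      rw [bernExp_insert p he]
      simp only [Finset.insert_comm e' e, Finset.erase_insert_of_ne hne]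
    rw [Finset.sum_congr rfl hS, Finset.sum_add_distrib, ← Finset.mul_sum, ← Finset.mul_sum]
    have h1 : bernExp p S (fun A => F (insert e A) - F (A.erase e))
        = bernExp p S (fun A => F (insert e A)) - bernExp p S F := by
      rw [← bernExp_sub]
      refine bernExp_congr fun A hA => ?_
      rw [Finset.erase_eq_of_notMem fun h => he (hA h)]
    have h2 : bernExp p S (fun A => F (insert e (insert e A)) - F ((insert e A).erase e))
        = bernExp p S (fun A => F (insert e A)) - bernExp p S F := by
      rw [← bernExp_sub]
      refine bernExp_congr fun A hA => ?_
      rw [Finset.erase_insert fun h => he (hA h), Finset.insert_idem]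
    rw [h1, h2]
    simp only [id]
    ring

end BernoulliSubsets

section Densities

local notation "𝕀" => Set.Elem (Set.Icc (0:ℝ) 1)

instance : IsProbabilityMeasure volI :=
  inferInstanceAs (IsProbabilityMeasure (volume : Measure unitInterval))

instance : NullSingletonClass volI where
  measure_singleton x := by
    rw [volI, (MeasurableEmbedding.subtype_coe measurableSet_Icc).comap_apply]
    simp

lemma continuous_rpow_coe {η : ℝ} (hη : 0 < η) : Continuous fun x : 𝕀 => η ^ (x : ℝ) :=
  continuous_const.rpow continuous_subtype_val fun _ => Or.inl hη.ne'

lemma integrable_volI_of_continuous {f : 𝕀 → ℝ} (hf : Continuous f) : Integrable f volI :=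
  hf.integrable_of_hasCompactSupport (HasCompactSupport.of_compactSpace f)

lemma measurableSet_coe_le (u : ℝ) : MeasurableSet {y : 𝕀 | (y : ℝ) ≤ u} :=
  measurableSet_le measurable_subtype_coe measurable_const

lemma measurableSet_coe_add_le (x : ℝ) : MeasurableSet {y : 𝕀 | x + (y : ℝ) ≤ 1} :=
  measurableSet_le (measurable_const.add measurable_subtype_coe) measurable_const

lemma volI_pos_of_isOpen {U : Set 𝕀} (hU : IsOpen U) (hne : U.Nonempty) : 0 < volI U := by
  obtain ⟨x, hx⟩ := hne
  obtain ⟨ε, hε, hball⟩ := Metric.isOpen_iff.1 hU x hx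
  rw [volI, (MeasurableEmbedding.subtype_coe measurableSet_Icc).comap_apply]
  have hsub : Set.Icc (max 0 (x - ε / 2)) (min 1 (x + ε / 2)) ⊆ Subtype.val '' U := by
    intro y hy
    have h1 := (max_le_iff.1 hy.1); have h2 := (le_min_iff.1 hy.2)
    refine ⟨⟨y, h1.1, h2.1⟩, hball ?_, rfl⟩
    rw [Metric.mem_ball, Subtype.dist_eq, Real.dist_eq, abs_lt]
    constructor <;> simp only <;> linarith
  refine lt_of_lt_of_le ?_ (measure_mono hsub)
  rw [Real.volume_Icc, ENNReal.ofReal_pos, sub_pos]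
  have := x.2.1; have := x.2.2
  refine max_lt (lt_min ?_ ?_) (lt_min ?_ ?_) <;> linarith

lemma continuous_cdf (f : C(𝕀, ℝ)) : Continuous (cdf f) := by
  rw [continuous_iff_continuousAt]
  intro u₀
  have hrep : cdf f = fun u => ∫ x, {y : 𝕀 | (y : ℝ) ≤ u}.indicator f x ∂volI := by
    funext u; exact (integral_indicator (measurableSet_coe_le u)).symm
  rw [hrep]
  have hint := integrable_volI_of_continuous (map_continuous f)
  refine continuousAt_of_dominated (bound := fun x => ‖f x‖) ?_ ?_ hint.norm ?_
  · exact Eventually.of_forall fun u =>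
      hint.aestronglyMeasurable.indicator (measurableSet_coe_le u)
  · exact Eventually.of_forall fun u => Eventually.of_forall fun x => norm_indicator_le_norm_self f x
  · have hne : ∀ᵐ x : 𝕀 ∂volI, (x : ℝ) ≠ u₀ := by
      rw [ae_iff]
      refine Set.Subsingleton.measure_zero (fun a ha b hb => ?_) volI
      simp only [ne_eq, not_not, Set.mem_ofPred_eq] at ha hb
      exact Subtype.ext (ha.trans hb.symm)
    filter_upwards [hne] with x hx
    rcases lt_or_gt_of_ne hx with h | h
    · refine (continuousAt_const (y := f x)).congr ?_
      filter_upwards [lt_mem_nhds h] with u hu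
      rw [Set.indicator_of_mem]; exact hu.le
    · refine (continuousAt_const (y := (0:ℝ))).congr ?_
      filter_upwards [gt_mem_nhds h] with u hu
      rw [Set.indicator_of_notMem]; exact not_le.2 hu

lemma continuous_hcVal {η : ℝ} (hη : 0 < η) {r : ℕ} (q : Fin r → C(𝕀, ℝ)) :
    Continuous (hcVal η q) := by
  unfold hcVal
  refine Continuous.div_const ?_ _
  refine (continuous_rpow_coe hη).mul (continuous_finsetProd _ fun k _ => ?_)
  exact (continuous_cdf (q k)).comp (continuous_const.sub continuous_subtype_val)

/-- Finite rooted plane trees. -/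
abbrev PlaneTree := WType (fun n : ℕ => Fin n)

/-- The root density of a finite tree, computed by belief propagation. -/
noncomputable def density {η : ℝ} (hη : 0 < η) : PlaneTree → C(𝕀, ℝ)
  | ⟨_, ts⟩ => ⟨hcVal η (fun i => density hη (ts i)), continuous_hcVal hη _⟩

variable {η : ℝ}

/-- The normalization of the root density. -/
noncomputable def rootMass (hη : 0 < η) {r : ℕ} (ts : Fin r → PlaneTree) : ℝ :=
  ∫ s : 𝕀, η ^ (s : ℝ) * ∏ k, cdf (density hη (ts k)) (1 - (s : ℝ)) ∂volI

lemma density_mk (hη : 0 < η) {r : ℕ} (ts : Fin r → PlaneTree) (x : 𝕀) :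
    density hη ⟨r, ts⟩ x
      = η ^ (x : ℝ) * (∏ k, cdf (density hη (ts k)) (1 - (x : ℝ))) / rootMass hη ts := rfl

lemma continuous_rootIntegrand (hη : 0 < η) {r : ℕ} (ts : Fin r → PlaneTree) :
    Continuous fun s : 𝕀 => η ^ (s : ℝ) * ∏ k, cdf (density hη (ts k)) (1 - (s : ℝ)) :=
  (continuous_rpow_coe hη).mul (continuous_finsetProd _ fun _ _ =>
    (continuous_cdf _).comp (continuous_const.sub continuous_subtype_val))

lemma integral_pos_of_pos_below_one {f : 𝕀 → ℝ} (hf : Continuous f) (h0 : ∀ x, 0 ≤ f x)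
    (h1 : ∀ x : 𝕀, (x : ℝ) < 1 → 0 < f x) {u : ℝ} (hu : 0 < u) :
    0 < ∫ x in {y : 𝕀 | (y : ℝ) ≤ u}, f x ∂volI := by
  rw [setIntegral_pos_iff_support_of_nonneg_ae (Eventually.of_forall h0)
    (integrable_volI_of_continuous hf).integrableOn]
  refine lt_of_lt_of_le (volI_pos_of_isOpen (U := {y : 𝕀 | (y : ℝ) < min u 1}) ?_ ?_)
    (measure_mono ?_)
  · exact isOpen_lt continuous_subtype_val continuous_const
  · exact ⟨0, by simp [hu]⟩
  · intro y hy
    have hy : (y : ℝ) < min u 1 := hy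
    rw [lt_min_iff] at hy
    exact ⟨(h1 y hy.2).ne', hy.1.le⟩

lemma density_props (hη : 0 < η) (t : PlaneTree) :
    (∀ x, 0 ≤ density hη t x) ∧ (∀ x : 𝕀, (x : ℝ) < 1 → 0 < density hη t x) ∧
      ∫ x, density hη t x ∂volI = 1 := by
  induction t with
  | mk r ts ih =>
  have hcdf0 : ∀ k u, 0 ≤ cdf (density hη (ts k)) u := fun k u =>
    integral_nonneg fun x => (ih k).1 x
  have hcdf : ∀ k u, 0 < u → 0 < cdf (density hη (ts k)) u := fun k u hu =>
    integral_pos_of_pos_below_one (map_continuous _) (ih k).1 (ih k).2.1 hu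
  have h0 : ∀ x : 𝕀, 0 ≤ η ^ (x : ℝ) * ∏ k, cdf (density hη (ts k)) (1 - (x : ℝ)) := fun x =>
    mul_nonneg (Real.rpow_nonneg hη.le _) (Finset.prod_nonneg fun k _ => hcdf0 k _)
  have h1 : ∀ x : 𝕀, (x : ℝ) < 1 →
      0 < η ^ (x : ℝ) * ∏ k, cdf (density hη (ts k)) (1 - (x : ℝ)) := fun x hx =>
    mul_pos (Real.rpow_pos_of_pos hη _) (Finset.prod_pos fun k _ => hcdf k _ (by linarith))
  have hM : 0 < rootMass hη ts := by
    have h := integral_pos_of_pos_below_one (continuous_rootIntegrand hη ts) h0 h1 one_pos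
    rwa [show {y : 𝕀 | (y : ℝ) ≤ 1} = Set.univ from Set.eq_univ_of_forall fun y => y.2.2,
      setIntegral_univ] at h
  refine ⟨fun x => ?_, fun x hx => ?_, ?_⟩
  · rw [density_mk]; exact div_nonneg (h0 x) hM.le
  · rw [density_mk]; exact div_pos (h1 x hx) hM
  · simp_rw [density_mk]
    rw [integral_div]
    exact div_self hM.ne'

lemma inX0_density (hη : 0 < η) (t : PlaneTree) : InX0 (density hη t) :=
  ⟨(density_props hη t).1, (density_props hη t).2.2⟩

lemma cdf_density_pos (hη : 0 < η) (t : PlaneTree) {u : ℝ} (hu : 0 < u) :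
    0 < cdf (density hη t) u :=
  integral_pos_of_pos_below_one (map_continuous _) (density_props hη t).1
    (density_props hη t).2.1 hu

lemma cdf_density_nonneg (hη : 0 < η) (t : PlaneTree) (u : ℝ) : 0 ≤ cdf (density hη t) u :=
  integral_nonneg (density_props hη t).1

lemma rootIntegrand_nonneg (hη : 0 < η) {r : ℕ} (ts : Fin r → PlaneTree) (x : 𝕀) :
    0 ≤ η ^ (x : ℝ) * ∏ k, cdf (density hη (ts k)) (1 - (x : ℝ)) :=
  mul_nonneg (Real.rpow_nonneg hη.le _) (Finset.prod_nonneg fun _ _ => cdf_density_nonneg hη _ _)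

lemma rootMass_pos (hη : 0 < η) {r : ℕ} (ts : Fin r → PlaneTree) : 0 < rootMass hη ts := by
  have h := integral_pos_of_pos_below_one (continuous_rootIntegrand hη ts)
    (rootIntegrand_nonneg hη ts) (fun x hx => mul_pos (Real.rpow_pos_of_pos hη _)
      (Finset.prod_pos fun k _ => cdf_density_pos hη _ (by linarith))) one_pos
  rwa [show {y : 𝕀 | (y : ℝ) ≤ 1} = Set.univ from Set.eq_univ_of_forall fun y => y.2.2,
    setIntegral_univ] at h

/-- The root marginal of a finite tree. -/
noncomputable def rootLaw (hη : 0 < η) (t : PlaneTree) : Measure 𝕀 :=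
  volI.withDensity fun x => ENNReal.ofReal (density hη t x)

instance (hη : 0 < η) (t : PlaneTree) : IsProbabilityMeasure (rootLaw hη t) where
  measure_univ := by
    rw [rootLaw, withDensity_apply _ MeasurableSet.univ, Measure.restrict_univ,
      ← ofReal_integral_eq_lintegral_ofReal
        (integrable_volI_of_continuous (map_continuous _))
        (Eventually.of_forall (density_props hη t).1), (density_props hη t).2.2,
      ENNReal.ofReal_one]

lemma rootLaw_add_le (hη : 0 < η) (t : PlaneTree) (x : ℝ) :
    rootLaw hη t {y | x + (y : ℝ) ≤ 1} = ENNReal.ofReal (cdf (density hη t) (1 - x)) := by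
  have hset : {y : 𝕀 | x + (y : ℝ) ≤ 1} = {y : 𝕀 | (y : ℝ) ≤ 1 - x} := by
    ext y; simp only [Set.mem_ofPred_eq]; constructor <;> intro h <;> linarith
  rw [hset, rootLaw, withDensity_apply _ (measurableSet_coe_le _), cdf,
    ← ofReal_integral_eq_lintegral_ofReal
      (integrable_volI_of_continuous (map_continuous _)).integrableOn
      (Eventually.of_forall (density_props hη t).1)]

lemma upsilon_pos (hη : 0 < η) : 0 < upsilon η := by
  have h := integral_pos_of_pos_below_one (continuous_rpow_coe hη)
    (fun x => Real.rpow_nonneg hη.le _) (fun x _ => Real.rpow_pos_of_pos hη _) one_pos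
  rwa [show {y : 𝕀 | (y : ℝ) ≤ 1} = Set.univ from Set.eq_univ_of_forall fun y => y.2.2,
    setIntegral_univ] at h

lemma measurable_ofReal_rpow (hη : 0 < η) :
    Measurable fun x : 𝕀 => ENNReal.ofReal (η ^ (x : ℝ)) :=
  (continuous_rpow_coe hη).measurable.ennreal_ofReal

lemma lintegral_fugMeasure (hη : 0 < η) {φ : 𝕀 → ℝ≥0∞} (hφ : Measurable φ) :
    ∫⁻ x, φ x ∂fugMeasure η
      = (ENNReal.ofReal (upsilon η))⁻¹ * ∫⁻ x, ENNReal.ofReal (η ^ (x : ℝ)) * φ x ∂volI := by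
  rw [fugMeasure, lintegral_smul_measure,
    lintegral_withDensity_eq_lintegral_mul _ (measurable_ofReal_rpow hη) hφ]
  rfl

lemma isProbabilityMeasure_fugMeasure (hη : 0 < η) : IsProbabilityMeasure (fugMeasure η) where
  measure_univ := by
    rw [← lintegral_one, lintegral_fugMeasure hη measurable_const]
    simp only [mul_one]
    rw [← ofReal_integral_eq_lintegral_ofReal
        (integrable_volI_of_continuous (continuous_rpow_coe hη))
        (Eventually.of_forall fun x => Real.rpow_nonneg hη.le _)]
    exact ENNReal.inv_mul_cancel (by simpa using upsilon_pos hη) ENNReal.ofReal_ne_top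

/-- The probability that the root, with subtrees `ts` attached, satisfies the constraints. -/
noncomputable def rootProb (hη : 0 < η) {r : ℕ} (ts : Fin r → PlaneTree) : ℝ≥0∞ :=
  ∫⁻ x : 𝕀, ∏ i, rootLaw hη (ts i) {y | (x : ℝ) + (y : ℝ) ≤ 1} ∂fugMeasure η

lemma measurable_rootLaw_add_le (hη : 0 < η) (t : PlaneTree) :
    Measurable fun x : 𝕀 => rootLaw hη t {y | (x : ℝ) + (y : ℝ) ≤ 1} := by
  simp_rw [rootLaw_add_le]
  exact ((continuous_cdf _).comp
    (continuous_const.sub continuous_subtype_val)).measurable.ennreal_ofReal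

lemma ofReal_rpow_mul_prod (hη : 0 < η) {r : ℕ} (ts : Fin r → PlaneTree) (x : 𝕀) :
    ENNReal.ofReal (η ^ (x : ℝ)) * ∏ i, rootLaw hη (ts i) {y | (x : ℝ) + (y : ℝ) ≤ 1}
      = ENNReal.ofReal (η ^ (x : ℝ) * ∏ k, cdf (density hη (ts k)) (1 - (x : ℝ))) := by
  simp_rw [rootLaw_add_le]
  rw [ENNReal.ofReal_mul (Real.rpow_nonneg hη.le _),
    ENNReal.ofReal_prod_of_nonneg fun _ _ => cdf_density_nonneg hη _ _]

lemma rootProb_eq (hη : 0 < η) {r : ℕ} (ts : Fin r → PlaneTree) :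
    rootProb hη ts = ENNReal.ofReal ((upsilon η)⁻¹ * rootMass hη ts) := by
  rw [rootProb, lintegral_fugMeasure hη
    (Finset.measurable_fun_prod _ fun i _ => measurable_rootLaw_add_le hη (ts i))]
  simp_rw [ofReal_rpow_mul_prod]
  rw [← ofReal_integral_eq_lintegral_ofReal
      (integrable_volI_of_continuous (continuous_rootIntegrand hη ts))
      (Eventually.of_forall (rootIntegrand_nonneg hη ts)),
    ENNReal.ofReal_mul (inv_nonneg.2 (upsilon_pos hη).le),
    ENNReal.ofReal_inv_of_pos (upsilon_pos hη)]
  rfl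

lemma lintegral_rootLaw_mk (hη : 0 < η) {r : ℕ} (ts : Fin r → PlaneTree) {φ : 𝕀 → ℝ≥0∞}
    (hφ : Measurable φ) :
    rootProb hη ts * ∫⁻ x, φ x ∂rootLaw hη ⟨r, ts⟩
      = ∫⁻ x, φ x * ∏ i, rootLaw hη (ts i) {y | (x : ℝ) + (y : ℝ) ≤ 1} ∂fugMeasure η := by
  have hM := rootMass_pos hη ts
  have hU := upsilon_pos hη
  rw [lintegral_fugMeasure hη (φ := fun x =>
      φ x * ∏ i, rootLaw hη (ts i) {y | (x : ℝ) + (y : ℝ) ≤ 1}) (hφ.mul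
    (Finset.measurable_fun_prod _ fun i _ => measurable_rootLaw_add_le hη (ts i))), rootLaw,
    lintegral_withDensity_eq_lintegral_mul _
      (map_continuous (density hη ⟨r, ts⟩)).measurable.ennreal_ofReal hφ]
  have h : ∀ x : 𝕀, ENNReal.ofReal (η ^ (x : ℝ)) *
      (φ x * ∏ i, rootLaw hη (ts i) {y | (x : ℝ) + (y : ℝ) ≤ 1})
      = ENNReal.ofReal (rootMass hη ts) * (ENNReal.ofReal (density hη ⟨r, ts⟩ x) * φ x) := by
    intro x
    rw [mul_left_comm, ofReal_rpow_mul_prod, ← mul_assoc, ← ENNReal.ofReal_mul hM.le, density_mk,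
      mul_div_cancel₀ _ hM.ne', mul_comm]
  simp_rw [h]
  rw [lintegral_const_mul _ (f := fun x => ENNReal.ofReal (density hη ⟨r, ts⟩ x) * φ x)
    ((map_continuous (density hη ⟨r, ts⟩)).measurable.ennreal_ofReal.mul hφ), ← mul_assoc,
    rootProb_eq, ENNReal.ofReal_mul (inv_nonneg.2 hU.le), ENNReal.ofReal_inv_of_pos hU]
  rfl

/-- The probability that a single spin is at most `1/2`. -/
noncomputable def halfProb (η : ℝ) : ℝ≥0∞ := fugMeasure η {x | (x : ℝ) ≤ 1 / 2}

lemma halfProb_le_one (hη : 0 < η) : halfProb η ≤ 1 :=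
  have := isProbabilityMeasure_fugMeasure hη
  prob_le_one

lemma halfProb_pos (hη : 0 < η) : 0 < halfProb η := by
  rw [halfProb, fugMeasure, Measure.smul_apply, smul_eq_mul, pos_iff_ne_zero]
  refine mul_ne_zero (by simp) ?_
  rw [withDensity_apply _ (measurableSet_coe_le _), ← pos_iff_ne_zero,
    setLIntegral_pos_iff (measurable_ofReal_rpow hη)]
  refine lt_of_lt_of_le (volI_pos_of_isOpen (U := {y : 𝕀 | (y : ℝ) < 1 / 2}) ?_ ?_)
    (measure_mono fun y hy => ?_)
  · exact isOpen_lt continuous_subtype_val continuous_const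
  · exact ⟨0, by simp⟩
  · have hy : (y : ℝ) < 1 / 2 := hy
    exact ⟨by simpa using Real.rpow_pos_of_pos hη _, hy.le⟩

/-- Antitone functions are positively correlated with the event `x ≤ 1/2`. -/
lemma halfProb_mul_lintegral_le (hη : 0 < η) {h : 𝕀 → ℝ≥0∞} (hanti : Antitone h) :
    halfProb η * ∫⁻ x, h x ∂fugMeasure η
      ≤ ∫⁻ x in {x : 𝕀 | (x : ℝ) ≤ 1 / 2}, h x ∂fugMeasure η := by
  have := isProbabilityMeasure_fugMeasure hη
  set S := {x : 𝕀 | (x : ℝ) ≤ 1 / 2}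
  have hS : MeasurableSet S := measurableSet_coe_le _
  set m : 𝕀 := ⟨1 / 2, by norm_num, by norm_num⟩
  have ha : halfProb η * h m ≤ ∫⁻ x in S, h x ∂fugMeasure η := by
    rw [mul_comm, halfProb, ← setLIntegral_const]
    exact setLIntegral_mono' hS fun x hx => hanti hx
  have hb : ∫⁻ x in Sᶜ, h x ∂fugMeasure η ≤ h m * fugMeasure η Sᶜ := by
    rw [← setLIntegral_const]
    exact setLIntegral_mono' hS.compl fun x hx => hanti (le_of_lt (not_le.1 hx))
  have hc : halfProb η + fugMeasure η Sᶜ = 1 := prob_add_prob_compl hS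
  rw [← lintegral_add_compl h hS, mul_add]
  have hd : halfProb η * ∫⁻ x in Sᶜ, h x ∂fugMeasure η
      ≤ fugMeasure η Sᶜ * ∫⁻ x in S, h x ∂fugMeasure η :=
    calc _ ≤ halfProb η * (h m * fugMeasure η Sᶜ) := by gcongr
      _ = fugMeasure η Sᶜ * (halfProb η * h m) := by ring
      _ ≤ _ := by gcongr
  refine (add_le_add le_rfl hd).trans_eq ?_
  rw [← add_mul, hc, one_mul]

lemma antitone_rootLaw_add_le (hη : 0 < η) {r : ℕ} (ts : Fin r → PlaneTree) :
    Antitone fun x : 𝕀 => ∏ i, rootLaw hη (ts i) {y | (x : ℝ) + (y : ℝ) ≤ 1} := by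
  intro x x' hx
  refine Finset.prod_le_prod' fun i _ => measure_mono fun y hy => ?_
  have : (x : ℝ) ≤ x' := hx
  simp only [Set.mem_ofPred_eq] at hy ⊢
  linarith

lemma rootProb_ne_zero (hη : 0 < η) {r : ℕ} (ts : Fin r → PlaneTree) : rootProb hη ts ≠ 0 := by
  rw [rootProb_eq, ne_eq, ENNReal.ofReal_eq_zero, not_le]
  exact mul_pos (inv_pos.2 (upsilon_pos hη)) (rootMass_pos hη ts)

lemma rootProb_ne_top (hη : 0 < η) {r : ℕ} (ts : Fin r → PlaneTree) : rootProb hη ts ≠ ⊤ := by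
  rw [rootProb_eq]; exact ENNReal.ofReal_ne_top

lemma halfProb_le_rootLaw (hη : 0 < η) (t : PlaneTree) :
    halfProb η ≤ rootLaw hη t {x | (x : ℝ) ≤ 1 / 2} := by
  obtain ⟨r, ts⟩ := t
  have hS := measurableSet_coe_le (1 / 2)
  have h1 := lintegral_rootLaw_mk hη ts (φ := {x : 𝕀 | (x : ℝ) ≤ 1 / 2}.indicator 1)
    (measurable_one.indicator hS)
  have h2 : ∀ x : 𝕀, {x : 𝕀 | (x : ℝ) ≤ 1 / 2}.indicator (1 : 𝕀 → ℝ≥0∞) x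
      * ∏ i, rootLaw hη (ts i) {y | (x : ℝ) + (y : ℝ) ≤ 1}
      = {x : 𝕀 | (x : ℝ) ≤ 1 / 2}.indicator
        (fun x => ∏ i, rootLaw hη (ts i) {y | (x : ℝ) + (y : ℝ) ≤ 1}) x := by
    intro x
    by_cases hx : x ∈ {x : 𝕀 | (x : ℝ) ≤ 1 / 2} <;> simp [Set.indicator]
  simp_rw [h2] at h1
  rw [lintegral_indicator_one hS, lintegral_indicator hS] at h1
  have h3 := halfProb_mul_lintegral_le hη (antitone_rootLaw_add_le hη ts)
  rw [← h1, mul_comm] at h3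
  exact (ENNReal.mul_le_mul_iff_right (rootProb_ne_zero hη ts) (rootProb_ne_top hη ts)).1 h3

lemma halfProb_pow_le_rootProb (hη : 0 < η) {r : ℕ} (ts : Fin r → PlaneTree) :
    halfProb η ^ (r + 1) ≤ rootProb hη ts := by
  have hS := measurableSet_coe_le (1 / 2)
  calc halfProb η ^ (r + 1) = ∫⁻ _ in {x : 𝕀 | (x : ℝ) ≤ 1 / 2}, halfProb η ^ r ∂fugMeasure η := by
        rw [setLIntegral_const, pow_succ]; rfl
    _ ≤ ∫⁻ x in {x : 𝕀 | (x : ℝ) ≤ 1 / 2},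
          ∏ i, rootLaw hη (ts i) {y | (x : ℝ) + (y : ℝ) ≤ 1} ∂fugMeasure η := by
        refine setLIntegral_mono' hS fun x hx => ?_
        calc halfProb η ^ r = ∏ _i : Fin r, halfProb η := by simp
          _ ≤ _ := Finset.prod_le_prod' fun i _ => (halfProb_le_rootLaw hη (ts i)).trans
              (measure_mono fun y hy => ?_)
        simp only [Set.mem_ofPred_eq] at hx hy ⊢
        linarith
    _ ≤ rootProb hη ts := setLIntegral_le_lintegral _ _

lemma rootProb_le_one (hη : 0 < η) {r : ℕ} (ts : Fin r → PlaneTree) : rootProb hη ts ≤ 1 := by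
  have := isProbabilityMeasure_fugMeasure hη
  calc rootProb hη ts ≤ ∫⁻ _, 1 ∂fugMeasure η :=
        lintegral_mono fun x => Finset.prod_le_one' fun i _ => prob_le_one
    _ = 1 := by simp

lemma norm_density_le (hη : 0 < η) {r : ℕ} (ts : Fin r → PlaneTree) :
    ‖density hη ⟨r, ts⟩‖ ≤ (max 1 η / upsilon η) * ((halfProb η).toReal ^ (r + 1))⁻¹ := by
  have hU := upsilon_pos hη
  have hM := rootMass_pos hη ts
  have hc : 0 < (halfProb η).toReal :=
    ENNReal.toReal_pos (halfProb_pos hη).ne' ((halfProb_le_one hη).trans_lt ENNReal.one_lt_top).ne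
  have hmass : upsilon η * (halfProb η).toReal ^ (r + 1) ≤ rootMass hη ts := by
    have h := ENNReal.toReal_mono (rootProb_ne_top hη ts) (halfProb_pow_le_rootProb hη ts)
    rw [ENNReal.toReal_pow, rootProb_eq, ENNReal.toReal_ofReal (by positivity),
      inv_mul_eq_div, le_div_iff₀ hU, mul_comm] at h
    exact h
  rw [ContinuousMap.norm_le _ (by positivity)]
  intro x
  rw [Real.norm_of_nonneg ((density_props hη _).1 x), density_mk]
  have hnum : η ^ (x : ℝ) * ∏ k, cdf (density hη (ts k)) (1 - (x : ℝ)) ≤ max 1 η := by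
    have hp : ∏ k, cdf (density hη (ts k)) (1 - (x : ℝ)) ≤ 1 := by
      refine Finset.prod_le_one (fun _ _ => cdf_density_nonneg hη _ _) fun k _ => ?_
      exact (setIntegral_le_integral (integrable_volI_of_continuous (map_continuous _))
        (Eventually.of_forall (density_props hη _).1)).trans_eq (density_props hη (ts k)).2.2
    have hr : η ^ (x : ℝ) ≤ max 1 η := by
      rcases le_total η 1 with h | h
      · exact (Real.rpow_le_one hη.le h x.2.1).trans (le_max_left _ _)
      · exact (Real.rpow_le_rpow_of_exponent_le h x.2.2).trans (by simp)
    calc _ ≤ η ^ (x : ℝ) * 1 := mul_le_mul_of_nonneg_left hp (Real.rpow_nonneg hη.le _)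
      _ ≤ _ := by rwa [mul_one]
  calc _ ≤ max 1 η / (upsilon η * (halfProb η).toReal ^ (r + 1)) := by gcongr
    _ = _ := by field_simp

end Densities

section GaltonWatson

open ProbabilityTheory

lemma poisson_pgf (c : ℝ≥0) {x : ℝ} (hx : 0 ≤ x) :
    ∑' r : ℕ, poissonMeasure c {r} * ENNReal.ofReal x ^ r
      = ENNReal.ofReal (Real.exp (c * (x - 1))) := by
  have h : HasSum (fun r : ℕ => Real.exp (-c) * (((c : ℝ) * x) ^ r / (r.factorial : ℝ)))
      (Real.exp (-c) * Real.exp (c * x)) := by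
    have h := NormedSpace.expSeries_div_hasSum_exp ((c : ℝ) * x)
    rw [← Real.exp_eq_exp_ℝ] at h
    exact h.mul_left _
  rw [mul_sub, mul_one, sub_eq_neg_add, Real.exp_add, ← h.tsum_eq,
    ENNReal.ofReal_tsum_of_nonneg (fun r => by positivity) h.summable]
  congr with r
  rw [poissonMeasure_singleton, ← ENNReal.ofReal_pow hx, ← ENNReal.ofReal_mul (by positivity)]
  congr 1
  rw [mul_pow]; ring

lemma tsum_poissonMeasure_singleton (c : ℝ≥0) : ∑' r : ℕ, poissonMeasure c {r} = 1 := by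
  simpa using poisson_pgf c (zero_le_one)

lemma tsum_prod_fin {X : Type*} (f : X → ℝ≥0∞) (r : ℕ) :
    ∑' ts : Fin r → X, ∏ i, f (ts i) = (∑' x, f x) ^ r := by
  induction r with
  | zero => simp
  | succ r ih =>
    rw [← (Fin.consEquiv fun _ => X).tsum_eq, ENNReal.tsum_prod', pow_succ', ← ih,
      ← ENNReal.tsum_mul_right]
    congr with x
    rw [← ENNReal.tsum_mul_left]
    congr with ts
    simp [Fin.prod_univ_succ, Fin.consEquiv]

lemma tsum_planeTree (F : PlaneTree → ℝ≥0∞) :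
    ∑' t, F t = ∑' r : ℕ, ∑' ts : Fin r → PlaneTree, F ⟨r, ts⟩ := by
  rw [← (WType.equivSigma (fun n : ℕ => Fin n)).symm.tsum_eq, ENNReal.tsum_sigma']
  rfl

lemma depth_mk_le_succ {r n : ℕ} (ts : Fin r → PlaneTree) :
    WType.depth (⟨r, ts⟩ : PlaneTree) ≤ n + 1 ↔ ∀ i, (ts i).depth ≤ n := by
  simp [WType.depth]

/-- The probability of a tree under the Galton–Watson law with Poisson offspring. -/
noncomputable def treeWeight (c : ℝ≥0) : PlaneTree → ℝ≥0∞
  | ⟨r, ts⟩ => poissonMeasure c {r} * ∏ i, treeWeight c (ts i)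

lemma treeWeight_mk (c : ℝ≥0) {r : ℕ} (ts : Fin r → PlaneTree) :
    treeWeight c ⟨r, ts⟩ = poissonMeasure c {r} * ∏ i, treeWeight c (ts i) := rfl

lemma tsum_treeWeight_depth_le (c : ℝ≥0) (n : ℕ) :
    ∑' t : PlaneTree, (if t.depth ≤ n then treeWeight c t else 0) ≤ 1 := by
  induction n with
  | zero =>
    have h : ∀ t : PlaneTree, ¬ t.depth ≤ 0 := fun t => not_le.2 (WType.depth_pos t)
    simp [h]
  | succ n ih =>
    rw [tsum_planeTree, ← tsum_poissonMeasure_singleton c]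
    refine ENNReal.tsum_le_tsum fun r => ?_
    have h : ∀ ts : Fin r → PlaneTree,
        (if WType.depth (⟨r, ts⟩ : PlaneTree) ≤ n + 1 then treeWeight c ⟨r, ts⟩ else 0)
          = poissonMeasure c {r} * ∏ i, if (ts i).depth ≤ n then treeWeight c (ts i) else 0 := by
      intro ts
      rw [Finset.prod_ite_zero, treeWeight_mk]
      simp [depth_mk_le_succ]
    simp_rw [h]
    rw [ENNReal.tsum_mul_left,
      tsum_prod_fin (fun t : PlaneTree => if t.depth ≤ n then treeWeight c t else 0) r]
    exact mul_le_of_le_one_right' (pow_le_one' ih r)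

lemma tsum_treeWeight_le_one (c : ℝ≥0) : ∑' t, treeWeight c t ≤ 1 := by
  rw [ENNReal.tsum_eq_iSup_sum]
  refine iSup_le fun s => ?_
  refine le_trans ?_ (tsum_treeWeight_depth_le c (s.sup WType.depth))
  refine le_trans (le_of_eq ?_) (ENNReal.sum_le_tsum s)
  exact Finset.sum_congr rfl fun t ht => (if_pos (Finset.le_sup ht)).symm

/-- A Poisson Galton–Watson tree with mean offspring at most one is almost surely finite. -/
lemma tsum_treeWeight {c : ℝ≥0} (hc : c ≤ 1) : ∑' t, treeWeight c t = 1 := by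
  set Q := ∑' t, treeWeight c t with hQ
  have hQ1 : Q ≤ 1 := tsum_treeWeight_le_one c
  have hQtop : Q ≠ ⊤ := (hQ1.trans_lt ENNReal.one_lt_top).ne
  have hfix : Q = ENNReal.ofReal (Real.exp (c * (Q.toReal - 1))) := by
    rw [← poisson_pgf c ENNReal.toReal_nonneg, ENNReal.ofReal_toReal hQtop]
    conv_lhs => rw [hQ, tsum_planeTree]
    simp_rw [treeWeight_mk, ENNReal.tsum_mul_left, tsum_prod_fin, ← hQ]
  have hreal : Q.toReal = Real.exp (c * (Q.toReal - 1)) := by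
    conv_lhs => rw [hfix]
    exact ENNReal.toReal_ofReal (Real.exp_pos _).le
  have hle : Q.toReal ≤ 1 := by simpa using ENNReal.toReal_mono ENNReal.one_ne_top hQ1
  have hc' : (c : ℝ) ≤ 1 := by exact_mod_cast hc
  have hone : Q.toReal = 1 := by
    by_contra hne
    have hlt : Q.toReal - 1 < 0 := sub_neg.2 (lt_of_le_of_ne hle hne)
    rcases eq_or_ne c 0 with h0 | h0
    · rw [h0] at hreal; simp at hreal; exact hne hreal
    · have h1 := Real.add_one_lt_exp (x := c * (Q.toReal - 1))
        (mul_ne_zero (by exact_mod_cast h0) hlt.ne)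
      rw [← hreal] at h1
      nlinarith
  rw [← ENNReal.ofReal_toReal hQtop, hone, ENNReal.ofReal_one]

instance : MeasurableSpace PlaneTree := ⊤

instance : DiscreteMeasurableSpace PlaneTree := ⟨fun _ => trivial⟩

/-- The Poisson Galton–Watson law on finite plane trees. -/
noncomputable def gwMeasure (c : ℝ≥0) : Measure PlaneTree :=
  Measure.sum fun t => treeWeight c t • Measure.dirac t

lemma gwMeasure_singleton (c : ℝ≥0) (t : PlaneTree) : gwMeasure c {t} = treeWeight c t :=
  Measure.sum_smul_dirac_singleton

lemma isProbabilityMeasure_gwMeasure {c : ℝ≥0} (hc : c ≤ 1) :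
    IsProbabilityMeasure (gwMeasure c) where
  measure_univ := by
    rw [gwMeasure, Measure.sum_apply _ MeasurableSet.univ]
    simpa using tsum_treeWeight hc

lemma lintegral_gwMeasure {c : ℝ≥0} (hc : c ≤ 1) (F : PlaneTree → ℝ≥0∞) :
    ∫⁻ t, F t ∂gwMeasure c = ∑' r : ℕ, poissonMeasure c {r} *
      ∫⁻ ts : Fin r → PlaneTree, F ⟨r, ts⟩ ∂Measure.pi fun _ => gwMeasure c := by
  have := isProbabilityMeasure_gwMeasure hc
  rw [lintegral_countable', tsum_planeTree]
  congr with r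
  rw [lintegral_countable', ← ENNReal.tsum_mul_left]
  congr with ts
  rw [Measure.pi_singleton, gwMeasure_singleton, treeWeight_mk]
  simp_rw [gwMeasure_singleton]
  ring

lemma gwMeasure_apply {c : ℝ≥0} (hc : c ≤ 1) (S : Set PlaneTree) :
    gwMeasure c S = ∑' r : ℕ, poissonMeasure c {r} *
      (Measure.pi fun _ : Fin r => gwMeasure c) {ts | (⟨r, ts⟩ : PlaneTree) ∈ S} := by
  rw [← lintegral_indicator_one (MeasurableSet.of_discrete (s := S)), lintegral_gwMeasure hc]
  congr with r
  rw [← lintegral_indicator_one (MeasurableSet.of_discrete (s := {ts | _}))]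
  rfl

lemma pi_le_pi {X : Type*} [MeasurableSpace X] {r : ℕ} {μ ν : Measure X} [SigmaFinite μ]
    [SigmaFinite ν] (h : μ ≤ ν) :
    (Measure.pi fun _ : Fin r => μ) ≤ Measure.pi fun _ : Fin r => ν := by
  have key : (Measure.pi fun _ : Fin r => μ).toOuterMeasure
      ≤ OuterMeasure.pi fun _ : Fin r => ν.toOuterMeasure := by
    refine OuterMeasure.le_pi.2 fun s _ => ?_
    change (Measure.pi fun _ : Fin r => μ) (Set.univ.pi s) ≤ ∏ i, ν (s i)
    rw [Measure.pi_pi]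
    exact Finset.prod_le_prod' fun i _ => h (s i)
  refine Measure.le_iff.2 fun s hs => ?_
  refine (key s).trans_eq ?_
  rw [Measure.pi, toMeasure_apply _ _ hs]

section FixedPoint

local notation "𝕀" => Set.Elem (Set.Icc (0:ℝ) 1)

variable {η : ℝ} {c : ℝ≥0}

lemma halfProb_toReal_pos (hη : 0 < η) : 0 < (halfProb η).toReal :=
  ENNReal.toReal_pos (halfProb_pos hη).ne' ((halfProb_le_one hη).trans_lt ENNReal.one_lt_top).ne

lemma halfProb_toReal_le_one (hη : 0 < η) : (halfProb η).toReal ≤ 1 := by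
  simpa using ENNReal.toReal_mono ENNReal.one_ne_top (halfProb_le_one hη)

lemma hcVal_mem_image_iff (hη : 0 < η) {r : ℕ} (ts : Fin r → PlaneTree) (A : Set C(𝕀, ℝ)) :
    (fun t => hcVal η (fun i => density hη (ts i)) t) ∈ DFunLike.coe '' A
      ↔ density hη ⟨r, ts⟩ ∈ A := by
  constructor
  · rintro ⟨f, hf, hfe⟩
    have : f = density hη ⟨r, ts⟩ := DFunLike.coe_injective hfe
    rwa [← this]
  · intro h
    exact ⟨_, h, rfl⟩

variable [MeasurableSpace C(𝕀, ℝ)]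

/-- The law of the root density of a Poisson Galton–Watson tree. -/
noncomputable def rootDensityLaw (hη : 0 < η) (c : ℝ≥0) : Measure C(𝕀, ℝ) :=
  (gwMeasure c).map (density hη)

lemma isProbabilityMeasure_rootDensityLaw (hη : 0 < η) (hc : c ≤ 1) :
    IsProbabilityMeasure (rootDensityLaw hη c) := by
  have := isProbabilityMeasure_gwMeasure hc
  exact Measure.isProbabilityMeasure_map (Measurable.of_discrete).aemeasurable

lemma rootDensityLaw_inX0 (hη : 0 < η) (hc : c ≤ 1) : rootDensityLaw hη c {f | InX0 f} = 1 := by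
  have := isProbabilityMeasure_gwMeasure hc
  have := isProbabilityMeasure_rootDensityLaw hη hc
  refine le_antisymm prob_le_one ?_
  refine le_trans ?_ (Measure.le_map_apply (Measurable.of_discrete).aemeasurable _)
  rw [show density hη ⁻¹' {f | InX0 f} = Set.univ from Set.eq_univ_of_forall (inX0_density hη),
    measure_univ]

lemma memPr1X0_rootDensityLaw [BorelSpace C(𝕀, ℝ)] (hη : 0 < η) (hc : c ≤ 1) :
    MemPr1X0 (rootDensityLaw hη c) := by
  have := isProbabilityMeasure_gwMeasure hc
  refine ⟨isProbabilityMeasure_rootDensityLaw hη hc, ?_, rootDensityLaw_inX0 hη hc⟩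
  rw [rootDensityLaw, integrable_map_measure continuous_norm.aestronglyMeasurable
    (Measurable.of_discrete).aemeasurable]
  refine ⟨(Measurable.of_discrete).aestronglyMeasurable, ?_⟩
  rw [HasFiniteIntegral, lintegral_gwMeasure hc]
  have hh := halfProb_toReal_pos hη
  have hU := upsilon_pos hη
  set K : ℝ := max 1 η / upsilon η * (halfProb η).toReal⁻¹
  have hb : ∀ r : ℕ, poissonMeasure c {r} *
      ∫⁻ ts : Fin r → PlaneTree, ‖((fun f : C(𝕀, ℝ) => ‖f‖) ∘ density hη) ⟨r, ts⟩‖ₑ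
        ∂Measure.pi (fun _ => gwMeasure c)
      ≤ ENNReal.ofReal K * (poissonMeasure c {r} * ENNReal.ofReal ((halfProb η).toReal⁻¹) ^ r) := by
    intro r
    rw [mul_left_comm]
    gcongr
    calc _ ≤ ∫⁻ _ : Fin r → PlaneTree, ENNReal.ofReal K * ENNReal.ofReal ((halfProb η).toReal⁻¹) ^ r
          ∂Measure.pi (fun _ => gwMeasure c) := by
          refine lintegral_mono fun ts => ?_
          rw [Function.comp_apply, enorm_norm, ← ofReal_norm,
            ← ENNReal.ofReal_pow (by positivity), ← ENNReal.ofReal_mul (by positivity)]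
          refine ENNReal.ofReal_le_ofReal ((norm_density_le hη ts).trans_eq ?_)
          rw [inv_pow, pow_succ, mul_inv]
          ring
      _ = _ := by simp
  refine (ENNReal.tsum_le_tsum hb).trans_lt ?_
  rw [ENNReal.tsum_mul_left, poisson_pgf c (by positivity)]
  exact ENNReal.mul_lt_top ENNReal.ofReal_lt_top ENNReal.ofReal_lt_top

lemma pi_preimage_density_le (hη : 0 < η) (μ : Measure PlaneTree) [IsFiniteMeasure μ]
    (lam : Measure C(𝕀, ℝ)) [IsFiniteMeasure lam] (h : μ.map (density hη) ≤ lam) {r : ℕ}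
    (A : Set C(𝕀, ℝ)) :
    (Measure.pi fun _ : Fin r => μ) {ts | density hη ⟨r, ts⟩ ∈ A}
      ≤ (Measure.pi fun _ : Fin r => lam) {q | (fun t => hcVal η q t) ∈ DFunLike.coe '' A} := by
  refine le_trans ?_ (pi_le_pi h _)
  rw [← Measure.pi_map_pi fun _ => (Measurable.of_discrete).aemeasurable]
  refine le_trans (measure_mono fun ts hts => ?_)
    (Measure.le_map_apply (Measurable.of_discrete).aemeasurable _)
  exact (hcVal_mem_image_iff hη ts A).2 hts

lemma IsHcOp.rootDensityLaw_eq [BorelSpace C(𝕀, ℝ)] {α : ℝ≥0}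
    {T : Measure C(𝕀, ℝ) → Measure C(𝕀, ℝ)} (hT : IsHcOp η α T) (hη : 0 < η) (hα : 2 * α ≤ 1) :
    T (rootDensityLaw hη (2 * α)) = rootDensityLaw hη (2 * α) := by
  have := isProbabilityMeasure_gwMeasure hα
  have := isProbabilityMeasure_rootDensityLaw hη hα
  have hmem := memPr1X0_rootDensityLaw hη hα
  have hle : rootDensityLaw hη (2 * α) ≤ T (rootDensityLaw hη (2 * α)) := by
    refine Measure.le_iff.2 fun A hA => ?_
    rw [hT _ hmem A hA, rootDensityLaw, Measure.map_apply .of_discrete hA, gwMeasure_apply hα]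
    refine ENNReal.tsum_le_tsum fun r => mul_le_mul_right ?_ _
    exact pi_preimage_density_le hη _ _ le_rfl A
  refine (Measure.eq_of_le_of_measure_univ_eq hle ?_).symm
  refine le_antisymm (hle _) ?_
  rw [hT _ hmem _ MeasurableSet.univ, measure_univ, ← tsum_poissonMeasure_singleton (2 * α)]
  exact ENNReal.tsum_le_tsum fun r => mul_le_of_le_one_right' prob_le_one

lemma IsHcOp.eq_rootDensityLaw [BorelSpace C(𝕀, ℝ)] {α : ℝ≥0}
    {T : Measure C(𝕀, ℝ) → Measure C(𝕀, ℝ)} (hT : IsHcOp η α T) (hη : 0 < η) (hα : 2 * α ≤ 1)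
    {lam : Measure C(𝕀, ℝ)} (hlam : MemPr1X0 lam) (hfix : T lam = lam) :
    lam = rootDensityLaw hη (2 * α) := by
  have := isProbabilityMeasure_gwMeasure hα
  have := isProbabilityMeasure_rootDensityLaw hη hα
  have := hlam.1
  have hn : ∀ n : ℕ, ((gwMeasure (2 * α)).restrict {t | t.depth ≤ n}).map (density hη) ≤ lam := by
    intro n
    induction n with
    | zero =>
      have h : {t : PlaneTree | t.depth ≤ 0} = ∅ :=
        Set.eq_empty_of_forall_notMem fun t => not_le.2 (WType.depth_pos t)
      rw [h, Measure.restrict_empty, Measure.map_zero]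
      exact Measure.zero_le _
    | succ n ih =>
      refine Measure.le_iff.2 fun A hA => ?_
      rw [← hfix, hT _ hlam A hA, Measure.map_apply .of_discrete hA,
        Measure.restrict_apply .of_discrete, gwMeasure_apply hα]
      refine ENNReal.tsum_le_tsum fun r => mul_le_mul_right ?_ _
      refine le_trans (le_of_eq ?_) (pi_preimage_density_le hη _ _ ih A)
      rw [← Measure.restrict_pi_pi, Measure.restrict_apply .of_discrete]
      congr 1
      ext ts
      simp only [Set.mem_inter_iff, Set.mem_preimage, Set.mem_ofPred_eq, Set.mem_pi,
        Set.mem_univ, true_imp_iff, depth_mk_le_succ]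
  have hle : rootDensityLaw hη (2 * α) ≤ lam := by
    refine Measure.le_iff.2 fun A hA => ?_
    rw [rootDensityLaw, Measure.map_apply .of_discrete hA]
    have hU : density hη ⁻¹' A = ⋃ n : ℕ, density hη ⁻¹' A ∩ {t | t.depth ≤ n} := by
      rw [← Set.inter_iUnion, Set.inter_eq_left.2]
      exact fun t _ => Set.mem_iUnion.2 ⟨t.depth, le_refl t.depth⟩
    rw [hU, Monotone.measure_iUnion]
    · refine iSup_le fun n => ?_
      refine le_trans (le_of_eq ?_) (hn n A)
      rw [Measure.map_apply .of_discrete hA, Measure.restrict_apply .of_discrete]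
    · intro m n hmn t ht
      exact ⟨ht.1, le_trans ht.2 hmn⟩
  exact (Measure.eq_of_le_of_isProbabilityMeasure hle).symm

end FixedPoint

end GaltonWatson

section Functional

open ProbabilityTheory

local notation "𝕀" => Set.Elem (Set.Icc (0:ℝ) 1)

lemma aemeasurable_map_of_countable {X Y : Type*} [MeasurableSpace X] [MeasurableSpace Y]
    [Countable X] [MeasurableSingletonClass X] [MeasurableSingletonClass Y] (μ : Measure X)
    {f : X → Y} (hf : Measurable f) (Φ : Y → ℝ) : AEMeasurable Φ (μ.map f) := by
  rw [← Measure.sum_smul_dirac μ, Measure.map_sum hf.aemeasurable, aemeasurable_sum_measure_iff]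
  intro x
  rw [Measure.map_smul, Measure.map_dirac' hf]
  exact aemeasurable_dirac.smul_measure _

lemma integral_map_of_countable {X Y : Type*} [MeasurableSpace X] [MeasurableSpace Y]
    [Countable X] [MeasurableSingletonClass X] [MeasurableSingletonClass Y] (μ : Measure X)
    {f : X → Y} (hf : Measurable f) (Φ : Y → ℝ) :
    ∫ y, Φ y ∂μ.map f = ∫ x, Φ (f x) ∂μ :=
  integral_map hf.aemeasurable (aemeasurable_map_of_countable μ hf Φ).aestronglyMeasurable

/-- The number of children of the root. -/
def arity : PlaneTree → ℕ
  | ⟨r, _⟩ => r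

lemma tsum_poisson_mul_self (c : ℝ≥0) :
    ∑' r : ℕ, poissonMeasure c {r} * (r : ℝ≥0∞) = c := by
  rw [tsum_eq_zero_add' ENNReal.summable]
  simp only [Nat.cast_zero, mul_zero, zero_add]
  have h : ∀ r : ℕ, poissonMeasure c {r + 1} * ((r + 1 : ℕ) : ℝ≥0∞)
      = c * poissonMeasure c {r} := by
    intro r
    rw [poissonMeasure_singleton, poissonMeasure_singleton, ← ENNReal.ofReal_natCast,
      ← ENNReal.ofReal_mul (by positivity), ← ENNReal.ofReal_coe_nnreal,
      ← ENNReal.ofReal_mul (NNReal.coe_nonneg c)]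
    congr 1
    rw [Nat.factorial_succ]
    push_cast
    field_simp
    ring
  simp_rw [h]
  rw [ENNReal.tsum_mul_left, tsum_poissonMeasure_singleton, mul_one]

variable {c : ℝ≥0}

lemma lintegral_arity (hc : c ≤ 1) : ∫⁻ t, (arity t : ℝ≥0∞) ∂gwMeasure c = c := by
  have := isProbabilityMeasure_gwMeasure hc
  rw [lintegral_gwMeasure hc, ← tsum_poisson_mul_self c]
  simp [arity]

lemma integrable_arity (hc : c ≤ 1) : Integrable (fun t => (arity t : ℝ)) (gwMeasure c) := by
  refine ⟨(Measurable.of_discrete).aestronglyMeasurable, ?_⟩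
  rw [HasFiniteIntegral]
  simp only [Real.enorm_natCast]
  rw [lintegral_arity hc]
  exact ENNReal.coe_lt_top

lemma integral_arity (hc : c ≤ 1) : ∫ t, (arity t : ℝ) ∂gwMeasure c = c := by
  rw [integral_eq_lintegral_of_nonneg_ae (Eventually.of_forall fun t => Nat.cast_nonneg _)
    (Measurable.of_discrete).aestronglyMeasurable]
  simp only [ENNReal.ofReal_natCast]
  rw [lintegral_arity hc, ENNReal.coe_toReal]

lemma hasSum_integral_gwMeasure (hc : c ≤ 1) {F : PlaneTree → ℝ}
    (hF : Integrable F (gwMeasure c)) :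
    HasSum (fun r : ℕ => (poissonMeasure c {r}).toReal *
      ∫ ts : Fin r → PlaneTree, F ⟨r, ts⟩ ∂Measure.pi fun _ => gwMeasure c)
      (∫ t, F t ∂gwMeasure c) := by
  have := isProbabilityMeasure_gwMeasure hc
  have heq : gwMeasure c = Measure.sum fun r : ℕ => poissonMeasure c {r} •
      (Measure.pi fun _ : Fin r => gwMeasure c).map fun ts => (⟨r, ts⟩ : PlaneTree) := by
    ext S hS
    rw [gwMeasure_apply hc, Measure.sum_apply _ hS]
    congr with r
    rw [Measure.smul_apply, Measure.map_apply .of_discrete hS, smul_eq_mul]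
    rfl
  rw [heq] at hF
  have h := hasSum_integral_measure hF
  rw [← heq] at h
  refine h.congr_fun fun r => ?_
  rw [integral_smul_measure, integral_map_of_countable _ .of_discrete, smul_eq_mul]

variable {η : ℝ}

/-- The log-probability gained by removing the root constraints. -/
noncomputable def rootLog (hη : 0 < η) : PlaneTree → ℝ
  | ⟨_, ts⟩ => Real.log (rootProb hη ts).toReal

/-- The probability that two independent root spins are compatible. -/
noncomputable def pairProb (hη : 0 < η) (t₁ t₂ : PlaneTree) : ℝ≥0∞ :=
  ∫⁻ x, rootLaw hη t₁ {y | (x : ℝ) + (y : ℝ) ≤ 1} ∂rootLaw hη t₂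

/-- The logarithm of `pairProb`. -/
noncomputable def pairLog (hη : 0 < η) (t₁ t₂ : PlaneTree) : ℝ :=
  Real.log (pairProb hη t₁ t₂).toReal

/-- The cost, in log-probability, of one constraint. -/
noncomputable def halfLog (η : ℝ) : ℝ := -Real.log (halfProb η).toReal

lemma halfLog_nonneg (hη : 0 < η) : 0 ≤ halfLog η :=
  neg_nonneg.2 (Real.log_nonpos ENNReal.toReal_nonneg (halfProb_toReal_le_one hη))

lemma abs_log_toReal_le (hη : 0 < η) {p : ℝ≥0∞} {k : ℕ} (h1 : halfProb η ^ k ≤ p) (h2 : p ≤ 1) :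
    |Real.log p.toReal| ≤ k * halfLog η := by
  have hp := (h2.trans_lt ENNReal.one_lt_top).ne
  have h1' := ENNReal.toReal_mono hp h1
  have h2' : p.toReal ≤ 1 := by simpa using ENNReal.toReal_mono ENNReal.one_ne_top h2
  rw [ENNReal.toReal_pow] at h1'
  have h3 := Real.log_le_log (pow_pos (halfProb_toReal_pos hη) k) h1'
  rw [Real.log_pow] at h3
  rw [abs_of_nonpos (Real.log_nonpos ENNReal.toReal_nonneg h2'), halfLog]
  linarith

lemma abs_rootLog_le (hη : 0 < η) (t : PlaneTree) : |rootLog hη t| ≤ (arity t + 1) * halfLog η := by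
  obtain ⟨r, ts⟩ := t
  have h := abs_log_toReal_le hη (halfProb_pow_le_rootProb hη ts) (rootProb_le_one hη ts)
  push_cast at h
  exact h

lemma rootLog_nonpos (hη : 0 < η) (t : PlaneTree) : rootLog hη t ≤ 0 := by
  obtain ⟨r, ts⟩ := t
  refine Real.log_nonpos ENNReal.toReal_nonneg ?_
  simpa using ENNReal.toReal_mono ENNReal.one_ne_top (rootProb_le_one hη ts)

lemma pairProb_le_one (hη : 0 < η) (t₁ t₂ : PlaneTree) : pairProb hη t₁ t₂ ≤ 1 :=
  calc pairProb hη t₁ t₂ ≤ ∫⁻ _, 1 ∂rootLaw hη t₂ := lintegral_mono fun x => prob_le_one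
    _ = 1 := by simp

lemma halfProb_sq_le_pairProb (hη : 0 < η) (t₁ t₂ : PlaneTree) :
    halfProb η ^ 2 ≤ pairProb hη t₁ t₂ := by
  have hS := measurableSet_coe_le (1 / 2)
  calc halfProb η ^ 2 ≤ halfProb η * rootLaw hη t₂ {x | (x : ℝ) ≤ 1 / 2} := by
        rw [sq]; gcongr; exact halfProb_le_rootLaw hη t₂
    _ = ∫⁻ _ in {x : 𝕀 | (x : ℝ) ≤ 1 / 2}, halfProb η ∂rootLaw hη t₂ := by
        rw [setLIntegral_const]
    _ ≤ ∫⁻ x in {x : 𝕀 | (x : ℝ) ≤ 1 / 2}, rootLaw hη t₁ {y | (x : ℝ) + (y : ℝ) ≤ 1}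
          ∂rootLaw hη t₂ := by
        refine setLIntegral_mono' hS fun x hx => (halfProb_le_rootLaw hη t₁).trans
          (measure_mono fun y hy => ?_)
        simp only [Set.mem_ofPred_eq] at hx hy ⊢
        linarith
    _ ≤ pairProb hη t₁ t₂ := setLIntegral_le_lintegral _ _

lemma abs_pairLog_le (hη : 0 < η) (t₁ t₂ : PlaneTree) : |pairLog hη t₁ t₂| ≤ 2 * halfLog η := by
  have h := abs_log_toReal_le hη (halfProb_sq_le_pairProb hη t₁ t₂) (pairProb_le_one hη t₁ t₂)
  push_cast at h
  exact h

lemma pairLog_nonpos (hη : 0 < η) (t₁ t₂ : PlaneTree) : pairLog hη t₁ t₂ ≤ 0 := by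
  refine Real.log_nonpos ENNReal.toReal_nonneg ?_
  simpa using ENNReal.toReal_mono ENNReal.one_ne_top (pairProb_le_one hη t₁ t₂)

lemma pairProb_toReal (hη : 0 < η) (t₁ t₂ : PlaneTree) :
    (pairProb hη t₁ t₂).toReal
      = ∫ x : 𝕀, cdf (density hη t₁) (1 - (x : ℝ)) * density hη t₂ x ∂volI := by
  rw [pairProb, rootLaw, lintegral_withDensity_eq_lintegral_mul _
    (map_continuous (density hη t₂)).measurable.ennreal_ofReal (measurable_rootLaw_add_le hη t₁)]
  have h : ∀ x : 𝕀, ((fun x => ENNReal.ofReal (density hη t₂ x)) *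
      fun x : 𝕀 => rootLaw hη t₁ {y | (x : ℝ) + (y : ℝ) ≤ 1}) x
      = ENNReal.ofReal (cdf (density hη t₁) (1 - (x : ℝ)) * density hη t₂ x) := by
    intro x
    rw [Pi.mul_apply, rootLaw_add_le, mul_comm,
      ENNReal.ofReal_mul (cdf_density_nonneg hη t₁ _)]
  simp_rw [h]
  rw [integral_eq_lintegral_of_nonneg_ae]
  · exact Eventually.of_forall fun x =>
      mul_nonneg (cdf_density_nonneg hη t₁ _) ((density_props hη t₂).1 x)
  · exact (((continuous_cdf _).comp (continuous_const.sub continuous_subtype_val)).mul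
      (map_continuous _)).aestronglyMeasurable

lemma integrable_rootLog (hη : 0 < η) (hc : c ≤ 1) : Integrable (rootLog hη) (gwMeasure c) := by
  have := isProbabilityMeasure_gwMeasure hc
  refine (((integrable_arity hc).add (integrable_const 1)).mul_const (halfLog η)).mono'
    (Measurable.of_discrete).aestronglyMeasurable (Eventually.of_forall fun t => ?_)
  exact abs_rootLog_le hη t

lemma integrable_pairLog (hη : 0 < η) (hc : c ≤ 1) :
    Integrable (fun p : PlaneTree × PlaneTree => pairLog hη p.1 p.2)
      ((gwMeasure c).prod (gwMeasure c)) := by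
  have := isProbabilityMeasure_gwMeasure hc
  exact Integrable.of_bound (Measurable.of_discrete).aestronglyMeasurable (2 * halfLog η)
    (Eventually.of_forall fun p => abs_pairLog_le hη p.1 p.2)

lemma hcFunctional_rootDensityLaw [MeasurableSpace C(𝕀, ℝ)] [BorelSpace C(𝕀, ℝ)] (hη : 0 < η)
    {α : ℝ≥0} (hα : 2 * α ≤ 1) :
    hcFunctional η α (rootDensityLaw hη (2 * α))
      = ∫ t, rootLog hη t ∂gwMeasure (2 * α)
        - α * ∫ p : PlaneTree × PlaneTree, pairLog hη p.1 p.2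
            ∂(gwMeasure (2 * α)).prod (gwMeasure (2 * α)) := by
  have := isProbabilityMeasure_gwMeasure hα
  have := isProbabilityMeasure_rootDensityLaw hη hα
  have hmeas : Measurable (density hη) := .of_discrete
  rw [hcFunctional]
  congr 1
  · have hterm : ∀ r : ℕ, ∫ q : Fin r → C(𝕀, ℝ), Real.log (∫ t : 𝕀,
          (η ^ (t : ℝ) * ∏ k, cdf (q k) (1 - (t : ℝ))) ∂volI)
          ∂(Measure.pi fun _ : Fin r => rootDensityLaw hη (2 * α))
        = (∫ ts : Fin r → PlaneTree, rootLog hη ⟨r, ts⟩ ∂Measure.pi fun _ => gwMeasure (2 * α))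
          + Real.log (upsilon η) := by
      intro r
      have hmap : (Measure.pi fun _ : Fin r => rootDensityLaw hη (2 * α))
          = (Measure.pi fun _ : Fin r => gwMeasure (2 * α)).map
            fun ts i => density hη (ts i) :=
        (Measure.pi_map_pi fun _ => hmeas.aemeasurable).symm
      rw [hmap, integral_map_of_countable _ .of_discrete]
      have hpt : ∀ ts : Fin r → PlaneTree, Real.log (∫ t : 𝕀,
          (η ^ (t : ℝ) * ∏ k, cdf (density hη (ts k)) (1 - (t : ℝ))) ∂volI)
          = rootLog hη ⟨r, ts⟩ + Real.log (upsilon η) := by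
        intro ts
        have hU := upsilon_pos hη
        have hM := rootMass_pos hη ts
        change Real.log (rootMass hη ts) = Real.log (rootProb hη ts).toReal + _
        rw [rootProb_eq, ENNReal.toReal_ofReal (by positivity),
          Real.log_mul (inv_ne_zero hU.ne') hM.ne', Real.log_inv]
        ring
      simp_rw [hpt]
      rw [integral_add _ (integrable_const _)]
      · simp
      · exact Integrable.of_bound (Measurable.of_discrete).aestronglyMeasurable
          ((r + 1) * halfLog η) (Eventually.of_forall fun ts => abs_rootLog_le hη ⟨r, ts⟩)
    simp_rw [hterm]
    have h1 := hasSum_integral_gwMeasure hα (integrable_rootLog hη hα)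
    have h2 : HasSum (fun r : ℕ => (poissonMeasure (2 * α) {r}).toReal) 1 := by
      convert hasSum_one_poissonMeasure (2 * α) using 2 with r
      exact poissonMeasure_real_singleton _ _
    have h3 := h1.add (h2.mul_right (Real.log (upsilon η)))
    simp_rw [← mul_add] at h3
    rw [h3.tsum_eq]
    ring
  · congr 1
    have hmap : (rootDensityLaw hη (2 * α)).prod (rootDensityLaw hη (2 * α))
        = ((gwMeasure (2 * α)).prod (gwMeasure (2 * α))).map
          (Prod.map (density hη) (density hη)) :=
      Measure.map_prod_map _ _ hmeas hmeas
    rw [hmap, integral_map_of_countable _ .of_discrete]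
    simp_rw [pairLog, pairProb_toReal]
    rfl

end Functional

section Gibbs

local notation "𝕀" => Set.Elem (Set.Icc (0:ℝ) 1)

/-- Independent spins with law `fugMeasure η` on all vertices. -/
noncomputable def spinMeasure (η : ℝ) : Measure (ℕ → 𝕀) :=
  Measure.infinitePi fun _ => fugMeasure η

/-- Spin configurations satisfying the constraint of every edge of `A`. -/
def feasible (A : Finset (Sym2 ℕ)) : Set (ℕ → 𝕀) :=
  {σ | ∀ i j, s(i, j) ∈ A → (σ i : ℝ) + σ j ≤ 1}

/-- The volume of the feasible configurations. -/
noncomputable def vol (η : ℝ) (A : Finset (Sym2 ℕ)) : ℝ≥0∞ := spinMeasure η (feasible A)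

/-- The logarithm of the volume of the feasible configurations. -/
noncomputable def logVol (η : ℝ) (A : Finset (Sym2 ℕ)) : ℝ := Real.log (vol η A).toReal

variable {η : ℝ}

lemma isProbabilityMeasure_spinMeasure (hη : 0 < η) : IsProbabilityMeasure (spinMeasure η) := by
  have := isProbabilityMeasure_fugMeasure hη
  unfold spinMeasure
  infer_instance

lemma measurableSet_pair_le (i j : ℕ) :
    MeasurableSet {σ : ℕ → 𝕀 | (σ i : ℝ) + σ j ≤ 1} :=
  measurableSet_le ((measurable_subtype_coe.comp (measurable_pi_apply i)).add
    (measurable_subtype_coe.comp (measurable_pi_apply j))) measurable_const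

lemma measurableSet_feasible (A : Finset (Sym2 ℕ)) : MeasurableSet (feasible A) := by
  have h : feasible A = ⋂ i, ⋂ j, ⋂ _ : s(i, j) ∈ A, {σ : ℕ → 𝕀 | (σ i : ℝ) + σ j ≤ 1} := by
    ext σ
    simp [feasible]
  rw [h]
  exact MeasurableSet.iInter fun i => MeasurableSet.iInter fun j => MeasurableSet.iInter fun _ =>
    measurableSet_pair_le i j

lemma measurable_update_pair (v : ℕ) :
    Measurable fun q : (ℕ → 𝕀) × 𝕀 => Function.update q.1 v q.2 := by
  rw [measurable_pi_iff]
  intro i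
  rcases eq_or_ne i v with rfl | h
  · simpa using measurable_snd
  · simp only [Function.update_of_ne h]
    exact (measurable_pi_apply i).comp measurable_fst

lemma spinMeasure_eq_map_update (hη : 0 < η) (v : ℕ) :
    ((spinMeasure η).prod (fugMeasure η)).map (fun q => Function.update q.1 v q.2)
      = spinMeasure η := by
  have := isProbabilityMeasure_fugMeasure hη
  have := isProbabilityMeasure_spinMeasure hη
  refine Measure.eq_infinitePi (fun _ : ℕ => fugMeasure η) fun s t ht => ?_
  have hpre : (fun q : (ℕ → 𝕀) × 𝕀 => Function.update q.1 v q.2) ⁻¹' (Set.pi s t)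
      = (Set.pi (s.erase v) t) ×ˢ (if v ∈ s then t v else Set.univ) := by
    ext ⟨σ, x⟩
    simp only [Set.mem_preimage, Set.mem_pi, Set.mem_prod, Finset.mem_coe, Finset.mem_erase]
    constructor
    · intro h
      refine ⟨fun i hi => ?_, ?_⟩
      · simpa [hi.1] using h i hi.2
      · split_ifs with hv
        · simpa using h v hv
        · trivial
    · rintro ⟨h1, h2⟩ i hi
      rcases eq_or_ne i v with rfl | h
      · simpa [hi] using h2
      · simpa [h] using h1 i ⟨h, hi⟩
  rw [Measure.map_apply (measurable_update_pair v)
    (MeasurableSet.pi (Finset.countable_toSet s) fun i _ => ht i), hpre, Measure.prod_prod, spinMeasure,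
    Measure.infinitePi_pi _ fun i _ => ht i]
  split_ifs with hv
  · exact Finset.prod_erase_mul s _ hv
  · rw [measure_univ, mul_one, Finset.erase_eq_of_notMem hv]

/-- Resampling a single spin leaves the spin measure invariant. -/
lemma lintegral_spinMeasure_update (hη : 0 < η) (v : ℕ) {f : (ℕ → 𝕀) → ℝ≥0∞}
    (hf : Measurable f) :
    ∫⁻ σ, f σ ∂spinMeasure η
      = ∫⁻ σ, ∫⁻ x, f (Function.update σ v x) ∂fugMeasure η ∂spinMeasure η := by
  have := isProbabilityMeasure_fugMeasure hη
  have := isProbabilityMeasure_spinMeasure hη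
  conv_lhs => rw [← spinMeasure_eq_map_update hη v]
  rw [lintegral_map hf (measurable_update_pair v),
    lintegral_prod (fun q => f (Function.update q.1 v q.2)) (hf.comp (measurable_update_pair v)).aemeasurable]

lemma isLowerSet_feasible (A : Finset (Sym2 ℕ)) : IsLowerSet (feasible A) := by
  intro σ τ h hσ i j hij
  have h1 : (τ i : ℝ) ≤ σ i := h i
  have h2 : (τ j : ℝ) ≤ σ j := h j
  have h3 := hσ i j hij
  linarith

lemma measurableSet_spin_le_half (v : ℕ) : MeasurableSet {σ : ℕ → 𝕀 | (σ v : ℝ) ≤ 1 / 2} :=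
  measurableSet_le (measurable_subtype_coe.comp (measurable_pi_apply v)) measurable_const

lemma isLowerSet_spin_le_half (v : ℕ) : IsLowerSet {σ : ℕ → 𝕀 | (σ v : ℝ) ≤ 1 / 2} :=
  fun σ τ h hσ => by
    have h1 : (τ v : ℝ) ≤ σ v := h v
    have h2 : (σ v : ℝ) ≤ 1 / 2 := hσ
    exact h1.trans h2

lemma halfProb_mul_le_inter (hη : 0 < η) {D : Set (ℕ → 𝕀)} (hD : MeasurableSet D)
    (hlow : IsLowerSet D) (v : ℕ) :
    halfProb η * spinMeasure η D ≤ spinMeasure η (D ∩ {σ | (σ v : ℝ) ≤ 1 / 2}) := by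
  have := isProbabilityMeasure_fugMeasure hη
  have := isProbabilityMeasure_spinMeasure hη
  have hS := measurableSet_spin_le_half v
  rw [← lintegral_indicator_one hD, ← lintegral_indicator_one (hD.inter hS),
    lintegral_spinMeasure_update hη v (measurable_one.indicator hD),
    lintegral_spinMeasure_update hη v (measurable_one.indicator (hD.inter hS)),
    ← lintegral_const_mul]
  · refine lintegral_mono fun σ => ?_
    have hanti : Antitone fun x : 𝕀 => D.indicator (1 : (ℕ → 𝕀) → ℝ≥0∞) (Function.update σ v x) := by
      intro x y hxy
      by_cases hy : Function.update σ v y ∈ D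
      · have hx : Function.update σ v x ∈ D :=
          hlow (update_le_update_iff.2 ⟨hxy, fun _ _ => le_rfl⟩) hy
        simp [hx, hy]
      · simp [hy]
    refine (halfProb_mul_lintegral_le hη hanti).trans_eq ?_
    rw [← lintegral_indicator (measurableSet_coe_le (1 / 2))]
    refine lintegral_congr fun x => ?_
    rw [Set.inter_indicator_one]
    by_cases hx : (x : ℝ) ≤ 1 / 2 <;> simp [Set.indicator]
  · exact Measurable.lintegral_prod_right'
      ((measurable_one.indicator hD).comp (measurable_update_pair v))

lemma halfProb_sq_mul_vol_le (hη : 0 < η) (e : Sym2 ℕ) (A : Finset (Sym2 ℕ)) :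
    halfProb η ^ 2 * vol η A ≤ vol η (insert e A) := by
  induction e using Sym2.ind with
  | _ i j =>
  have h1 := halfProb_mul_le_inter hη (measurableSet_feasible A) (isLowerSet_feasible A) i
  have h2 := halfProb_mul_le_inter hη ((measurableSet_feasible A).inter
    (measurableSet_spin_le_half i)) ((isLowerSet_feasible A).inter (isLowerSet_spin_le_half i)) j
  calc halfProb η ^ 2 * vol η A = halfProb η * (halfProb η * vol η A) := by ring
    _ ≤ _ := (mul_le_mul_right h1 _).trans h2
    _ ≤ vol η (insert s(i, j) A) := measure_mono ?_
  rintro σ ⟨⟨hA, hi⟩, hj⟩ k l hkl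
  simp only [Set.mem_ofPred_eq] at hi hj
  rcases Finset.mem_insert.1 hkl with h | h
  · rcases Sym2.eq_iff.1 h with ⟨rfl, rfl⟩ | ⟨rfl, rfl⟩ <;> linarith
  · exact hA k l h

lemma feasible_anti {A B : Finset (Sym2 ℕ)} (h : A ⊆ B) : feasible B ⊆ feasible A :=
  fun _ hσ i j hij => hσ i j (h hij)

lemma vol_anti {A B : Finset (Sym2 ℕ)} (h : A ⊆ B) : vol η B ≤ vol η A :=
  measure_mono (feasible_anti h)

lemma vol_empty (hη : 0 < η) : vol η ∅ = 1 := by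
  have := isProbabilityMeasure_spinMeasure hη
  rw [vol, show feasible ∅ = Set.univ from Set.eq_univ_of_forall fun σ i j h => by simp at h]
  exact measure_univ

lemma vol_le_one (hη : 0 < η) (A : Finset (Sym2 ℕ)) : vol η A ≤ 1 :=
  (vol_anti (Finset.empty_subset A)).trans_eq (vol_empty hη)

lemma vol_ne_top (hη : 0 < η) (A : Finset (Sym2 ℕ)) : vol η A ≠ ⊤ :=
  ((vol_le_one hη A).trans_lt ENNReal.one_lt_top).ne

lemma vol_pos (hη : 0 < η) (A : Finset (Sym2 ℕ)) : 0 < vol η A := by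
  induction A using Finset.induction_on with
  | empty => rw [vol_empty hη]; exact one_pos
  | insert e A _ ih =>
    exact lt_of_lt_of_le (ENNReal.mul_pos (pow_ne_zero 2 (halfProb_pos hη).ne') ih.ne')
      (halfProb_sq_mul_vol_le hη e A)

lemma vol_toReal_pos (hη : 0 < η) (A : Finset (Sym2 ℕ)) : 0 < (vol η A).toReal :=
  ENNReal.toReal_pos (vol_pos hη A).ne' (vol_ne_top hη A)

lemma logVol_anti (hη : 0 < η) {A B : Finset (Sym2 ℕ)} (h : A ⊆ B) : logVol η B ≤ logVol η A :=
  Real.log_le_log (vol_toReal_pos hη B) (ENNReal.toReal_mono (vol_ne_top hη A) (vol_anti h))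

lemma logVol_le_insert (hη : 0 < η) (e : Sym2 ℕ) (A : Finset (Sym2 ℕ)) :
    logVol η A ≤ logVol η (insert e A) + 2 * halfLog η := by
  have h := ENNReal.toReal_mono (vol_ne_top hη _) (halfProb_sq_mul_vol_le hη e A)
  rw [ENNReal.toReal_mul, ENNReal.toReal_pow] at h
  have hc := halfProb_toReal_pos hη
  have h2 := Real.log_le_log (mul_pos (pow_pos hc 2) (vol_toReal_pos hη A)) h
  rw [Real.log_mul (pow_pos hc 2).ne' (vol_toReal_pos hη A).ne', Real.log_pow] at h2
  rw [logVol, logVol, halfLog]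
  push_cast at h2
  linarith

lemma abs_logVol_insert_sub_le (hη : 0 < η) (e : Sym2 ℕ) (A : Finset (Sym2 ℕ)) :
    |logVol η (insert e A) - logVol η A| ≤ 2 * halfLog η := by
  have h1 := logVol_anti hη (Finset.subset_insert e A)
  have h2 := logVol_le_insert hη e A
  rw [abs_of_nonpos (by linarith)]
  linarith

lemma logVol_le_union (hη : 0 < η) (A B : Finset (Sym2 ℕ)) :
    logVol η A ≤ logVol η (A ∪ B) + B.card * (2 * halfLog η) := by
  induction B using Finset.induction_on with
  | empty => simp
  | insert e B he ih =>
    have h := logVol_le_insert hη e (A ∪ B)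
    rw [Finset.union_insert, Finset.card_insert_of_notMem he]
    push_cast
    linarith

end Gibbs

section Exploration

local notation "𝕀" => Set.Elem (Set.Icc (0:ℝ) 1)

/-- `Explored A L w` says that exploring the graph with edge set `A` from the distinct roots
listed in `L`, deleting each vertex once its neighbours have been recorded, reveals disjoint
loopless plane trees, listed in `w`. -/
inductive Explored : Finset (Sym2 ℕ) → List ℕ → List PlaneTree → Prop
  | nil (A : Finset (Sym2 ℕ)) : Explored A [] []
  | cons (A : Finset (Sym2 ℕ)) (v : ℕ) (L : List ℕ) (R : Finset ℕ) (r : ℕ) (ts : Fin r → PlaneTree)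
      (w : List PlaneTree) (hR : ∀ u, u ∈ R ↔ s(v, u) ∈ A) (hr : R.card = r) (hv : v ∉ R)
      (hL : ∀ u ∈ R, u ∉ L) (hvL : v ∉ L)
      (h : Explored (A.filter (v ∉ ·)) (R.sort ++ L) (List.ofFn ts ++ w)) :
      Explored A (v :: L) (WType.mk r ts :: w)

namespace Explored

lemma unique {A : Finset (Sym2 ℕ)} {L : List ℕ} {w w' : List PlaneTree}
    (h : Explored A L w) (h' : Explored A L w') : w = w' := by
  induction h generalizing w' with
  | nil A => cases h'; rfl
  | cons A v L R r ts w hR hr hv hL hvL h ih =>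
    cases h' with
    | cons _ _ _ R' r' ts' w' hR' hr' hv' hL' hvL' h' =>
      obtain rfl : R = R' := Finset.ext fun u => (hR u).trans (hR' u).symm
      obtain rfl : r = r' := hr.symm.trans hr'
      obtain ⟨h1, h2⟩ := List.append_inj (ih h') (by simp)
      rw [List.ofFn_injective h1, h2]

lemma length_eq {A : Finset (Sym2 ℕ)} {L : List ℕ} {w : List PlaneTree} (h : Explored A L w) :
    L.length = w.length := by
  induction h with
  | nil A => rfl
  | cons A v L R r ts w hR hr hv hL hvL h ih =>
    simp only [List.length_append, List.length_ofFn, Finset.length_sort] at ih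
    simp only [List.length_cons]
    omega

variable {η : ℝ}

lemma indicator_feasible_update {A : Finset (Sym2 ℕ)} {v : ℕ} {R : Finset ℕ}
    (hR : ∀ u, u ∈ R ↔ s(v, u) ∈ A) (hv : v ∉ R) (σ : ℕ → 𝕀) (x : 𝕀) :
    (feasible A).indicator (1 : (ℕ → 𝕀) → ℝ≥0∞) (Function.update σ v x)
      = (feasible (A.filter (v ∉ ·))).indicator 1 σ
        * (R.sort.map fun u => {y : 𝕀 | (x : ℝ) + y ≤ 1}.indicator (1 : 𝕀 → ℝ≥0∞) (σ u)).prod := by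
  have h1 : Function.update σ v x ∈ feasible A ↔
      σ ∈ feasible (A.filter (v ∉ ·)) ∧ ∀ u ∈ R, (x : ℝ) + σ u ≤ 1 := by
    constructor
    · intro h
      refine ⟨fun i j hij => ?_, fun u hu => ?_⟩
      · rw [Finset.mem_filter, Sym2.mem_iff, not_or] at hij
        have := h i j hij.1
        rwa [Function.update_of_ne (Ne.symm hij.2.1), Function.update_of_ne (Ne.symm hij.2.2)]
          at this
      · have huv : u ≠ v := fun e => hv (e ▸ hu)
        have := h v u ((hR u).1 hu)
        rwa [Function.update_self, Function.update_of_ne huv] at this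
    · rintro ⟨hA, hx⟩ i j hij
      by_cases hi : i = v
      · subst hi
        have hj : j ∈ R := (hR j).2 hij
        have hji : j ≠ i := fun e => hv (e ▸ hj)
        rw [Function.update_self, Function.update_of_ne hji]
        exact hx j hj
      · by_cases hj : j = v
        · subst hj
          have hiR : i ∈ R := (hR i).2 (by rwa [Sym2.eq_swap])
          rw [Function.update_self, Function.update_of_ne hi, add_comm]
          exact hx i hiR
        · rw [Function.update_of_ne hi, Function.update_of_ne hj]
          refine hA i j (Finset.mem_filter.2 ⟨hij, ?_⟩)
          rw [Sym2.mem_iff, not_or]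
          exact ⟨Ne.symm hi, Ne.symm hj⟩
  by_cases hA : σ ∈ feasible (A.filter (v ∉ ·))
  · by_cases hx : ∀ u ∈ R, (x : ℝ) + σ u ≤ 1
    · rw [Set.indicator_of_mem (h1.2 ⟨hA, hx⟩), Set.indicator_of_mem hA, List.prod_eq_one]
      · simp
      · intro y hy
        obtain ⟨u, hu, rfl⟩ := List.mem_map.1 hy
        exact Set.indicator_of_mem (s := {y : 𝕀 | (x : ℝ) + y ≤ 1})
          (hx u ((Finset.mem_sort _).1 hu)) _
    · rw [Set.indicator_of_notMem (fun h => hx (h1.1 h).2), List.prod_eq_zero, mul_zero]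
      push Not at hx
      obtain ⟨u, hu, hxu⟩ := hx
      refine List.mem_map.2 ⟨u, (Finset.mem_sort _).2 hu, ?_⟩
      exact Set.indicator_of_notMem (s := {y : 𝕀 | (x : ℝ) + y ≤ 1}) (not_le.2 hxu) _
  · rw [Set.indicator_of_notMem (fun h => hA (h1.1 h).1), Set.indicator_of_notMem hA, zero_mul]

lemma measurable_indicator_mul_prod (A : Finset (Sym2 ℕ)) (L : List ℕ) {φ : ℕ → 𝕀 → ℝ≥0∞}
    (hφ : ∀ u, Measurable (φ u)) :
    Measurable fun σ : ℕ → 𝕀 =>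
      (feasible A).indicator (1 : (ℕ → 𝕀) → ℝ≥0∞) σ * (L.map fun u => φ u (σ u)).prod := by
  refine (measurable_one.indicator (measurableSet_feasible A)).mul ?_
  induction L with
  | nil => simp
  | cons v L ih =>
    simp only [List.map_cons, List.prod_cons]
    exact ((hφ v).comp (measurable_pi_apply v)).mul ih

lemma prod_zipWith_one {f : ℕ → PlaneTree → ℝ≥0∞} (hf : ∀ u t, f u t = 1) (L : List ℕ)
    (w : List PlaneTree) : (List.zipWith f L w).prod = 1 := by
  induction L generalizing w with
  | nil => simp
  | cons v L ih =>
    cases w with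
    | nil => simp
    | cons t w => simp [hf, ih]

lemma prod_zipWith_congr {f g : ℕ → PlaneTree → ℝ≥0∞} {L : List ℕ} (h : ∀ u ∈ L, ∀ t, f u t = g u t)
    (w : List PlaneTree) : (List.zipWith f L w).prod = (List.zipWith g L w).prod := by
  induction L generalizing w with
  | nil => simp
  | cons v L ih =>
    cases w with
    | nil => simp
    | cons t w =>
      simp only [List.zipWith_cons_cons, List.prod_cons, h v List.mem_cons_self]
      rw [ih fun u hu => h u (List.mem_cons_of_mem _ hu)]

lemma prod_zipWith_snd {g : PlaneTree → ℝ≥0∞} {L : List ℕ} {w : List PlaneTree}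
    (h : L.length = w.length) : (List.zipWith (fun _ t => g t) L w).prod = (w.map g).prod := by
  induction L generalizing w with
  | nil => cases w <;> simp_all
  | cons v L ih =>
    cases w with
    | nil => simp at h
    | cons t w =>
      simp only [List.zipWith_cons_cons, List.prod_cons, List.map_cons]
      rw [ih (by simpa using h)]

lemma resample (hη : 0 < η) {A : Finset (Sym2 ℕ)} {v : ℕ} {L : List ℕ} {R : Finset ℕ} {r : ℕ}
    {ts : Fin r → PlaneTree} {w : List PlaneTree} (hR : ∀ u, u ∈ R ↔ s(v, u) ∈ A)
    (hr : R.card = r) (hv : v ∉ R) (hL : ∀ u ∈ R, u ∉ L) (hvL : v ∉ L)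
    (ih : ∀ {φ : ℕ → 𝕀 → ℝ≥0∞}, (∀ u, Measurable (φ u)) →
      ∫⁻ σ, (feasible (A.filter (v ∉ ·))).indicator (1 : (ℕ → 𝕀) → ℝ≥0∞) σ
          * ((R.sort ++ L).map fun u => φ u (σ u)).prod ∂spinMeasure η
        = vol η (A.filter (v ∉ ·))
          * (List.zipWith (fun u t => ∫⁻ x, φ u x ∂rootLaw hη t) (R.sort ++ L)
              (List.ofFn ts ++ w)).prod)
    {φ : ℕ → 𝕀 → ℝ≥0∞} (hφ : ∀ u, Measurable (φ u)) :
    ∫⁻ σ, (feasible A).indicator (1 : (ℕ → 𝕀) → ℝ≥0∞) σ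
        * ((v :: L).map fun u => φ u (σ u)).prod ∂spinMeasure η
      = vol η (A.filter (v ∉ ·)) * rootProb hη ts
        * (List.zipWith (fun u t => ∫⁻ x, φ u x ∂rootLaw hη t) (v :: L) (⟨r, ts⟩ :: w)).prod := by
  have := isProbabilityMeasure_fugMeasure hη
  have := isProbabilityMeasure_spinMeasure hη
  have hmeas := measurable_indicator_mul_prod A (v :: L) hφ
  set Z := (List.zipWith (fun u t => ∫⁻ x, φ u x ∂rootLaw hη t) L w).prod with hZ
  set ψ : 𝕀 → ℕ → 𝕀 → ℝ≥0∞ := fun x u =>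
    if u ∈ R then {y : 𝕀 | (x : ℝ) + y ≤ 1}.indicator 1 else φ u with hψ
  have hS : ∀ x : 𝕀, MeasurableSet {y : 𝕀 | (x : ℝ) + y ≤ 1} := fun x => measurableSet_coe_add_le x
  have hψm : ∀ x u, Measurable (ψ x u) := by
    intro x u
    by_cases hu : u ∈ R
    · simp only [hψ, hu, if_true]; exact measurable_one.indicator (hS x)
    · simp only [hψ, hu, if_false]; exact hφ u
  have hpt : ∀ (σ : ℕ → 𝕀) (x : 𝕀),
      (feasible A).indicator (1 : (ℕ → 𝕀) → ℝ≥0∞) (Function.update σ v x)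
        * ((v :: L).map fun u => φ u (Function.update σ v x u)).prod
      = φ v x * ((feasible (A.filter (v ∉ ·))).indicator (1 : (ℕ → 𝕀) → ℝ≥0∞) σ
        * ((R.sort ++ L).map fun u => ψ x u (σ u)).prod) := by
    intro σ x
    have h1 : (L.map fun u => φ u (Function.update σ v x u)) = L.map fun u => ψ x u (σ u) :=
      List.map_congr_left fun u hu => by
        have huv : u ≠ v := fun e => hvL (e ▸ hu)
        have huR : u ∉ R := fun e => hL u e hu
        simp [hψ, huv, huR]
    have h2 : (R.sort.map fun u => ψ x u (σ u))
        = R.sort.map fun u => {y : 𝕀 | (x : ℝ) + y ≤ 1}.indicator (1 : 𝕀 → ℝ≥0∞) (σ u) :=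
      List.map_congr_left fun u hu => by
        have huR : u ∈ R := (Finset.mem_sort _).1 hu
        simp [hψ, huR]
    rw [indicator_feasible_update hR hv, List.map_cons, List.prod_cons, h1, List.map_append,
      List.prod_append, h2, Function.update_self]
    ring
  have hz : ∀ x : 𝕀, (List.zipWith (fun u t => ∫⁻ y, ψ x u y ∂rootLaw hη t) (R.sort ++ L)
      (List.ofFn ts ++ w)).prod
      = (∏ i, rootLaw hη (ts i) {y | (x : ℝ) + (y : ℝ) ≤ 1}) * Z := by
    intro x
    have hlen : R.sort.length = (List.ofFn ts).length := by simp [hr]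
    have h1 : ∀ u ∈ R.sort, ∀ t, ∫⁻ y, ψ x u y ∂rootLaw hη t
        = rootLaw hη t {y | (x : ℝ) + (y : ℝ) ≤ 1} := by
      intro u hu t
      have huR : u ∈ R := (Finset.mem_sort _).1 hu
      simp only [hψ, huR, if_true]
      exact lintegral_indicator_one (hS x)
    have h2 : ∀ u ∈ L, ∀ t, ∫⁻ y, ψ x u y ∂rootLaw hη t = ∫⁻ y, φ u y ∂rootLaw hη t := by
      intro u hu t
      have huR : u ∉ R := fun e => hL u e hu
      simp [hψ, huR]
    rw [List.zipWith_append hlen, List.prod_append, hZ, prod_zipWith_congr h1,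
      prod_zipWith_congr h2, prod_zipWith_snd hlen, List.map_ofFn, List.prod_ofFn]
    rfl
  rw [lintegral_spinMeasure_update hη v hmeas,
    lintegral_lintegral_swap (f := fun σ x =>
      (feasible A).indicator (1 : (ℕ → 𝕀) → ℝ≥0∞) (Function.update σ v x)
        * ((v :: L).map fun u => φ u (Function.update σ v x u)).prod) (hmeas.comp (measurable_update_pair v)).aemeasurable]
  have hx : ∀ x : 𝕀, ∫⁻ σ, (feasible A).indicator (1 : (ℕ → 𝕀) → ℝ≥0∞) (Function.update σ v x)
        * ((v :: L).map fun u => φ u (Function.update σ v x u)).prod ∂spinMeasure η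
      = (vol η (A.filter (v ∉ ·)) * Z) *
          (φ v x * ∏ i, rootLaw hη (ts i) {y | (x : ℝ) + (y : ℝ) ≤ 1}) := by
    intro x
    rw [lintegral_congr fun σ => hpt σ x,
      lintegral_const_mul _ (measurable_indicator_mul_prod _ _ (hψm x)), ih (hψm x), hz]
    ring
  rw [lintegral_congr hx, lintegral_const_mul
    (f := fun x => φ v x * ∏ i, rootLaw hη (ts i) {y | (x : ℝ) + (y : ℝ) ≤ 1}) _
    ((hφ v).mul (Finset.measurable_fun_prod _ fun i _ => measurable_rootLaw_add_le hη (ts i))),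
    ← lintegral_rootLaw_mk hη ts (hφ v), List.zipWith_cons_cons, List.prod_cons, hZ]
  ring

lemma vol_eq_of_resample (hη : 0 < η) {A : Finset (Sym2 ℕ)} {L : List ℕ} {w : List PlaneTree}
    {C : ℝ≥0∞} (h : ∀ {φ : ℕ → 𝕀 → ℝ≥0∞}, (∀ u, Measurable (φ u)) →
      ∫⁻ σ, (feasible A).indicator (1 : (ℕ → 𝕀) → ℝ≥0∞) σ
          * (L.map fun u => φ u (σ u)).prod ∂spinMeasure η
        = C * (List.zipWith (fun u t => ∫⁻ x, φ u x ∂rootLaw hη t) L w).prod) :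
    vol η A = C := by
  have h1 := h (φ := fun _ _ => 1) fun _ => measurable_const
  rw [prod_zipWith_one (by simp), mul_one] at h1
  rw [← h1, vol, ← lintegral_indicator_one (measurableSet_feasible A)]
  simp

/-- Given feasibility, the spins at the roots are independent with laws `rootLaw`. -/
lemma lintegral_spinMeasure (hη : 0 < η) {A : Finset (Sym2 ℕ)} {L : List ℕ} {w : List PlaneTree}
    (h : Explored A L w) {φ : ℕ → 𝕀 → ℝ≥0∞} (hφ : ∀ u, Measurable (φ u)) :
    ∫⁻ σ, (feasible A).indicator (1 : (ℕ → 𝕀) → ℝ≥0∞) σ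
        * (L.map fun u => φ u (σ u)).prod ∂spinMeasure η
      = vol η A * (List.zipWith (fun u t => ∫⁻ x, φ u x ∂rootLaw hη t) L w).prod := by
  induction h generalizing φ with
  | nil A =>
    simp [vol, lintegral_indicator_one (measurableSet_feasible A)]
  | cons A v L R r ts w hR hr hv hL hvL h ih =>
    rw [vol_eq_of_resample hη (resample hη hR hr hv hL hvL ih)]
    exact resample hη hR hr hv hL hvL ih hφ

lemma logVol_sub_logVol_filter (hη : 0 < η) {A : Finset (Sym2 ℕ)} {v : ℕ} {t : PlaneTree}
    (h : Explored A [v] [t]) :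
    logVol η A - logVol η (A.filter (v ∉ ·)) = rootLog hη t := by
  cases h with
  | cons _ _ _ R r ts _ hR hr hv hL hvL h =>
    have h1 := vol_eq_of_resample hη
      (resample hη hR hr hv hL hvL fun hφ => lintegral_spinMeasure hη h hφ)
    rw [logVol, h1, ENNReal.toReal_mul, Real.log_mul (vol_toReal_pos hη _).ne'
      (ENNReal.toReal_pos (rootProb_ne_zero hη ts) (rootProb_ne_top hη ts)).ne', logVol, rootLog]
    ring

lemma card_filter_mem {A : Finset (Sym2 ℕ)} {v : ℕ} {t : PlaneTree}
    (h : Explored A [v] [t]) : (A.filter (v ∈ ·)).card = arity t := by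
  cases h with
  | cons _ _ _ R r ts _ hR hr hv hL hvL h =>
    have h1 : A.filter (v ∈ ·) = R.image fun u => s(v, u) := by
      ext e
      rw [Finset.mem_filter, Finset.mem_image]
      constructor
      · rintro ⟨he, u, rfl⟩
        exact ⟨u, (hR u).2 he, rfl⟩
      · rintro ⟨u, hu, rfl⟩
        exact ⟨(hR u).1 hu, Sym2.mem_mk_left v u⟩
    rw [h1, Finset.card_image_of_injective _ fun a b hab => Sym2.congr_right.1 hab, hr, arity]

lemma logVol_insert_sub_logVol (hη : 0 < η) {A : Finset (Sym2 ℕ)} {u v : ℕ} {t₁ t₂ : PlaneTree}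
    (h : Explored A [u, v] [t₁, t₂]) :
    logVol η (insert s(u, v) A) - logVol η A = pairLog hη t₁ t₂ := by
  have := isProbabilityMeasure_spinMeasure hη
  have huv : u ≠ v := by
    cases h with
    | cons _ _ _ R r ts _ hR hr hv hL hvL h => simpa using hvL
  set κ : (ℕ → 𝕀) → 𝕀 × 𝕀 := fun σ => (σ u, σ v) with hκ
  have hκm : Measurable κ := (measurable_pi_apply u).prodMk (measurable_pi_apply v)
  have hlaw : ((vol η A) • rootLaw hη t₁).prod (rootLaw hη t₂)
      = ((spinMeasure η).restrict (feasible A)).map κ := by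
    have := Measure.smul_finite (rootLaw hη t₁) (vol_ne_top hη A)
    refine Measure.prod_eq fun s t hs ht => ?_
    have h1 := h.lintegral_spinMeasure hη
      (φ := fun i => if i = u then s.indicator 1 else t.indicator 1) fun i => by
        split_ifs
        · exact measurable_one.indicator hs
        · exact measurable_one.indicator ht
    simp only [List.map_cons, List.map_nil, List.prod_cons, List.prod_nil, if_true, huv.symm,
      if_false, List.zipWith_cons_cons, List.zipWith_nil_right, mul_one,
      lintegral_indicator_one hs, lintegral_indicator_one ht] at h1
    rw [Measure.map_apply hκm (hs.prod ht), Measure.restrict_apply (hκm (hs.prod ht)),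
      Measure.smul_apply, smul_eq_mul, mul_assoc, ← h1,
      ← lintegral_indicator_one ((hκm (hs.prod ht)).inter (measurableSet_feasible A))]
    refine lintegral_congr fun σ => ?_
    by_cases h2 : σ ∈ feasible A <;> by_cases h3 : σ u ∈ s <;> by_cases h4 : σ v ∈ t <;>
      simp [h2, h3, h4, hκ]
  have hS : MeasurableSet {q : 𝕀 × 𝕀 | (q.1 : ℝ) + q.2 ≤ 1} :=
    measurableSet_le ((measurable_subtype_coe.comp measurable_fst).add
      (measurable_subtype_coe.comp measurable_snd)) measurable_const
  have hins : feasible (insert s(u, v) A)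
      = κ ⁻¹' {q : 𝕀 × 𝕀 | (q.1 : ℝ) + q.2 ≤ 1} ∩ feasible A := by
    ext σ
    constructor
    · intro hσ
      exact ⟨hσ u v (Finset.mem_insert_self _ _), feasible_anti (Finset.subset_insert _ _) hσ⟩
    · rintro ⟨h1, h2⟩ i j hij
      have h1 : (σ u : ℝ) + σ v ≤ 1 := h1
      rcases Finset.mem_insert.1 hij with h3 | h3
      · rcases Sym2.eq_iff.1 h3 with ⟨rfl, rfl⟩ | ⟨rfl, rfl⟩ <;> linarith
      · exact h2 i j h3
  have hvol : vol η (insert s(u, v) A) = vol η A * pairProb hη t₁ t₂ := by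
    have := Measure.smul_finite (rootLaw hη t₁) (vol_ne_top hη A)
    rw [vol, hins, ← Measure.restrict_apply (hκm hS), ← Measure.map_apply hκm hS, ← hlaw,
      Measure.prod_apply_symm hS, pairProb, ← lintegral_const_mul _ (measurable_rootLaw_add_le hη t₁)]
    refine lintegral_congr fun x => ?_
    rw [Measure.smul_apply, smul_eq_mul]
    congr 2
    ext y
    simp [add_comm]
  have hpos : 0 < (pairProb hη t₁ t₂).toReal := by
    have h1 := vol_toReal_pos hη (insert s(u, v) A)
    rw [hvol, ENNReal.toReal_mul] at h1
    exact pos_of_mul_pos_right h1 (vol_toReal_pos hη A).le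
  rw [logVol, hvol, ENNReal.toReal_mul, Real.log_mul (vol_toReal_pos hη _).ne' hpos.ne', logVol,
    pairLog]
  ring

end Explored

end Exploration

section LocalLimit

open ProbabilityTheory

lemma tendsto_zero_of_mul_tendsto {n : ℕ → ℕ} {p : ℕ → ℝ} {c : ℝ} (hn : Tendsto n atTop atTop)
    (hnp : Tendsto (fun i => (n i : ℝ) * p i) atTop (nhds c)) : Tendsto p atTop (nhds 0) := by
  have hn' : Tendsto (fun i => (n i : ℝ)) atTop atTop := tendsto_natCast_atTop_atTop.comp hn
  refine (hnp.div_atTop hn').congr' ?_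
  filter_upwards [hn.eventually_gt_atTop 0] with i hi
  have : (n i : ℝ) ≠ 0 := by exact_mod_cast hi.ne'
  field_simp

lemma eventually_le_binomial {n : ℕ → ℕ} {p : ℕ → ℝ} {c : ℝ} (hn : Tendsto n atTop atTop)
    (hnp : Tendsto (fun i => (n i : ℝ) * p i) atTop (nhds c)) (h0 : ∀ i, 0 ≤ p i)
    (k r : ℕ) {b : ℝ} (hb : b < Real.exp (-c) * c ^ r / r.factorial) :
    ∀ᶠ i in atTop, b ≤ ((n i - 1 - k).choose r : ℝ) * (p i ^ r * (1 - p i) ^ (n i - 1 - r)) := by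
  have hp := tendsto_zero_of_mul_tendsto hn hnp
  have hlim : Tendsto (fun i => Real.exp (-((n i : ℝ) * p i / (1 - p i)))
      * ((n i : ℝ) * p i - (k + r) * p i) ^ r / r.factorial) atTop
      (nhds (Real.exp (-(c / (1 - 0))) * (c - (k + r) * 0) ^ r / r.factorial)) := by
    refine ((Real.continuous_exp.continuousAt.tendsto.comp ?_).mul ?_).div_const _
    · exact (hnp.div (hp.const_sub 1) (by norm_num)).neg
    · exact (hnp.sub (hp.const_mul _)).pow r
  simp only [sub_zero, div_one, mul_zero] at hlim
  filter_upwards [hlim.eventually_const_lt hb, hn.eventually_ge_atTop (k + r + 1),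
    hp.eventually_lt_const one_pos] with i h1 h2 h3
  refine h1.le.trans ?_
  have h4 : 0 < 1 - p i := by linarith
  have h5 : Real.exp (-((n i : ℝ) * p i / (1 - p i))) ≤ (1 - p i) ^ (n i - 1 - r) := by
    calc Real.exp (-((n i : ℝ) * p i / (1 - p i))) ≤ Real.exp (n i * Real.log (1 - p i)) := by
          refine Real.exp_le_exp.2 ?_
          have h6 := Real.one_sub_inv_le_log_of_pos h4
          have h7 : -((n i : ℝ) * p i / (1 - p i)) = n i * (1 - (1 - p i)⁻¹) := by
            field_simp
            ring
          rw [h7]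
          exact mul_le_mul_of_nonneg_left h6 (Nat.cast_nonneg _)
      _ = (1 - p i) ^ n i := by rw [mul_comm, Real.exp_mul, Real.exp_log h4, Real.rpow_natCast]
      _ ≤ (1 - p i) ^ (n i - 1 - r) :=
          pow_le_pow_of_le_one h4.le (by linarith [h0 i]) (by omega)
  have h6 : ((n i : ℝ) * p i - (k + r) * p i) ^ r / r.factorial
      ≤ ((n i - 1 - k).choose r : ℝ) * p i ^ r := by
    have h7 := Nat.pow_sub_le_descFactorial (n i - 1 - k) r
    rw [Nat.descFactorial_eq_factorial_mul_choose, show n i - 1 - k + 1 - r = n i - (k + r) by omega]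
      at h7
    have h8 : ((n i : ℝ) - (k + r)) ^ r ≤ r.factorial * ((n i - 1 - k).choose r : ℝ) := by
      have h9 : ((n i - (k + r) : ℕ) : ℝ) = (n i : ℝ) - (k + r) := by
        rw [Nat.cast_sub (by omega)]
        push_cast
        ring
      rw [← h9]
      exact_mod_cast h7
    have hf : (0 : ℝ) < r.factorial := by exact_mod_cast Nat.factorial_pos r
    rw [div_le_iff₀ hf, ← sub_mul, mul_pow]
    calc _ ≤ (r.factorial * ((n i - 1 - k).choose r : ℝ)) * p i ^ r :=
          mul_le_mul_of_nonneg_right h8 (pow_nonneg (h0 i) r)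
      _ = _ := by ring
  calc Real.exp (-((n i : ℝ) * p i / (1 - p i))) * ((n i : ℝ) * p i - (k + r) * p i) ^ r
        / r.factorial
      = (((n i : ℝ) * p i - (k + r) * p i) ^ r / r.factorial)
        * Real.exp (-((n i : ℝ) * p i / (1 - p i))) := by ring
    _ ≤ ((n i - 1 - k).choose r : ℝ) * p i ^ r * (1 - p i) ^ (n i - 1 - r) := by
        refine mul_le_mul h6 h5 (Real.exp_pos _).le ?_
        exact mul_nonneg (Nat.cast_nonneg _) (pow_nonneg (h0 i) r)
    _ = _ := by ring

/-- The loopless edges with both endpoints in `V`. -/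
def pairs (V : Finset ℕ) : Finset (Sym2 ℕ) := V.sym2.filter fun e => ¬ e.IsDiag

lemma mem_pairs {V : Finset ℕ} {i j : ℕ} : s(i, j) ∈ pairs V ↔ (i ∈ V ∧ j ∈ V) ∧ i ≠ j := by
  rw [pairs, Finset.mem_filter, Finset.mk_mem_sym2_iff, Sym2.mk_isDiag_iff]

lemma mem_of_mem_pairs {V : Finset ℕ} {e : Sym2 ℕ} (he : e ∈ pairs V) {v : ℕ} (hv : v ∈ e) :
    v ∈ V :=
  Finset.mem_sym2_iff.1 (Finset.mem_filter.1 he).1 v hv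

lemma pairs_insert {V : Finset ℕ} {v : ℕ} (hv : v ∉ V) :
    pairs (insert v V) = V.image (fun u => s(v, u)) ∪ pairs V := by
  ext e
  induction e using Sym2.ind with
  | _ i j =>
  simp only [Finset.mem_union, mem_pairs, Finset.mem_image, Finset.mem_insert, Sym2.eq_iff]
  constructor
  · rintro ⟨⟨rfl | hi, rfl | hj⟩, hij⟩
    · exact absurd rfl hij
    · exact Or.inl ⟨j, hj, Or.inl ⟨rfl, rfl⟩⟩
    · exact Or.inl ⟨i, hi, Or.inr ⟨rfl, rfl⟩⟩
    · exact Or.inr ⟨⟨hi, hj⟩, hij⟩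
  · rintro (⟨u, hu, ⟨rfl, rfl⟩ | ⟨rfl, rfl⟩⟩ | ⟨⟨hi, hj⟩, hij⟩)
    · exact ⟨⟨Or.inl rfl, Or.inr hu⟩, fun e => hv (e ▸ hu)⟩
    · exact ⟨⟨Or.inr hu, Or.inl rfl⟩, fun e => hv (e ▸ hu)⟩
    · exact ⟨⟨Or.inr hi, Or.inr hj⟩, hij⟩

lemma disjoint_star_pairs {V : Finset ℕ} {v : ℕ} (hv : v ∉ V) :
    Disjoint (V.image fun u => s(v, u)) (pairs V) := by
  rw [Finset.disjoint_left]
  intro e he h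
  obtain ⟨u, hu, rfl⟩ := Finset.mem_image.1 he
  exact hv (mem_pairs.1 h).1.1

lemma injective_star (v : ℕ) : Function.Injective fun u : ℕ => s(v, u) :=
  fun _ _ h => Sym2.congr_right.1 h

lemma card_pairs (V : Finset ℕ) : ((pairs V).card : ℝ) = V.card * (V.card - 1) / 2 := by
  induction V using Finset.induction_on with
  | empty => simp [pairs]
  | insert v V hv ih =>
    rw [pairs_insert hv, Finset.card_union_of_disjoint (disjoint_star_pairs hv),
      Finset.card_image_of_injective _ (injective_star v), Finset.card_insert_of_notMem hv]
    push_cast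
    rw [ih]
    ring

lemma bernExp_pairs_insert (p : ℝ) {V : Finset ℕ} {v : ℕ} (hv : v ∉ V)
    (F : Finset (Sym2 ℕ) → ℝ) :
    bernExp p (pairs (insert v V)) F = bernExp p V fun R => bernExp p (pairs V) fun A =>
      F (R.image (fun u => s(v, u)) ∪ A) := by
  rw [pairs_insert hv, bernExp_union p (disjoint_star_pairs hv),
    bernExp_image p (injective_star v)]

lemma filter_notMem_star_union {V R : Finset ℕ} {v : ℕ} (hv : v ∉ V) {A : Finset (Sym2 ℕ)}
    (hA : A ⊆ pairs V) :
    (R.image (fun u => s(v, u)) ∪ A).filter (v ∉ ·) = A := by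
  ext e
  rw [Finset.mem_filter, Finset.mem_union, Finset.mem_image]
  constructor
  · rintro ⟨⟨u, hu, rfl⟩ | he, hve⟩
    · exact absurd (Sym2.mem_mk_left v u) hve
    · exact he
  · exact fun he => ⟨Or.inr he, fun h => hv (mem_of_mem_pairs (hA he) h)⟩

lemma Explored.star_union {V R : Finset ℕ} {v : ℕ} {L : List ℕ} {A : Finset (Sym2 ℕ)}
    {ts : Fin R.card → PlaneTree} {w : List PlaneTree} (hv : v ∉ V) (hA : A ⊆ pairs V)
    (hR : R ⊆ V) (hRL : ∀ u ∈ R, u ∉ L) (hvL : v ∉ L)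
    (h : Explored A (R.sort ++ L) (List.ofFn ts ++ w)) :
    Explored (R.image (fun u => s(v, u)) ∪ A) (v :: L) (⟨R.card, ts⟩ :: w) := by
  refine .cons _ v L R R.card ts w (fun u => ?_) rfl (fun hvR => hv (hR hvR)) hRL hvL ?_
  · rw [Finset.mem_union, Finset.mem_image]
    constructor
    · exact fun hu => Or.inl ⟨u, hu, rfl⟩
    · rintro (⟨u', hu', h⟩ | h)
      · rwa [← Sym2.congr_right.1 h]
      · exact absurd (mem_pairs.1 (hA h)).1.1 hv
  · rwa [filter_notMem_star_union hv hA]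

/-- The number of vertices of a plane tree. -/
def treeSize : PlaneTree → ℕ
  | ⟨_, ts⟩ => 1 + ∑ i, treeSize (ts i)

/-- The probability of a list of trees under the product of Galton–Watson laws. -/
noncomputable def forestWeight (c : ℝ≥0) (w : List PlaneTree) : ℝ :=
  (w.map fun t => (treeWeight c t).toReal).prod

lemma forestWeight_nonneg (c : ℝ≥0) (w : List PlaneTree) : 0 ≤ forestWeight c w :=
  List.prod_nonneg fun x hx => by
    obtain ⟨t, _, rfl⟩ := List.mem_map.1 hx
    exact ENNReal.toReal_nonneg

lemma forestWeight_cons (c : ℝ≥0) {r : ℕ} (ts : Fin r → PlaneTree) (w : List PlaneTree) :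
    forestWeight c (⟨r, ts⟩ :: w)
      = Real.exp (-c) * c ^ r / r.factorial * forestWeight c (List.ofFn ts ++ w) := by
  rw [forestWeight, forestWeight, List.map_cons, List.prod_cons, treeWeight_mk, List.map_append,
    List.prod_append, List.map_ofFn, List.prod_ofFn, ENNReal.toReal_mul, ENNReal.toReal_prod,
    ← poissonMeasure_real_singleton, Measure.real, mul_assoc]
  rfl

open Classical in
lemma choose_mul_le_bernExp {p b : ℝ} (h0 : 0 ≤ p) (h1 : p ≤ 1) {V L : Finset ℕ}
    (hL : L ⊆ V) (r : ℕ) {F : Finset ℕ → ℝ} (hF0 : ∀ R ⊆ V, 0 ≤ F R)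
    (hF : ∀ R ⊆ V, R.card = r → (∀ u ∈ R, u ∉ L) → b ≤ F R) :
    ((V.card - L.card).choose r : ℝ) * (p ^ r * (1 - p) ^ (V.card - r)) * b ≤ bernExp p V F := by
  have h2 : 0 ≤ 1 - p := by linarith
  have hsub : Finset.powersetCard r (V \ L) ⊆ V.powerset := fun R hR =>
    Finset.mem_powerset.2 ((Finset.mem_powersetCard.1 hR).1.trans Finset.sdiff_subset)
  calc _ = ∑ R ∈ Finset.powersetCard r (V \ L), p ^ r * (1 - p) ^ (V.card - r) * b := by
        rw [Finset.sum_const, Finset.card_powersetCard, Finset.card_sdiff_of_subset hL,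
          nsmul_eq_mul]
        ring
    _ ≤ ∑ R ∈ Finset.powersetCard r (V \ L), p ^ R.card * (1 - p) ^ (V.card - R.card) * F R := by
        refine Finset.sum_le_sum fun R hR => ?_
        obtain ⟨h3, h4⟩ := Finset.mem_powersetCard.1 hR
        rw [h4]
        refine mul_le_mul_of_nonneg_left ?_ (by positivity)
        exact hF R (h3.trans Finset.sdiff_subset) h4 fun u hu => (Finset.mem_sdiff.1 (h3 hu)).2
    _ ≤ bernExp p V F := by
        refine Finset.sum_le_sum_of_subset_of_nonneg hsub fun R hR _ => ?_
        exact mul_nonneg (by positivity) (hF0 R (Finset.mem_powerset.1 hR))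

open Classical in
/-- Sparse random graphs explored from finitely many roots look at least as often like a forest
as independent Galton–Watson trees do. -/
theorem eventually_le_bernExp_explored (c : ℝ≥0) (w : List PlaneTree) {n : ℕ → ℕ} {p : ℕ → ℝ}
    (hn : Tendsto n atTop atTop) (hnp : Tendsto (fun i => (n i : ℝ) * p i) atTop (nhds c))
    (h0 : ∀ i, 0 ≤ p i) (h1 : ∀ i, p i ≤ 1) {b : ℝ} (hb : b < forestWeight c w) :
    ∀ᶠ i in atTop, ∀ V : Finset ℕ, V.card = n i → ∀ L : List ℕ, L.Nodup → (∀ u ∈ L, u ∈ V) →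
      L.length = w.length →
      b ≤ bernExp (p i) (pairs V) fun A => if Explored A L w then 1 else 0 := by
  obtain ⟨m, hm⟩ : ∃ m, (w.map treeSize).sum = m := ⟨_, rfl⟩
  induction m using Nat.strong_induction_on generalizing w n b with
  | _ m ih =>
  cases w with
  | nil =>
    refine Eventually.of_forall fun i V _ L _ _ hlen => ?_
    obtain rfl : L = [] := List.length_eq_zero_iff.1 hlen
    have hb1 : b < 1 := by simpa [forestWeight] using hb
    simp only [Explored.nil, if_true, bernExp_const]
    exact hb1.le
  | cons t w =>
    obtain ⟨r, ts⟩ := t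
    have hnonneg : ∀ i (V : Finset ℕ) (L : List ℕ) (w : List PlaneTree),
        0 ≤ bernExp (p i) (pairs V) fun A => if Explored A L w then 1 else 0 := fun i V L w =>
      bernExp_nonneg (h0 i) (h1 i) fun A _ => by split_ifs <;> norm_num
    rcases lt_or_ge b 0 with hb0 | hb0
    · exact Eventually.of_forall fun i V _ L _ _ _ => hb0.le.trans (hnonneg i V L _)
    rw [forestWeight_cons] at hb
    set q := Real.exp (-(c : ℝ)) * c ^ r / r.factorial with hq
    have hq0 : 0 ≤ q := by positivity
    have hW0 := forestWeight_nonneg c (List.ofFn ts ++ w)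
    have hqpos : 0 < q := by
      rcases hq0.eq_or_lt with h | h
      · rw [← h, zero_mul] at hb; linarith
      · exact h
    obtain ⟨b', hb1, hb2⟩ := exists_between ((div_lt_iff₀' hqpos).2 hb)
    have hb'0 : 0 ≤ b' := (div_nonneg hb0 hqpos.le).trans hb1.le
    obtain ⟨d, hd1, hd2⟩ : ∃ d, d < q ∧ b ≤ d * b' := by
      rw [div_lt_iff₀' hqpos] at hb1
      have hb'pos : 0 < b' := by
        rcases hb'0.eq_or_lt with h | h
        · rw [← h, mul_zero] at hb1; linarith
        · exact h
      exact ⟨b / b', (div_lt_iff₀ hb'pos).2 hb1, (div_mul_cancel₀ b hb'pos.ne').ge⟩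
    have hn1 : Tendsto (fun i => n i - 1) atTop atTop := (tendsto_sub_atTop_nat 1).comp hn
    have hnp1 : Tendsto (fun i => ((n i - 1 : ℕ) : ℝ) * p i) atTop (nhds c) := by
      have h := hnp.sub (tendsto_zero_of_mul_tendsto hn hnp)
      rw [sub_zero] at h
      refine h.congr' ?_
      filter_upwards [hn.eventually_ge_atTop 1] with i hi
      rw [Nat.cast_sub hi]
      push_cast
      ring
    have hsize : ((List.ofFn ts ++ w).map treeSize).sum < m := by
      rw [← hm, List.map_append, List.sum_append, List.map_ofFn, List.sum_ofFn, List.map_cons,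
        List.sum_cons, treeSize]
      simp only [Function.comp_apply]
      omega
    filter_upwards [ih _ hsize (List.ofFn ts ++ w) hn1 hnp1 hb2 rfl,
      eventually_le_binomial hn hnp h0 w.length r hd1] with i hi1 hi2 V hV L hnd hLV hlen
    cases L with
    | nil => simp at hlen
    | cons v L =>
    rw [List.nodup_cons] at hnd
    have hvV : v ∈ V := hLV v List.mem_cons_self
    have hlen' : L.length = w.length := by simpa using hlen
    have hV' : (V.erase v).card = n i - 1 := by rw [Finset.card_erase_of_mem hvV, hV]
    have hLV' : ∀ u ∈ L, u ∈ V.erase v := fun u hu =>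
      Finset.mem_erase.2 ⟨fun e => hnd.1 (e ▸ hu), hLV u (List.mem_cons_of_mem _ hu)⟩
    have hLcard : L.toFinset.card = w.length := by
      rw [List.toFinset_card_of_nodup hnd.2, hlen']
    rw [← Finset.insert_erase hvV, bernExp_pairs_insert _ (Finset.notMem_erase v V)]
    refine hd2.trans ((mul_le_mul_of_nonneg_right hi2 hb'0).trans ?_)
    rw [← hV', ← hLcard]
    refine choose_mul_le_bernExp (h0 i) (h1 i)
      (fun u hu => hLV' u (List.mem_toFinset.1 hu)) r (fun R _ =>
        bernExp_nonneg (h0 i) (h1 i) fun A _ => by split_ifs <;> norm_num) fun R hR hr hRL => ?_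
    subst hr
    have hRL' : ∀ u ∈ R, u ∉ L := fun u hu h => hRL u hu (List.mem_toFinset.2 h)
    refine (hi1 (V.erase v) hV' (R.sort ++ L) ?_ ?_ ?_).trans ?_
    · refine List.nodup_append'.2 ⟨Finset.sort_nodup _ _, hnd.2, ?_⟩
      exact fun u hu hu' => hRL' u ((Finset.mem_sort _).1 hu) hu'
    · intro u hu
      rcases List.mem_append.1 hu with h | h
      · exact hR ((Finset.mem_sort _).1 h)
      · exact hLV' u h
    · simp [hlen']
    · refine bernExp_mono (h0 i) (h1 i) fun A hA => ?_
      split_ifs with h2 h3 h3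
      · exact le_rfl
      · exact absurd (h2.star_union (Finset.notMem_erase v V) hA hR hRL' hnd.1) h3
      · exact zero_le_one
      · exact le_rfl

open Classical in
/-- Lower bound on the expectation of a nonnegative functional dominating a function of the
explored forest. -/
theorem eventually_le_bernExp (c : ℝ≥0) {n : ℕ → ℕ} {p : ℕ → ℝ}
    (hn : Tendsto n atTop atTop) (hnp : Tendsto (fun i => (n i : ℝ) * p i) atTop (nhds c))
    (h0 : ∀ i, 0 ≤ p i) (h1 : ∀ i, p i ≤ 1) (W : Finset (List PlaneTree)) {k : ℕ}
    (hW : ∀ w ∈ W, w.length = k) {ψ : List PlaneTree → ℝ} (hψ : ∀ w, 0 ≤ ψ w) {b : ℝ}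
    (hb : b < ∑ w ∈ W, forestWeight c w * ψ w) :
    ∀ᶠ i in atTop, ∀ V : Finset ℕ, V.card = n i → ∀ L : List ℕ, L.Nodup → (∀ u ∈ L, u ∈ V) →
      L.length = k → ∀ F : Finset (Sym2 ℕ) → ℝ, (∀ A ⊆ pairs V, 0 ≤ F A) →
      (∀ A w, Explored A L w → ψ w ≤ F A) → b ≤ bernExp (p i) (pairs V) F := by
  obtain ⟨δ, hδ, hbδ⟩ : ∃ δ > 0, b ≤ ∑ w ∈ W, (forestWeight c w - δ) * ψ w := by
    have hS : 0 ≤ ∑ w ∈ W, ψ w := Finset.sum_nonneg fun w _ => hψ w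
    refine ⟨(∑ w ∈ W, forestWeight c w * ψ w - b) / (1 + ∑ w ∈ W, ψ w),
      div_pos (by linarith) (by linarith), ?_⟩
    simp_rw [sub_mul, Finset.sum_sub_distrib, ← Finset.mul_sum]
    have h2 : (∑ w ∈ W, forestWeight c w * ψ w - b) / (1 + ∑ w ∈ W, ψ w) * ∑ w ∈ W, ψ w
        ≤ ∑ w ∈ W, forestWeight c w * ψ w - b := by
      rw [div_mul_eq_mul_div, div_le_iff₀ (by linarith)]
      nlinarith
    linarith
  have hev : ∀ᶠ i in atTop, ∀ w ∈ W, ∀ V : Finset ℕ, V.card = n i → ∀ L : List ℕ, L.Nodup →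
      (∀ u ∈ L, u ∈ V) → L.length = w.length → forestWeight c w - δ
        ≤ bernExp (p i) (pairs V) fun A => if Explored A L w then 1 else 0 :=
    (Finset.eventually_all W).2 fun w _ =>
      eventually_le_bernExp_explored c w hn hnp h0 h1 (by linarith)
  filter_upwards [hev] with i hi V hV L hnd hLV hlen F hF0 hF
  calc b ≤ ∑ w ∈ W, (forestWeight c w - δ) * ψ w := hbδ
    _ ≤ ∑ w ∈ W, bernExp (p i) (pairs V) fun A => ψ w * if Explored A L w then 1 else 0 := by
        refine Finset.sum_le_sum fun w hw => ?_
        rw [bernExp_const_mul, mul_comm]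
        exact mul_le_mul_of_nonneg_left
          (hi w hw V hV L hnd hLV (hlen.trans (hW w hw).symm)) (hψ w)
    _ = bernExp (p i) (pairs V) fun A => ∑ w ∈ W, ψ w * if Explored A L w then 1 else 0 :=
        (bernExp_sum _ _ _ _).symm
    _ ≤ bernExp (p i) (pairs V) F := by
        refine bernExp_mono (h0 i) (h1 i) fun A hA => ?_
        by_cases h : ∃ w ∈ W, Explored A L w
        · obtain ⟨w, hw, hAw⟩ := h
          rw [Finset.sum_eq_single_of_mem w hw fun w' _ hne => by
            rw [if_neg fun h' => hne (h'.unique hAw), mul_zero], if_pos hAw, mul_one]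
          exact hF A w hAw
        · rw [Finset.sum_eq_zero fun w hw => by
            rw [if_neg fun h' => h ⟨w, hw, h'⟩, mul_zero]]
          exact hF0 A hA

end LocalLimit

section Increments

open ProbabilityTheory

variable {η : ℝ}

lemma exists_finset_lt_sum {β : Type*} [MeasurableSpace β] [MeasurableSingletonClass β]
    [Countable β] {μ : Measure β} {G : β → ℝ} (hG : Integrable G μ) {b : ℝ}
    (hb : b < ∫ x, G x ∂μ) : ∃ s : Finset β, b < ∑ x ∈ s, μ.real {x} * G x := by
  rw [integral_countable hG] at hb
  simp only [smul_eq_mul] at hb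
  rcases lt_or_ge b 0 with h | h
  · exact ⟨∅, by simpa using h⟩
  · have hs : Summable fun x => μ.real {x} * G x := by
      by_contra hs
      rw [tsum_eq_zero_of_not_summable hs] at hb
      linarith
    exact (hs.hasSum.eventually_const_lt hb).exists

lemma forestWeight_singleton (c : ℝ≥0) (t : PlaneTree) :
    forestWeight c [t] = (gwMeasure c).real {t} := by
  rw [Measure.real, gwMeasure_singleton]
  simp [forestWeight]

lemma forestWeight_pair {c : ℝ≥0} (hc : c ≤ 1) (q : PlaneTree × PlaneTree) :
    forestWeight c [q.1, q.2] = ((gwMeasure c).prod (gwMeasure c)).real {q} := by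
  have := isProbabilityMeasure_gwMeasure hc
  rw [Measure.real, ← Set.singleton_prod_singleton, Measure.prod_prod, ENNReal.toReal_mul,
    gwMeasure_singleton, gwMeasure_singleton]
  simp [forestWeight]

open Classical in
lemma eventually_le_bernExp_vertex {c : ℝ≥0} {n : ℕ → ℕ} {p : ℕ → ℝ}
    (hn : Tendsto n atTop atTop) (hnp : Tendsto (fun i => (n i : ℝ) * p i) atTop (nhds c))
    (h0 : ∀ i, 0 ≤ p i) (h1 : ∀ i, p i ≤ 1) {G : PlaneTree → ℝ}
    (hG : Integrable G (gwMeasure c)) (hG0 : ∀ t, 0 ≤ G t) {b : ℝ}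
    (hb : b < ∫ t, G t ∂gwMeasure c) :
    ∀ᶠ i in atTop, ∀ V : Finset ℕ, V.card = n i → ∀ v ∈ V, ∀ F : Finset (Sym2 ℕ) → ℝ,
      (∀ A ⊆ pairs V, 0 ≤ F A) → (∀ A t, Explored A [v] [t] → G t ≤ F A) →
      b ≤ bernExp (p i) (pairs V) F := by
  obtain ⟨s, hs⟩ := exists_finset_lt_sum hG hb
  set ψ : List PlaneTree → ℝ := fun w => match w with
    | [t] => G t
    | _ => 0 with hψ
  have hψ0 : ∀ w, 0 ≤ ψ w := fun w => by
    rcases w with _ | ⟨t, _ | ⟨t', w⟩⟩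
    · exact le_rfl
    · exact hG0 t
    · exact le_rfl
  have hsum : b < ∑ w ∈ s.image fun t => [t], forestWeight c w * ψ w := by
    rw [Finset.sum_image fun a _ b _ h => by simpa using h]
    simpa only [forestWeight_singleton] using hs
  filter_upwards [eventually_le_bernExp c hn hnp h0 h1 (s.image fun t => [t]) (k := 1)
    (fun w hw => by obtain ⟨t, _, rfl⟩ := Finset.mem_image.1 hw; rfl) hψ0 hsum]
    with i hi V hV v hv F hF0 hF
  refine hi V hV [v] (List.nodup_singleton v) (by simpa using hv) rfl F hF0 fun A w hAw => ?_
  obtain ⟨t, rfl⟩ := List.length_eq_one_iff.1 hAw.length_eq.symm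
  exact hF A t hAw

open Classical in
lemma eventually_le_bernExp_edge {c : ℝ≥0} (hc : c ≤ 1) {n : ℕ → ℕ} {p : ℕ → ℝ}
    (hn : Tendsto n atTop atTop) (hnp : Tendsto (fun i => (n i : ℝ) * p i) atTop (nhds c))
    (h0 : ∀ i, 0 ≤ p i) (h1 : ∀ i, p i ≤ 1) {G : PlaneTree × PlaneTree → ℝ}
    (hG : Integrable G ((gwMeasure c).prod (gwMeasure c))) (hG0 : ∀ q, 0 ≤ G q) {b : ℝ}
    (hb : b < ∫ q, G q ∂((gwMeasure c).prod (gwMeasure c))) :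
    ∀ᶠ i in atTop, ∀ V : Finset ℕ, V.card = n i → ∀ u ∈ V, ∀ v ∈ V, u ≠ v →
      ∀ F : Finset (Sym2 ℕ) → ℝ,
      (∀ A ⊆ pairs V, 0 ≤ F A) → (∀ A t₁ t₂, Explored A [u, v] [t₁, t₂] → G (t₁, t₂) ≤ F A) →
      b ≤ bernExp (p i) (pairs V) F := by
  obtain ⟨s, hs⟩ := exists_finset_lt_sum hG hb
  set ψ : List PlaneTree → ℝ := fun w => match w with
    | [t₁, t₂] => G (t₁, t₂)
    | _ => 0 with hψ
  have hψ0 : ∀ w, 0 ≤ ψ w := fun w => by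
    rcases w with _ | ⟨t, _ | ⟨t', _ | ⟨t'', w⟩⟩⟩
    · exact le_rfl
    · exact le_rfl
    · exact hG0 (t, t')
    · exact le_rfl
  have hsum : b < ∑ w ∈ s.image fun q => [q.1, q.2], forestWeight c w * ψ w := by
    rw [Finset.sum_image fun a _ b _ h => by
      simp only [List.cons.injEq, and_true] at h
      exact Prod.ext h.1 h.2]
    simpa only [forestWeight_pair hc] using hs
  filter_upwards [eventually_le_bernExp c hn hnp h0 h1 (s.image fun q => [q.1, q.2]) (k := 2)
    (fun w hw => by obtain ⟨t, _, rfl⟩ := Finset.mem_image.1 hw; rfl) hψ0 hsum]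
    with i hi V hV u hu v hv huv F hF0 hF
  refine hi V hV [u, v] (by simpa using huv) (by simp [hu, hv]) rfl F hF0 fun A w hAw => ?_
  have hlen := hAw.length_eq
  obtain ⟨t₁, t₂, rfl⟩ := List.length_eq_two.1 hlen.symm
  exact hF A t₁ t₂ hAw

/-- The mean log-volume of the random graph on `N` vertices with edge probability `p`. -/
noncomputable def meanLogVol (η : ℝ) (N : ℕ) (p : ℝ) : ℝ :=
  bernExp p (pairs (Finset.range N)) (logVol η)

lemma card_filter_mem_star_union {V R : Finset ℕ} {v : ℕ} (hv : v ∉ V) {A : Finset (Sym2 ℕ)}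
    (hA : A ⊆ pairs V) :
    ((R.image (fun u => s(v, u)) ∪ A).filter (v ∈ ·)).card = R.card := by
  rw [← Finset.card_image_of_injective R (injective_star v)]
  congr 1
  ext e
  rw [Finset.mem_filter, Finset.mem_union]
  constructor
  · rintro ⟨he | he, hve⟩
    · exact he
    · exact absurd (mem_of_mem_pairs (hA he) hve) hv
  · intro he
    obtain ⟨u, _, rfl⟩ := Finset.mem_image.1 he
    exact ⟨Or.inl he, Sym2.mem_mk_left v u⟩

lemma bernExp_degree (p : ℝ) (N : ℕ) :
    bernExp p (pairs (Finset.range (N + 1))) (fun A => ((A.filter (N ∈ ·)).card : ℝ)) = N * p := by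
  have hN : N ∉ Finset.range N := Finset.notMem_range_self
  rw [Finset.range_add_one, bernExp_pairs_insert p hN]
  calc _ = bernExp p (Finset.range N) fun R => (R.card : ℝ) :=
        bernExp_congr fun R _ => by
          rw [← bernExp_const p (pairs (Finset.range N)) (R.card : ℝ)]
          exact bernExp_congr fun A hA => by rw [card_filter_mem_star_union hN hA]
    _ = N * p := by rw [bernExp_card, Finset.card_range]

lemma meanLogVol_eq_filter (p : ℝ) (N : ℕ) :
    meanLogVol η N p
      = bernExp p (pairs (Finset.range (N + 1))) fun A => logVol η (A.filter (N ∉ ·)) := by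
  have hN : N ∉ Finset.range N := Finset.notMem_range_self
  rw [Finset.range_add_one, bernExp_pairs_insert p hN]
  calc _ = bernExp p (Finset.range N) fun _ => meanLogVol η N p := (bernExp_const _ _ _).symm
    _ = _ := bernExp_congr fun R _ => bernExp_congr fun A hA => by
        rw [filter_notMem_star_union hN hA]

lemma logVol_filter_le (hη : 0 < η) (A : Finset (Sym2 ℕ)) (v : ℕ) :
    logVol η (A.filter (v ∉ ·))
      ≤ logVol η A + ((A.filter (v ∈ ·)).card : ℝ) * (2 * halfLog η) := by
  have h := logVol_le_union hη (A.filter (v ∉ ·)) (A.filter (v ∈ ·))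
  rwa [Finset.union_comm, Finset.filter_union_filter_not_eq] at h

/-- Adding a vertex changes the mean log-volume by the expected `rootLog`. -/
lemma tendsto_meanLogVol_vertex (hη : 0 < η) {c : ℝ≥0} (hc : c ≤ 1) {p : ℕ → ℝ}
    (hnp : Tendsto (fun N : ℕ => (N : ℝ) * p N) atTop (nhds c))
    (h0 : ∀ i, 0 ≤ p i) (h1 : ∀ i, p i ≤ 1) :
    Tendsto (fun N => meanLogVol η (N + 1) (p N) - meanLogVol η N (p N)) atTop
      (nhds (∫ t, rootLog hη t ∂gwMeasure c)) := by
  have := isProbabilityMeasure_gwMeasure hc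
  have hn : Tendsto (fun N : ℕ => N + 1) atTop atTop := tendsto_add_atTop_nat 1
  have hnp' : Tendsto (fun N : ℕ => ((N + 1 : ℕ) : ℝ) * p N) atTop (nhds c) := by
    have h := hnp.add (tendsto_zero_of_mul_tendsto tendsto_id hnp)
    rw [add_zero] at h
    refine h.congr fun N => ?_
    push_cast
    ring
  have hdiff : ∀ N, meanLogVol η (N + 1) (p N) - meanLogVol η N (p N)
      = bernExp (p N) (pairs (Finset.range (N + 1)))
          fun A => logVol η A - logVol η (A.filter (N ∉ ·)) := fun N => by
    rw [meanLogVol_eq_filter (p N) N, bernExp_sub]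
    rfl
  have hκ := halfLog_nonneg hη
  have hI := integrable_rootLog hη hc
  have hI2 : Integrable (fun t => ((arity t : ℝ) + 1) * (2 * halfLog η)) (gwMeasure c) :=
    ((integrable_arity hc).add (integrable_const 1)).mul_const _
  refine tendsto_order.2 ⟨fun b hb => ?_, fun b hb => ?_⟩
  · obtain ⟨b', hb1, hb2⟩ := exists_between hb
    have hint : ∫ t, (rootLog hη t + ((arity t : ℝ) + 1) * (2 * halfLog η)) ∂gwMeasure c
        = ∫ t, rootLog hη t ∂gwMeasure c + (c + 1) * (2 * halfLog η) := by
      rw [integral_add hI hI2, integral_mul_const, integral_add (integrable_arity hc)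
        (integrable_const 1), integral_arity hc]
      simp
    have hlt : b' + (c + 1) * (2 * halfLog η)
        < ∫ t, (rootLog hη t + ((arity t : ℝ) + 1) * (2 * halfLog η)) ∂gwMeasure c := by
      rw [hint]; linarith
    have hG0 : ∀ t, 0 ≤ rootLog hη t + ((arity t : ℝ) + 1) * (2 * halfLog η) := fun t => by
      have h2 := (abs_le.1 (abs_rootLog_le hη t)).1
      have h3 : 0 ≤ ((arity t : ℝ) + 1) * halfLog η := by positivity
      linarith
    have hlim : Tendsto (fun N : ℕ => b' + (c + 1) * (2 * halfLog η)
        - ((N : ℝ) * p N + 1) * (2 * halfLog η)) atTop (nhds b') := by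
      have h := ((hnp.add_const 1).mul_const (2 * halfLog η)).const_sub
        (b' + (c + 1) * (2 * halfLog η))
      simpa using h
    filter_upwards [eventually_le_bernExp_vertex hn hnp' h0 h1 (hI.add hI2) hG0 hlt,
      hlim.eventually_const_lt hb1] with N hN hN2
    rw [hdiff]
    have h := hN (Finset.range (N + 1)) (Finset.card_range _) N (Finset.self_mem_range_succ N)
      (fun A => (logVol η A - logVol η (A.filter (N ∉ ·)))
        + (2 * halfLog η * ((A.filter (N ∈ ·)).card : ℝ) + 2 * halfLog η)) (fun A _ => ?_)
      fun A t hA => ?_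
    · rw [bernExp_add, bernExp_add, bernExp_const, bernExp_const_mul, bernExp_degree] at h
      linarith
    · have h := logVol_filter_le hη A N
      linarith
    · have h2 := hA.logVol_sub_logVol_filter hη
      have h3 := hA.card_filter_mem
      rw [h2, h3, Pi.add_apply]
      exact le_of_eq (by ring)
  · obtain ⟨b', hb1, hb2⟩ := exists_between hb
    have hlt : -b' < ∫ t, -rootLog hη t ∂gwMeasure c := by
      rw [integral_neg]; linarith
    filter_upwards [eventually_le_bernExp_vertex hn hnp' h0 h1 hI.neg
      (fun t => neg_nonneg.2 (rootLog_nonpos hη t)) hlt] with N hN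
    rw [hdiff]
    have h := hN (Finset.range (N + 1)) (Finset.card_range _) N (Finset.self_mem_range_succ N)
      (fun A => (-1) * (logVol η A - logVol η (A.filter (N ∉ ·)))) (fun A _ => ?_)
      fun A t hA => ?_
    · rw [bernExp_const_mul] at h
      linarith
    · have h := logVol_anti hη (Finset.filter_subset (N ∉ ·) A)
      linarith
    · rw [hA.logVol_sub_logVol_filter hη]
      simp

/-- The effect of one edge on the mean log-volume is uniformly close to the expected `pairLog`. -/
lemma eventually_edge_effect (hη : 0 < η) {c : ℝ≥0} (hc : c ≤ 1) {p : ℕ → ℝ}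
    (hnp : Tendsto (fun N : ℕ => (N : ℝ) * p N) atTop (nhds c))
    (h0 : ∀ i, 0 ≤ p i) (h1 : ∀ i, p i ≤ 1) {ε : ℝ} (hε : 0 < ε) :
    ∀ᶠ N in atTop, ∀ e ∈ pairs (Finset.range N),
      |bernExp (p N) (pairs (Finset.range N))
          (fun A => logVol η (insert e A) - logVol η (A.erase e))
        - ∫ q, pairLog hη q.1 q.2 ∂((gwMeasure c).prod (gwMeasure c))| ≤ ε := by
  have := isProbabilityMeasure_gwMeasure hc
  have hI := integrable_pairLog hη hc
  have hI2 : Integrable (fun _ : PlaneTree × PlaneTree => 2 * halfLog η)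
    ((gwMeasure c).prod (gwMeasure c)) := integrable_const _
  set J := ∫ q, pairLog hη q.1 q.2 ∂((gwMeasure c).prod (gwMeasure c)) with hJ
  have hlt1 : -J - ε < ∫ q, -pairLog hη q.1 q.2 ∂((gwMeasure c).prod (gwMeasure c)) := by
    rw [integral_neg]; linarith
  have hlt2 : J - ε + 2 * halfLog η
      < ∫ q, (pairLog hη q.1 q.2 + 2 * halfLog η) ∂((gwMeasure c).prod (gwMeasure c)) := by
    rw [integral_add hI hI2, integral_const, probReal_univ, one_smul]; linarith
  have herase : ∀ {A : Finset (Sym2 ℕ)} {u v : ℕ} {t₁ t₂ : PlaneTree},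
      Explored A [u, v] [t₁, t₂] → A.erase s(u, v) = A := by
    intro A u v t₁ t₂ h
    cases h with
    | cons _ _ _ R r ts _ hR hr hv hL hvL h =>
      exact Finset.erase_eq_of_notMem fun h' => hL v ((hR v).2 h') (by simp)
  have hle : ∀ (e : Sym2 ℕ) (A : Finset (Sym2 ℕ)),
      |logVol η (insert e A) - logVol η (A.erase e)| ≤ 2 * halfLog η := fun e A => by
    have h := abs_logVol_insert_sub_le hη e (A.erase e)
    by_cases he : e ∈ A
    · rw [Finset.insert_erase he] at h
      rwa [Finset.insert_eq_of_mem he]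
    · rwa [Finset.erase_eq_of_notMem he] at h ⊢
  have hle0 : ∀ (e : Sym2 ℕ) (A : Finset (Sym2 ℕ)),
      logVol η (insert e A) ≤ logVol η (A.erase e) := fun e A =>
    logVol_anti hη ((Finset.erase_subset e A).trans (Finset.subset_insert e A))
  filter_upwards [eventually_le_bernExp_edge hc tendsto_id hnp h0 h1 hI.neg
      (fun q => neg_nonneg.2 (pairLog_nonpos hη q.1 q.2)) hlt1,
    eventually_le_bernExp_edge hc tendsto_id hnp h0 h1 (hI.add hI2)
      (fun q => by
        have := (abs_le.1 (abs_pairLog_le hη q.1 q.2)).1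
        simp only [Pi.add_apply]
        linarith) hlt2] with N hN1 hN2 e he
  induction e using Sym2.ind with
  | _ u v =>
  obtain ⟨⟨hu, hv⟩, huv⟩ := mem_pairs.1 he
  have h2 := hN1 (Finset.range N) (Finset.card_range _) u hu v hv huv
    (fun A => (-1) * (logVol η (insert s(u, v) A) - logVol η (A.erase s(u, v)))) (fun A _ => ?_)
    fun A t₁ t₂ hA => ?_
  · have h3 := hN2 (Finset.range N) (Finset.card_range _) u hu v hv huv
      (fun A => (logVol η (insert s(u, v) A) - logVol η (A.erase s(u, v))) + 2 * halfLog η)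
      (fun A _ => ?_) fun A t₁ t₂ hA => ?_
    · rw [bernExp_const_mul] at h2
      rw [bernExp_add, bernExp_const] at h3
      rw [abs_le]
      constructor <;> linarith
    · linarith [(abs_le.1 (hle s(u, v) A)).1]
    · rw [herase hA, hA.logVol_insert_sub_logVol hη]
      exact le_rfl
  · linarith [hle0 s(u, v) A]
  · rw [herase hA, hA.logVol_insert_sub_logVol hη]
    simp

end Increments

section Convergence

variable {η : ℝ}

/-- The probability that a given pair of the `N` vertices is an edge of the random multigraph. -/
noncomputable def edgeProb (c : ℝ) (N : ℕ) : ℝ := 1 - Real.exp (-(c / ((N - 1 : ℕ) : ℝ)))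

lemma edgeProb_nonneg {c : ℝ} (hc : 0 ≤ c) (N : ℕ) : 0 ≤ edgeProb c N :=
  sub_nonneg.2 (Real.exp_le_one_iff.2 (neg_nonpos.2 (by positivity)))

lemma edgeProb_le_one (c : ℝ) (N : ℕ) : edgeProb c N ≤ 1 :=
  sub_le_self _ (Real.exp_nonneg _)

lemma mul_exp_neg_le_exp_neg_sub (x y : ℝ) :
    (x - y) * Real.exp (-x) ≤ Real.exp (-y) - Real.exp (-x) := by
  have h := mul_le_mul_of_nonneg_right (Real.add_one_le_exp (x - y)) (Real.exp_nonneg (-x))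
  rw [← Real.exp_add, show x - y + -x = -y by ring] at h
  linarith

lemma exp_neg_sub_le_mul_exp_neg (x y : ℝ) :
    Real.exp (-y) - Real.exp (-x) ≤ (x - y) * Real.exp (-y) := by
  linarith [mul_exp_neg_le_exp_neg_sub y x]

lemma tendsto_const_div_natCast_pred (c : ℝ) :
    Tendsto (fun N : ℕ => c / ((N - 1 : ℕ) : ℝ)) atTop (nhds 0) :=
  (tendsto_const_div_atTop_nhds_zero_nat c).comp (tendsto_sub_atTop_nat 1)

lemma tendsto_mul_edgeProb_succ (c : ℝ) :
    Tendsto (fun N : ℕ => (N : ℝ) * edgeProb c (N + 1)) atTop (nhds c) := by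
  have h0 := tendsto_const_div_atTop_nhds_zero_nat c
  have h1 : Tendsto (fun N : ℕ => c * Real.exp (-(c / (N : ℝ)))) atTop (nhds c) := by
    have h := ((Real.continuous_exp.tendsto _).comp h0.neg).const_mul c
    simpa using h
  refine tendsto_of_tendsto_of_tendsto_of_le_of_le' h1 tendsto_const_nhds ?_ ?_
  all_goals
    filter_upwards [eventually_gt_atTop 0] with N hN
    have hN' : (0 : ℝ) < N := by exact_mod_cast hN
    have hc : (N : ℝ) * (c / N) = c := by field_simp
    rw [edgeProb, Nat.add_sub_cancel]
  · have h := mul_le_mul_of_nonneg_left (mul_exp_neg_le_exp_neg_sub (c / N) 0) hN'.le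
    rwa [sub_zero, ← mul_assoc, hc, neg_zero, Real.exp_zero] at h
  · have h := mul_le_mul_of_nonneg_left (exp_neg_sub_le_mul_exp_neg (c / N) 0) hN'.le
    rwa [sub_zero, ← mul_assoc, hc, neg_zero, Real.exp_zero, mul_one] at h

lemma tendsto_mul_edgeProb (c : ℝ) :
    Tendsto (fun N : ℕ => (N : ℝ) * edgeProb c N) atTop (nhds c) := by
  rw [← tendsto_add_atTop_iff_nat 1]
  have h := tendsto_mul_edgeProb_succ c
  have h2 := h.add (tendsto_zero_of_mul_tendsto tendsto_id h)
  rw [add_zero] at h2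
  exact h2.congr fun N => by push_cast; ring

lemma div_pred_sub_div {N : ℕ} (hN : 2 ≤ N) (c : ℝ) :
    (c / ((N - 1 : ℕ) : ℝ) - c / (N : ℝ)) * ((N : ℝ) * ((N : ℝ) - 1) / 2) = c / 2 := by
  have h1 : (2 : ℝ) ≤ N := by exact_mod_cast hN
  have h2 : (N : ℝ) - 1 ≠ 0 := by linarith
  have h3 : (N : ℝ) ≠ 0 := by linarith
  rw [Nat.cast_sub (by lia), Nat.cast_one]
  field_simp
  ring

lemma edgeProb_succ_le {c : ℝ} (hc : 0 ≤ c) {N : ℕ} (hN : 2 ≤ N) :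
    edgeProb c (N + 1) ≤ edgeProb c N := by
  have h1 : (2 : ℝ) ≤ N := by exact_mod_cast hN
  rw [edgeProb, edgeProb, Nat.add_sub_cancel]
  refine sub_le_sub_left (Real.exp_le_exp.2 (neg_le_neg (div_le_div_of_nonneg_left hc ?_ ?_))) 1
  · exact_mod_cast (by lia : 0 < N - 1)
  · exact_mod_cast Nat.sub_le N 1

lemma tendsto_edgeProb_sub_mul_card (c : ℝ) :
    Tendsto (fun N : ℕ => (edgeProb c N - edgeProb c (N + 1))
      * ((pairs (Finset.range N)).card : ℝ)) atTop (nhds (c / 2)) := by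
  have h1 : Tendsto (fun N : ℕ => c / 2 * Real.exp (-(c / ((N - 1 : ℕ) : ℝ)))) atTop
      (nhds (c / 2)) := by
    have h := ((Real.continuous_exp.tendsto _).comp
      (tendsto_const_div_natCast_pred c).neg).const_mul (c / 2)
    simpa using h
  have h2 : Tendsto (fun N : ℕ => c / 2 * Real.exp (-(c / (N : ℝ)))) atTop (nhds (c / 2)) := by
    have h := ((Real.continuous_exp.tendsto _).comp
      (tendsto_const_div_atTop_nhds_zero_nat c).neg).const_mul (c / 2)
    simpa using h
  refine tendsto_of_tendsto_of_tendsto_of_le_of_le' h1 h2 ?_ ?_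
  all_goals
    filter_upwards [eventually_ge_atTop 2] with N hN
    have hd := div_pred_sub_div hN c
    have hN' : (2 : ℝ) ≤ N := by exact_mod_cast hN
    have hM : (0 : ℝ) ≤ (N : ℝ) * ((N : ℝ) - 1) / 2 := by
      have : (0 : ℝ) ≤ (N : ℝ) - 1 := by linarith
      positivity
    rw [card_pairs, Finset.card_range, edgeProb, edgeProb, Nat.add_sub_cancel, sub_sub_sub_cancel_left]
  · have h := mul_le_mul_of_nonneg_right
      (mul_exp_neg_le_exp_neg_sub (c / ((N - 1 : ℕ) : ℝ)) (c / N)) hM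
    rwa [mul_right_comm, hd] at h
  · have h := mul_le_mul_of_nonneg_right
      (exp_neg_sub_le_mul_exp_neg (c / ((N - 1 : ℕ) : ℝ)) (c / N)) hM
    rwa [mul_right_comm, hd] at h

/-- Lowering the edge probability from `edgeProb c N` to `edgeProb c (N + 1)` changes the mean
log-volume by `c / 2` times the expected `pairLog`. -/
lemma tendsto_meanLogVol_edge (hη : 0 < η) {c : ℝ≥0} (hc : c ≤ 1) :
    Tendsto (fun N => meanLogVol η N (edgeProb c N) - meanLogVol η N (edgeProb c (N + 1))) atTop
      (nhds (c / 2 * ∫ q, pairLog hη q.1 q.2 ∂((gwMeasure c).prod (gwMeasure c)))) := by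
  set J := ∫ q, pairLog hη q.1 q.2 ∂((gwMeasure c).prod (gwMeasure c)) with hJ
  have hξ : ∀ N, ∃ ξ, 0 ≤ ξ ∧ ξ ≤ 1 ∧ (2 ≤ N → edgeProb c (N + 1) ≤ ξ ∧ ξ ≤ edgeProb c N ∧
      meanLogVol η N (edgeProb c N) - meanLogVol η N (edgeProb c (N + 1))
        = (edgeProb c N - edgeProb c (N + 1)) * ∑ e ∈ pairs (Finset.range N),
          bernExp ξ (pairs (Finset.range N))
            (fun A => logVol η (insert e A) - logVol η (A.erase e))) := fun N => by
    by_cases hN : 2 ≤ N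
    · rcases (edgeProb_succ_le c.coe_nonneg hN).eq_or_lt with h | h
      · exact ⟨edgeProb c N, edgeProb_nonneg c.coe_nonneg N, edgeProb_le_one c N,
          fun _ => ⟨h.le, le_rfl, by rw [h]; ring⟩⟩
      · obtain ⟨ξ, hξ, hs⟩ := exists_hasDerivAt_eq_slope _ _ h
          (fun x _ => (hasDerivAt_bernExp (pairs (Finset.range N)) (logVol η)
            x).continuousAt.continuousWithinAt)
          fun x _ => hasDerivAt_bernExp (pairs (Finset.range N)) (logVol η) x
        refine ⟨ξ, (edgeProb_nonneg c.coe_nonneg _).trans hξ.1.le,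
          hξ.2.le.trans (edgeProb_le_one c N), fun _ => ⟨hξ.1.le, hξ.2.le, ?_⟩⟩
        rw [hs, mul_div_cancel₀ _ (sub_pos.2 h).ne']
        rfl
    · exact ⟨0, le_rfl, zero_le_one, fun h => absurd h hN⟩
  choose ξ h0 h1 h2 using hξ
  have hnξ : Tendsto (fun N : ℕ => (N : ℝ) * ξ N) atTop (nhds c) := by
    refine tendsto_of_tendsto_of_tendsto_of_le_of_le' (tendsto_mul_edgeProb_succ c)
      (tendsto_mul_edgeProb c) ?_ ?_
    all_goals filter_upwards [eventually_ge_atTop 2] with N hN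
    · exact mul_le_mul_of_nonneg_left (h2 N hN).1 N.cast_nonneg
    · exact mul_le_mul_of_nonneg_left (h2 N hN).2.1 N.cast_nonneg
  have hw := tendsto_edgeProb_sub_mul_card (c : ℝ)
  have hr : Tendsto (fun N => meanLogVol η N (edgeProb c N) - meanLogVol η N (edgeProb c (N + 1))
      - (edgeProb c N - edgeProb c (N + 1)) * ((pairs (Finset.range N)).card : ℝ) * J) atTop
      (nhds 0) := by
    rw [Metric.tendsto_atTop']
    intro ε hε
    have hc2 : (0 : ℝ) < c / 2 + 1 := by positivity
    have hε' : 0 < ε / (c / 2 + 1) := by positivity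
    obtain ⟨N₀, hN₀⟩ := eventually_atTop.1 ((eventually_edge_effect hη hc hnξ h0 h1 hε').and
      ((hw.eventually_lt_const (lt_add_one _)).and (eventually_ge_atTop 2)))
    refine ⟨N₀, fun N hN => ?_⟩
    obtain ⟨he, hwN, hN2⟩ := hN₀ N hN.le
    rw [Real.dist_0_eq_abs, (h2 N hN2).2.2, mul_assoc, ← mul_sub, ← nsmul_eq_mul, ← Finset.sum_const,
      ← Finset.sum_sub_distrib, abs_mul,
      abs_of_nonneg (sub_nonneg.2 (edgeProb_succ_le c.coe_nonneg hN2))]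
    calc _ ≤ (edgeProb c N - edgeProb c (N + 1))
          * ∑ _e ∈ pairs (Finset.range N), ε / (c / 2 + 1) :=
          mul_le_mul_of_nonneg_left
            ((Finset.abs_sum_le_sum_abs _ _).trans (Finset.sum_le_sum fun e h => he e h))
            (sub_nonneg.2 (edgeProb_succ_le c.coe_nonneg hN2))
      _ = (edgeProb c N - edgeProb c (N + 1)) * ((pairs (Finset.range N)).card : ℝ)
          * (ε / (c / 2 + 1)) := by rw [Finset.sum_const, nsmul_eq_mul, mul_assoc]
      _ < (c / 2 + 1) * (ε / (c / 2 + 1)) := mul_lt_mul_of_pos_right hwN hε'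
      _ = ε := mul_div_cancel₀ _ hc2.ne'
  have h := hr.add (hw.mul_const J)
  rw [zero_add] at h
  exact h.congr fun N => by ring

lemma tendsto_meanLogVol_div (hη : 0 < η) {c : ℝ≥0} (hc : c ≤ 1) :
    Tendsto (fun N : ℕ => (N : ℝ)⁻¹ * meanLogVol η N (edgeProb c N)) atTop
      (nhds (∫ t, rootLog hη t ∂gwMeasure c
        - c / 2 * ∫ q, pairLog hη q.1 q.2 ∂((gwMeasure c).prod (gwMeasure c)))) := by
  have h := ((tendsto_meanLogVol_vertex hη hc (tendsto_mul_edgeProb_succ (c : ℝ))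
    (fun N => edgeProb_nonneg c.coe_nonneg _) fun N => edgeProb_le_one c _).sub
    (tendsto_meanLogVol_edge hη hc)).cesaro
  refine h.congr fun N => ?_
  have hz : meanLogVol η 0 (edgeProb c 0) = 0 := by
    have := isProbabilityMeasure_spinMeasure hη
    have hp : pairs (Finset.range 0) = ∅ := by
      rw [← Finset.card_eq_zero, ← Nat.cast_eq_zero (R := ℝ), card_pairs]
      simp
    rw [meanLogVol, hp, bernExp_empty, logVol, vol_empty hη]
    simp
  rw [Finset.sum_congr rfl fun i _ => sub_sub_sub_cancel_right (meanLogVol η (i + 1) (edgeProb c (i + 1)))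
    (meanLogVol η i (edgeProb c i)) (meanLogVol η i (edgeProb c (i + 1))),
    Finset.sum_range_sub fun i => meanLogVol η i (edgeProb c i), hz, sub_zero]

lemma bernExp_abs_le_sqrt {ε : Type*} [DecidableEq ε] {p : ℝ} (h0 : 0 ≤ p) (h1 : p ≤ 1)
    (S : Finset ε) (F : Finset ε → ℝ) :
    bernExp p S (fun A => |F A|) ≤ √(bernExp p S fun A => F A ^ 2) := by
  refine Real.le_sqrt_of_sq_le ?_
  set a := bernExp p S fun A => |F A| with ha
  have h : 0 ≤ bernExp p S fun A => F A ^ 2 + (a ^ 2 - 2 * a * |F A|) :=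
    bernExp_nonneg h0 h1 fun A _ => by
      rw [← sq_abs (F A)]
      nlinarith [sq_nonneg (|F A| - a)]
  rw [bernExp_add, bernExp_sub, bernExp_const, bernExp_const_mul, ← ha] at h
  nlinarith

/-- The normalized log-volume of the random graph converges in mean. -/
lemma tendsto_bernExp_abs_logVol_sub (hη : 0 < η) {c : ℝ≥0} (hc : c ≤ 1) :
    Tendsto (fun N : ℕ => bernExp (edgeProb c N) (pairs (Finset.range N)) fun A =>
      |(N : ℝ)⁻¹ * logVol η A - (∫ t, rootLog hη t ∂gwMeasure c
        - c / 2 * ∫ q, pairLog hη q.1 q.2 ∂((gwMeasure c).prod (gwMeasure c)))|) atTop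
      (nhds 0) := by
  have hm := tendsto_meanLogVol_div hη hc
  set ℓ := ∫ t, rootLog hη t ∂gwMeasure c
        - c / 2 * ∫ q, pairLog hη q.1 q.2 ∂((gwMeasure c).prod (gwMeasure c)) with hℓ
  have hlim : Tendsto (fun N : ℕ => √(((N : ℝ)⁻¹ * meanLogVol η N (edgeProb c N) - ℓ) ^ 2
      + edgeProb c N * (2 * halfLog η) ^ 2 / 2)) atTop (nhds 0) := by
    have hp : Tendsto (edgeProb c) atTop (nhds 0) :=
      tendsto_zero_of_mul_tendsto tendsto_id (tendsto_mul_edgeProb (c : ℝ))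
    have h := (((hm.sub_const ℓ).pow 2).add
      ((hp.mul_const ((2 * halfLog η) ^ 2)).div_const 2)).sqrt
    simpa using h
  refine squeeze_zero (fun N => bernExp_nonneg (edgeProb_nonneg c.coe_nonneg N)
    (edgeProb_le_one c N) fun A _ => abs_nonneg _) (fun N => ?_) hlim
  have hp0 := edgeProb_nonneg c.coe_nonneg N
  refine (bernExp_abs_le_sqrt hp0 (edgeProb_le_one c N) _ _).trans (Real.sqrt_le_sqrt ?_)
  have hvar := bernExp_variance_le hp0 (edgeProb_le_one c N) (pairs (Finset.range N)) (logVol η)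
    fun A e => abs_logVol_insert_sub_le hη e A
  rw [card_pairs, Finset.card_range] at hvar
  have hsq : bernExp (edgeProb c N) (pairs (Finset.range N))
      (fun A => ((N : ℝ)⁻¹ * logVol η A - ℓ) ^ 2)
      = ((N : ℝ)⁻¹) ^ 2 * (bernExp (edgeProb c N) (pairs (Finset.range N))
        (fun A => logVol η A ^ 2) - meanLogVol η N (edgeProb c N) ^ 2)
        + ((N : ℝ)⁻¹ * meanLogVol η N (edgeProb c N) - ℓ) ^ 2 := by
    rw [bernExp_congr (G := fun A => (((N : ℝ)⁻¹) ^ 2 * logVol η A ^ 2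
      - 2 * (N : ℝ)⁻¹ * ℓ * logVol η A) + ℓ ^ 2) fun A _ => by ring, bernExp_add, bernExp_sub,
      bernExp_const, bernExp_const_mul, bernExp_const_mul, meanLogVol]
    ring
  rw [hsq, add_comm]
  gcongr
  refine (mul_le_mul_of_nonneg_left hvar (sq_nonneg _)).trans ?_
  rcases N.eq_zero_or_pos with rfl | hN
  · rw [Nat.cast_zero, inv_zero, zero_pow two_ne_zero, zero_mul]
    positivity
  · have hN' : (0 : ℝ) < N := by exact_mod_cast hN
    have h2 : ((N : ℝ)⁻¹) ^ 2 * (N * (N - 1) / 2) ≤ 1 / 2 := by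
      rw [inv_pow, inv_mul_le_iff₀ (by positivity)]
      nlinarith
    have h3 : 0 ≤ edgeProb c N * (2 * halfLog η) ^ 2 := by positivity
    calc _ = ((N : ℝ)⁻¹) ^ 2 * (N * (N - 1) / 2) * (edgeProb c N * (2 * halfLog η) ^ 2) := by ring
      _ ≤ 1 / 2 * (edgeProb c N * (2 * halfLog η) ^ 2) := mul_le_mul_of_nonneg_right h2 h3
      _ = _ := by ring

end Convergence

section RandomGraph

open ProbabilityTheory

/-- The edge `{f 0, f 1}` of a pair of vertices. -/
def edgeOf {N : ℕ} (f : Fin 2 → Fin N) : Sym2 ℕ := s((f 0 : ℕ), (f 1 : ℕ))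

lemma edgeOf_mem_pairs {N : ℕ} {f : Fin 2 → Fin N} :
    edgeOf f ∈ pairs (Finset.range N) ↔ Function.Injective f := by
  rw [edgeOf, mem_pairs]
  simp only [Finset.mem_range, Fin.is_lt, and_self, true_and]
  constructor
  · intro h i j hij
    fin_cases i <;> fin_cases j
    · rfl
    · exact absurd (congrArg Fin.val hij) h
    · exact absurd (congrArg Fin.val hij.symm) h
    · rfl
  · intro h h01
    exact absurd (h (Fin.ext h01)) (by decide)

lemma card_filter_edgeOf_mem {N : ℕ} {B : Finset (Sym2 ℕ)} (hB : B ⊆ pairs (Finset.range N)) :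
    (Finset.univ.filter fun f : Fin 2 → Fin N => edgeOf f ∈ B).card = B.card * 2 := by
  have hmaps : ∀ f ∈ Finset.univ.filter fun f : Fin 2 → Fin N => edgeOf f ∈ B, edgeOf f ∈ B :=
    fun f hf => (Finset.mem_filter.1 hf).2
  rw [Finset.card_eq_sum_card_fiberwise hmaps]
  refine Finset.sum_const_nat fun e he => ?_
  induction e using Sym2.ind with
  | _ i j =>
  obtain ⟨⟨hi, hj⟩, hij⟩ := mem_pairs.1 (hB he)
  rw [Finset.mem_range] at hi hj
  have hne : (![⟨i, hi⟩, ⟨j, hj⟩] : Fin 2 → Fin N) ≠ ![⟨j, hj⟩, ⟨i, hi⟩] := fun h =>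
    hij (congrArg Fin.val (congrFun h 0))
  refine Eq.trans (congrArg Finset.card ?_) (Finset.card_pair hne)
  ext f
  have hiff : edgeOf f = s(i, j) ↔ f = ![⟨i, hi⟩, ⟨j, hj⟩] ∨ f = ![⟨j, hj⟩, ⟨i, hi⟩] := by
    simp [edgeOf, funext_iff, Fin.forall_fin_two, Fin.ext_iff]
  rw [Finset.mem_filter, Finset.mem_insert, Finset.mem_singleton, ← hiff]
  exact ⟨fun h => h.2, fun h => ⟨Finset.mem_filter.2 ⟨Finset.mem_univ _, h ▸ he⟩, h⟩⟩

lemma uniformOn_edgeOf_mem {N : ℕ} {B : Finset (Sym2 ℕ)} (hB : B ⊆ pairs (Finset.range N)) :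
    uniformOn {f : Fin 2 → Fin N | Function.Injective f} {f | edgeOf f ∈ B}
      = ENNReal.ofReal ((B.card : ℝ) / (pairs (Finset.range N)).card) := by
  set S := pairs (Finset.range N) with hS
  have h1 : {f : Fin 2 → Fin N | Function.Injective f}
      = ((Finset.univ.filter fun f : Fin 2 → Fin N => edgeOf f ∈ S : Finset _) : Set _) := by
    ext f
    simp [← edgeOf_mem_pairs, hS]
  have h2 : {f : Fin 2 → Fin N | edgeOf f ∈ B}
      = ((Finset.univ.filter fun f : Fin 2 → Fin N => edgeOf f ∈ B : Finset _) : Set _) := by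
    ext f
    simp
  have h3 : (Finset.univ.filter fun f : Fin 2 → Fin N => edgeOf f ∈ S)
      ∩ (Finset.univ.filter fun f => edgeOf f ∈ B) = Finset.univ.filter fun f => edgeOf f ∈ B :=
    Finset.inter_eq_right.2 (Finset.monotone_filter_right _ fun f _ hf => hB hf)
  rw [h1, h2, uniformOn_apply_finset, h3, card_filter_edgeOf_mem hB,
    card_filter_edgeOf_mem (Finset.Subset.refl _)]
  rcases S.card.eq_zero_or_pos with h0 | h0
  · have hB0 : B.card = 0 := Nat.le_zero.1 (h0 ▸ Finset.card_le_card hB)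
    simp [hB0]
  · rw [ENNReal.ofReal_div_of_pos (by exact_mod_cast h0), ENNReal.ofReal_natCast,
      ENNReal.ofReal_natCast, Nat.cast_mul, Nat.cast_mul]
    exact ENNReal.mul_div_mul_right _ _ (by simp) (by simp)

/-- The edge set formed by the first `n` of a sequence of pairs. -/
def edgeSet {N : ℕ} (n : ℕ) (e : ℕ → Fin 2 → Fin N) : Finset (Sym2 ℕ) :=
  (Finset.range n).image fun k => edgeOf (e k)

lemma edgeSet_subset_iff {N n : ℕ} {e : ℕ → Fin 2 → Fin N} {B : Finset (Sym2 ℕ)} :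
    edgeSet n e ⊆ B ↔ ∀ k : Fin n, edgeOf (e k) ∈ B := by
  simp [edgeSet, Finset.image_subset_iff, Fin.forall_iff]

/-- Möbius inversion on subsets of `S`. -/
lemma eq_of_sum_powerset_eq {ε : Type*} [DecidableEq ε] {S : Finset ε} {u w : Finset ε → ℝ}
    (h : ∀ B ⊆ S, ∑ C ∈ B.powerset, u C = ∑ C ∈ B.powerset, w C) {B : Finset ε} (hB : B ⊆ S) :
    u B = w B := by
  induction B using Finset.strongInduction with
  | H B ih =>
    have h1 := h B hB
    rw [← Finset.add_sum_erase _ _ (Finset.mem_powerset_self B),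
      ← Finset.add_sum_erase _ _ (Finset.mem_powerset_self B),
      Finset.sum_congr rfl fun C hC => ?_] at h1
    · exact add_right_cancel h1
    · have hC' : C ⊂ B := Finset.mem_ssubsets.1 hC
      exact ih C hC' (hC'.1.trans hB)

variable {Ω : Type*} [MeasurableSpace Ω] {μ : Measure Ω} {N : ℕ}
  {K : Ω → ℕ} {E : ℕ → Ω → Fin 2 → Fin N} {β : ℝ≥0}

/-- The edge set of the random multigraph. -/
def randomEdges (K : Ω → ℕ) (E : ℕ → Ω → Fin 2 → Fin N) (ω : Ω) : Finset (Sym2 ℕ) :=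
  edgeSet (K ω) fun k => E k ω

lemma aemeasurable_of_law (hN : 2 ≤ N)
    (hlaw : ∀ n : ℕ, Measure.map (fun ω => (K ω, fun k : Fin n => E k ω)) μ
      = (poissonMeasure β).prod
          (Measure.pi fun _ : Fin n => uniformOn {e : Fin 2 → Fin N | Function.Injective e}))
    (n : ℕ) : AEMeasurable (fun ω => (K ω, fun k : Fin n => E k ω)) μ := by
  have : IsProbabilityMeasure (uniformOn {e : Fin 2 → Fin N | Function.Injective e}) :=
    isProbabilityMeasure_uniformOn (Set.toFinite _)
      ⟨Fin.castLE hN, Fin.castLE_injective hN⟩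
  by_contra h
  have h2 := hlaw n
  rw [Measure.map_of_not_aemeasurable h] at h2
  exact IsProbabilityMeasure.ne_zero _ h2.symm

lemma nullMeasurableSet_randomEdges
    (hm : ∀ n : ℕ, AEMeasurable (fun ω => (K ω, fun k : Fin n => E k ω)) μ)
    (P : Finset (Sym2 ℕ) → Prop) : NullMeasurableSet {ω | P (randomEdges K E ω)} μ := by
  have h : {ω | P (randomEdges K E ω)} = ⋃ n : ℕ, (fun ω => (K ω, fun k : Fin n => E k ω)) ⁻¹'
      {x | x.1 = n ∧ P (Finset.univ.image fun k => edgeOf (x.2 k))} := by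
    ext ω
    have himg : randomEdges K E ω = Finset.univ.image fun k : Fin (K ω) => edgeOf (E k ω) := by
      ext e
      simp [randomEdges, edgeSet, Fin.exists_iff]
    simp only [Set.mem_iUnion, Set.mem_preimage, Set.mem_ofPred_eq, himg]
    exact ⟨fun h => ⟨K ω, rfl, h⟩, fun ⟨n, hn, h⟩ => by subst hn; exact h⟩
  rw [h]
  exact NullMeasurableSet.iUnion fun n => (hm n).nullMeasurable
    (Set.to_countable _).measurableSet

lemma measure_randomEdges_subset [IsProbabilityMeasure μ] (hN : 2 ≤ N)
    (hlaw : ∀ n : ℕ, Measure.map (fun ω => (K ω, fun k : Fin n => E k ω)) μ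
      = (poissonMeasure β).prod
          (Measure.pi fun _ : Fin n => uniformOn {e : Fin 2 → Fin N | Function.Injective e}))
    {B : Finset (Sym2 ℕ)} (hB : B ⊆ pairs (Finset.range N)) :
    μ {ω | randomEdges K E ω ⊆ B} = ENNReal.ofReal
      (Real.exp (β * ((B.card : ℝ) / (pairs (Finset.range N)).card - 1))) := by
  have hm := aemeasurable_of_law hN hlaw
  have : IsProbabilityMeasure (uniformOn {e : Fin 2 → Fin N | Function.Injective e}) :=
    isProbabilityMeasure_uniformOn (Set.toFinite _)
      ⟨Fin.castLE hN, Fin.castLE_injective hN⟩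
  have hmeas : ∀ n : ℕ, MeasurableSet ({n} ×ˢ (Set.univ.pi fun _ => {f | edgeOf f ∈ B}) :
      Set (ℕ × (Fin n → Fin 2 → Fin N))) := fun n => (Set.to_countable _).measurableSet
  have h : {ω | randomEdges K E ω ⊆ B} = ⋃ n : ℕ, (fun ω => (K ω, fun k : Fin n => E k ω)) ⁻¹'
      ({n} ×ˢ (Set.univ.pi fun _ => {f | edgeOf f ∈ B})) := by
    ext ω
    simp only [randomEdges, edgeSet_subset_iff, Set.mem_iUnion, Set.mem_preimage, Set.mem_prod,
      Set.mem_singleton_iff, Set.mem_pi, Set.mem_univ, forall_const, Set.mem_ofPred_eq]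
    exact ⟨fun h => ⟨K ω, rfl, h⟩, fun ⟨n, hn, h⟩ => by subst hn; exact h⟩
  rw [h, measure_iUnion₀ ?_ fun n => (hm n).nullMeasurable (hmeas n),
    ← poisson_pgf β (by positivity)]
  · refine tsum_congr fun n => ?_
    rw [← Measure.map_apply_of_aemeasurable (hm n) (hmeas n), hlaw, Measure.prod_prod,
      Measure.pi_pi, Finset.prod_const, Finset.card_univ, Fintype.card_fin, uniformOn_edgeOf_mem hB]
  · refine fun m n hmn => Disjoint.aedisjoint (Set.disjoint_left.2 fun ω h1 h2 => hmn ?_)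
    have h3 : K ω = m := h1.1
    have h4 : K ω = n := h2.1
    exact h3.symm.trans h4

lemma integral_randomEdges_eq_sum [IsProbabilityMeasure μ]
    (hm : ∀ n : ℕ, AEMeasurable (fun ω => (K ω, fun k : Fin n => E k ω)) μ) {S : Finset (Sym2 ℕ)}
    (hS : ∀ᵐ ω ∂μ, randomEdges K E ω ⊆ S) (G : Finset (Sym2 ℕ) → ℝ) :
    ∫ ω, G (randomEdges K E ω) ∂μ
      = ∑ B ∈ S.powerset, μ.real {ω | randomEdges K E ω = B} * G B := by
  have hn : ∀ B, NullMeasurableSet {ω | randomEdges K E ω = B} μ := fun B =>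
    nullMeasurableSet_randomEdges hm (· = B)
  have hae : (fun ω => G (randomEdges K E ω)) =ᵐ[μ]
      fun ω => ∑ B ∈ S.powerset, {ω | randomEdges K E ω = B}.indicator (fun _ => G B) ω := by
    filter_upwards [hS] with ω hω
    rw [Finset.sum_eq_single_of_mem (randomEdges K E ω) (Finset.mem_powerset.2 hω)]
    · exact (Set.indicator_of_mem (s := {ω' | randomEdges K E ω' = randomEdges K E ω}) rfl
        fun _ => G (randomEdges K E ω)).symm
    · exact fun B _ hB => Set.indicator_of_notMem
        (s := {ω | randomEdges K E ω = B}) (fun h => hB (Eq.symm h)) _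
  rw [integral_congr_ae hae, integral_finsetSum _ fun B _ =>
    (integrable_const (G B)).indicator₀ (hn B)]
  refine Finset.sum_congr rfl fun B _ => ?_
  rw [integral_indicator₀ (hn B), setIntegral_const, smul_eq_mul]

/-- The random multigraph with a Poisson number of edges has independent edges once
multiplicities are forgotten. -/
lemma integral_randomEdges [IsProbabilityMeasure μ] (hN : 2 ≤ N) {α : ℝ≥0}
    (hlaw : ∀ n : ℕ, Measure.map (fun ω => (K ω, fun k : Fin n => E k ω)) μ
      = (poissonMeasure (α * N)).prod
          (Measure.pi fun _ : Fin n => uniformOn {e : Fin 2 → Fin N | Function.Injective e}))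
    (G : Finset (Sym2 ℕ) → ℝ) :
    ∫ ω, G (randomEdges K E ω) ∂μ
      = bernExp (edgeProb (2 * α) N) (pairs (Finset.range N)) G := by
  have hm := aemeasurable_of_law hN hlaw
  set S := pairs (Finset.range N) with hS
  set p := edgeProb (2 * α) N with hp
  have hN' : (2 : ℝ) ≤ N := by exact_mod_cast hN
  have hScard : (S.card : ℝ) = N * (N - 1) / 2 := by rw [hS, card_pairs, Finset.card_range]
  have hS0 : (S.card : ℝ) ≠ 0 := by
    rw [hScard]
    have : (0 : ℝ) < N - 1 := by linarith
    positivity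
  have hsub : ∀ B ⊆ S, μ.real {ω | randomEdges K E ω ⊆ B} = (1 - p) ^ (S.card - B.card) :=
    fun B hB => by
    rw [Measure.real, measure_randomEdges_subset hN hlaw hB,
      ENNReal.toReal_ofReal (Real.exp_nonneg _), hp, edgeProb, sub_sub_cancel, ← Real.exp_nat_mul,
      Nat.cast_sub (Finset.card_le_card hB), ← hS]
    congr 1
    have h1 : (N : ℝ) - 1 ≠ 0 := by linarith
    have h2 : (N : ℝ) ≠ 0 := by linarith
    rw [Nat.cast_sub (by lia : 1 ≤ N), NNReal.coe_mul, NNReal.coe_natCast, hScard]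
    push_cast
    field_simp
    ring
  have hae : ∀ᵐ ω ∂μ, randomEdges K E ω ⊆ S := by
    refine (prob_compl_eq_zero_iff₀ (nullMeasurableSet_randomEdges hm (· ⊆ S))).2 ?_
    rw [measure_randomEdges_subset hN hlaw (Finset.Subset.refl S), ← hS, div_self hS0, sub_self,
      mul_zero, Real.exp_zero, ENNReal.ofReal_one]
  rw [integral_randomEdges_eq_sum hm hae, bernExp]
  refine Finset.sum_congr rfl fun B hB => ?_
  congr 1
  refine eq_of_sum_powerset_eq (S := S) (u := fun B => μ.real {ω | randomEdges K E ω = B})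
    (w := fun B => p ^ B.card * (1 - p) ^ (S.card - B.card)) (fun B hB => ?_)
    (Finset.mem_powerset.1 hB)
  have hun : {ω | randomEdges K E ω ⊆ B}
      = ⋃ C ∈ B.powerset, {ω | randomEdges K E ω = C} := by
    ext ω
    simp
  have hone : ∑ C ∈ B.powerset, p ^ C.card * (1 - p) ^ (B.card - C.card) = 1 := by
    simpa [bernExp] using bernExp_const p B 1
  rw [← measureReal_biUnion_finset₀ (f := fun C => {ω | randomEdges K E ω = C}) (fun C _ D _ hCD => Disjoint.aedisjoint
      (Set.disjoint_left.2 fun ω h1 h2 => hCD (Eq.trans (Eq.symm h1) h2)))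
    (fun C _ => nullMeasurableSet_randomEdges hm (· = C)), ← hun, hsub B hB]
  refine (mul_one _).symm.trans ?_
  refine (congrArg _ hone.symm).trans ?_
  rw [Finset.mul_sum]
  refine Finset.sum_congr rfl fun C hC => ?_
  have h1 := Finset.card_le_card (Finset.mem_powerset.1 hC)
  have h2 := Finset.card_le_card hB
  refine (mul_left_comm _ _ _).trans ?_
  rw [← pow_add]
  congr 2
  lia

end RandomGraph

section Polytope

open ProbabilityTheory

local notation "𝕀" => Set.Elem (Set.Icc (0:ℝ) 1)

variable {η : ℝ}

lemma measurable_restrict_fin (N : ℕ) : Measurable fun (σ : ℕ → 𝕀) (i : Fin N) => σ i :=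
  measurable_pi_lambda _ fun i => measurable_pi_apply (i : ℕ)

lemma spinMeasure_map_restrict (hη : 0 < η) (N : ℕ) :
    (spinMeasure η).map (fun σ (i : Fin N) => σ i) = Measure.pi fun _ : Fin N => fugMeasure η := by
  have := isProbabilityMeasure_fugMeasure hη
  refine (Measure.pi_eq fun s hs => ?_).symm
  have hpre : (fun (σ : ℕ → 𝕀) (i : Fin N) => σ i) ⁻¹' Set.univ.pi s
      = Set.pi (Finset.range N) fun i => if h : i < N then s ⟨i, h⟩ else Set.univ := by
    ext σ
    simp only [Set.mem_preimage, Set.mem_pi, Set.mem_univ, forall_const, Finset.coe_range,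
      Set.mem_Iio]
    exact ⟨fun h i hi => by rw [dif_pos hi]; exact h ⟨i, hi⟩,
      fun h i => by simpa using h i i.is_lt⟩
  rw [Measure.map_apply (measurable_restrict_fin N)
    (MeasurableSet.univ_pi hs), hpre, spinMeasure, Measure.infinitePi_pi _ fun i hi => ?_,
    Finset.prod_range]
  · simp
  · rw [dif_pos (Finset.mem_range.1 hi)]
    exact hs _

lemma measure_polytope_eq_vol (hη : 0 < η) {Ω : Type*} {N : ℕ} (K : Ω → ℕ)
    (E : ℕ → Ω → Fin 2 → Fin N) (ω : Ω) :
    (Measure.pi fun _ : Fin N => fugMeasure η) (polytope N K E ω) = vol η (randomEdges K E ω) := by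
  have hmeas : MeasurableSet (polytope N K E ω) := by
    have h : polytope N K E ω = ⋂ k, ⋂ _ : k < K ω,
        {σ : Fin N → 𝕀 | (σ (E k ω 0) : ℝ) + σ (E k ω 1) ≤ 1} := by
      ext σ
      simp [polytope]
    rw [h]
    exact MeasurableSet.iInter fun k => MeasurableSet.iInter fun _ =>
      measurableSet_le ((measurable_subtype_coe.comp (measurable_pi_apply _)).add
        (measurable_subtype_coe.comp (measurable_pi_apply _))) measurable_const
  rw [← spinMeasure_map_restrict hη, Measure.map_apply (measurable_restrict_fin N) hmeas,
    vol]
  congr 1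
  ext σ
  simp only [polytope, feasible, randomEdges, edgeSet, edgeOf, Set.mem_preimage,
    Set.mem_ofPred_eq, Finset.mem_image, Finset.mem_range]
  constructor
  · rintro h i j ⟨k, hk, hij⟩
    rcases Sym2.eq_iff.1 hij with ⟨rfl, rfl⟩ | ⟨rfl, rfl⟩
    · exact h k hk
    · rw [add_comm]
      exact h k hk
  · exact fun h k hk => h _ _ ⟨k, hk, rfl⟩

end Polytope

/-- for every `η > 0` and `0 < α ≤ 1/2`, (1) the operator `T_∞^hc` has a
unique fixed point `λ_∞^hc` in `Pr₁(X₀)`, and (2) `N⁻¹ log ν^{⊗N}(𝔓_{G_N})` converges in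
`L¹` to `P_∞^hc(λ_∞^hc)`. -/
theorem hardcore_log_volume (η : ℝ) (hη : 0 < η) (α : ℝ≥0) (hα : 0 < α)
    (hα2 : (α : ℝ) ≤ 1 / 2)
    [MeasurableSpace C(↥(Set.Icc (0:ℝ) 1), ℝ)] [BorelSpace C(↥(Set.Icc (0:ℝ) 1), ℝ)]
    (T : Measure C(↥(Set.Icc (0:ℝ) 1), ℝ) → Measure C(↥(Set.Icc (0:ℝ) 1), ℝ))
    (hT : IsHcOp η α T)
    (Ω : ℕ → Type*) [∀ N, MeasureSpace (Ω N)]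
    [∀ N, IsProbabilityMeasure (ℙ : Measure (Ω N))]
    (K : ∀ N, Ω N → ℕ) (E : ∀ N, ℕ → Ω N → (Fin 2 → Fin N))
    (hlaw : ∀ N, 2 ≤ N → ∀ n : ℕ,
      Measure.map (fun ω => (K N ω, fun k : Fin n => E N k ω)) ℙ
        = (ProbabilityTheory.poissonMeasure (α * N)).prod
            (Measure.pi fun _ : Fin n =>
              ProbabilityTheory.uniformOn {e : Fin 2 → Fin N | Function.Injective e})) :
    (∃! lam, MemPr1X0 lam ∧ T lam = lam) ∧
    (∀ lam, MemPr1X0 lam → T lam = lam →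
      Tendsto (fun N : ℕ => ∫ ω,
          |(N : ℝ)⁻¹ * Real.log
              (((Measure.pi fun _ : Fin N => fugMeasure η) (polytope N (K N) (E N) ω)).toReal)
            - hcFunctional η α lam| ∂ℙ)
        atTop (nhds 0)) := by
  have h2α : 2 * α ≤ 1 := by
    rw [← NNReal.coe_le_coe]
    push_cast
    linarith
  refine ⟨⟨rootDensityLaw hη (2 * α), ⟨memPr1X0_rootDensityLaw hη h2α,
    hT.rootDensityLaw_eq hη h2α⟩, fun lam h => hT.eq_rootDensityLaw hη h2α h.1 h.2⟩,
    fun lam hlam hfix => ?_⟩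
  rw [hT.eq_rootDensityLaw hη h2α hlam hfix, hcFunctional_rootDensityLaw hη h2α]
  refine (tendsto_bernExp_abs_logVol_sub hη h2α).congr' ?_
  filter_upwards [eventually_ge_atTop 2] with N hN
  simp only [measure_polytope_eq_vol hη, NNReal.coe_mul, NNReal.coe_ofNat, mul_div_cancel_left₀ _
    (two_ne_zero' ℝ)]
  exact (integral_randomEdges hN (hlaw N hN) fun A => |(N : ℝ)⁻¹ * logVol η A - _|).symm

end ContinuousHardcore
end

section
/- For every nonempty compact set Σ ⊆ ℝ there exists a Borel probability measure ν on Σ such that for every ε > 0 there exists a constant c(ε) > 0 with ν(Σ ∩ (a−ε, a+ε)) ≥ c(ε) for every a ∈ Σ. -/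
open MeasureTheory

/-- A nonempty separable space carries a Borel probability measure that charges every nonempty
open set. -/
theorem exists_isProbabilityMeasure_isOpenPosMeasure (X : Type*) [TopologicalSpace X]
    [TopologicalSpace.SeparableSpace X] [Nonempty X] [MeasurableSpace X] :
    ∃ μ : Measure X, IsProbabilityMeasure μ ∧ μ.IsOpenPosMeasure := by
  obtain ⟨u, hu⟩ := TopologicalSpace.exists_dense_seq X
  let w : ℕ → ENNReal := fun n => 2⁻¹ ^ (n + 1)
  refine ⟨Measure.sum fun n => w n • Measure.dirac (u n), ⟨?_⟩, ⟨fun U hU hne => ?_⟩⟩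
  · rw [Measure.sum_apply _ MeasurableSet.univ]
    simp [w, ENNReal.tsum_geometric_add_one, ENNReal.one_sub_inv_two, ENNReal.inv_mul_cancel]
  · obtain ⟨n, hn⟩ := hu.exists_mem_open hU hne
    have hpos : 0 < (w n • Measure.dirac (u n)) U := by
      rw [Measure.smul_apply, Measure.dirac_apply_of_mem hn]
      simp [w, pos_iff_ne_zero]
    exact ne_of_gt (hpos.trans_le (Measure.le_sum (fun n => w n • Measure.dirac (u n)) n U))

/-- On a compact metric space, a finite measure charging every nonempty open set has a positive
lower bound on the measures of the balls of a given radius. -/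
theorem exists_pos_forall_le_measure_ball {X : Type*} [PseudoMetricSpace X] [CompactSpace X]
    [MeasurableSpace X] (μ : Measure X) [IsFiniteMeasure μ] [μ.IsOpenPosMeasure]
    {ε : ℝ} (hε : 0 < ε) :
    ∃ c : ℝ, 0 < c ∧ ∀ x, ENNReal.ofReal c ≤ μ (Metric.ball x ε) := by
  obtain ⟨t, -, ht, hcover⟩ :=
    finite_cover_balls_of_compact (isCompact_univ (X := X)) (half_pos hε)
  have hc : ∃ c : ℝ, 0 < c ∧ ∀ y ∈ t, c ≤ μ.real (Metric.ball y (ε / 2)) := by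
    rcases t.eq_empty_or_nonempty with rfl | hne
    · exact ⟨1, one_pos, by simp⟩
    · obtain ⟨z, -, hz⟩ :=
        Set.exists_min_image t (fun y => μ.real (Metric.ball y (ε / 2))) ht hne
      exact ⟨_, ENNReal.toReal_pos (Metric.measure_ball_pos μ z (half_pos hε)).ne'
        (measure_ne_top _ _), hz⟩
  obtain ⟨c, hc0, hc⟩ := hc
  refine ⟨c, hc0, fun x => ?_⟩
  obtain ⟨y, hy, hxy⟩ := Set.mem_iUnion₂.1 (hcover (Set.mem_univ x))
  calc ENNReal.ofReal c ≤ μ (Metric.ball y (ε / 2)) :=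
        ENNReal.ofReal_le_of_le_toReal (hc y hy)
    _ ≤ μ (Metric.ball x ε) := by
        refine measure_mono (Metric.ball_subset_ball' ?_)
        rw [dist_comm]
        linarith [Metric.mem_ball.1 hxy]

/-- For every nonempty compact set `Σ ⊆ ℝ` there exists a Borel probability
measure `ν` on `Σ` such that for every `ε > 0` there is a constant `c(ε) > 0` with
`ν(Σ ∩ (a-ε, a+ε)) ≥ c(ε)` for every `a ∈ Σ`. -/
theorem exists_fullish_measure_on_compact (S : Set ℝ) (hS : IsCompact S) (hne : S.Nonempty) :
    ∃ ν : Measure ↥S, IsProbabilityMeasure ν ∧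
      ∀ ε : ℝ, 0 < ε → ∃ c : ℝ, 0 < c ∧
        ∀ a ∈ S, ENNReal.ofReal c ≤ ν {x : ↥S | a - ε < (x : ℝ) ∧ (x : ℝ) < a + ε} := by
  have : CompactSpace S := isCompact_iff_compactSpace.1 hS
  have : Nonempty S := hne.to_subtype
  obtain ⟨ν, hprob, hpos⟩ := exists_isProbabilityMeasure_isOpenPosMeasure S
  refine ⟨ν, hprob, fun ε hε => ?_⟩
  obtain ⟨c, hc0, hc⟩ := exists_pos_forall_le_measure_ball ν hε
  refine ⟨c, hc0, fun a ha => (hc ⟨a, ha⟩).trans (measure_mono fun x hx => ?_)⟩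
  have hx' : |(x : ℝ) - a| < ε := hx
  rw [abs_lt] at hx'
  exact ⟨by linarith, by linarith⟩
end

section
/- Let η > 0 and let f : [0,1] → [0,∞) be integrable with ∫₀¹ f(t) dt = 1, and suppose the function t ↦ η^{−t} f(t) is nonincreasing on [0,1] (i.e. η^{−s} f(s) ≥ η^{−t} f(t) whenever 0 ≤ s ≤ t ≤ 1). Then ∫₀^{1/2} f(t) dt ≥ 1/(1 + η^{1/2}). -/
/-- Let `η > 0` and let `f : [0,1] → [0,∞)` be an integrable probability
density on `[0,1]` such that `t ↦ η^{-t} f(t)` is nonincreasing on `[0,1]`.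
Then `∫₀^{1/2} f ≥ 1/(1 + η^{1/2})`. -/
theorem density_half_mass_lower_bound (η : ℝ) (hη : 0 < η) (f : ℝ → ℝ)
    (hint : MeasureTheory.IntegrableOn f (Set.Icc (0 : ℝ) 1))
    (hnonneg : ∀ t ∈ Set.Icc (0 : ℝ) 1, 0 ≤ f t)
    (hprob : ∫ t in (0 : ℝ)..1, f t = 1)
    (hmono : ∀ s t : ℝ, 0 ≤ s → s ≤ t → t ≤ 1 → η ^ (-t) * f t ≤ η ^ (-s) * f s) :
    1 / (1 + η ^ ((1 : ℝ) / 2)) ≤ ∫ t in (0 : ℝ)..(1 / 2), f t := by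
  have hI : IntervalIntegrable f MeasureTheory.volume 0 1 :=
    (intervalIntegrable_iff_integrableOn_Icc_of_le zero_le_one).2 hint
  have hI₁ : IntervalIntegrable f MeasureTheory.volume 0 (1 / 2) :=
    hI.mono_set (by
      rw [Set.uIcc_of_le (by norm_num), Set.uIcc_of_le (by norm_num)]
      exact Set.Icc_subset_Icc le_rfl (by norm_num))
  have hI₂ : IntervalIntegrable f MeasureTheory.volume (1 / 2) 1 :=
    hI.mono_set (by
      rw [Set.uIcc_of_le (by norm_num), Set.uIcc_of_le (by norm_num)]
      exact Set.Icc_subset_Icc (by norm_num) le_rfl)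
  have hsum := intervalIntegral.integral_add_adjacent_intervals hI₁ hI₂
  have hshift : ∫ t in (0 : ℝ)..(1 / 2), f (t + 1 / 2) = ∫ t in (1 / 2 : ℝ)..1, f t := by
    rw [intervalIntegral.integral_comp_add_right]
    norm_num
  have hI₃ : IntervalIntegrable (fun t => f (t + 1 / 2)) MeasureTheory.volume 0 (1 / 2) := by
    convert hI₂.comp_add_right (1 / 2) using 1 <;> norm_num
  have hle : ∫ t in (0 : ℝ)..(1 / 2), f (t + 1 / 2) ≤
      ∫ t in (0 : ℝ)..(1 / 2), η ^ ((1 : ℝ) / 2) * f t := by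
    refine intervalIntegral.integral_mono_on (by norm_num) hI₃ (hI₁.const_mul _) fun t ht => ?_
    have h := hmono t (t + 1 / 2) ht.1 (by linarith) (by linarith [ht.2])
    have h' := mul_le_mul_of_nonneg_left h (Real.rpow_pos_of_pos hη (t + 1 / 2)).le
    rwa [← mul_assoc, ← mul_assoc, ← Real.rpow_add hη, ← Real.rpow_add hη, add_neg_cancel,
      Real.rpow_zero, one_mul, show t + 1 / 2 + -t = (1 : ℝ) / 2 by ring] at h'
  rw [intervalIntegral.integral_const_mul, hshift] at hle
  have hpos := Real.rpow_pos_of_pos hη ((1 : ℝ) / 2)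
  rw [div_le_iff₀ (by linarith)]
  linarith
end

section
/- Let α > 0, ρ ∈ (0,1) and β ∈ ℝ, and define F(β) = α·log(e^{−β} + (1−e^{−β})ρ). Then F is differentiable at β with F'(β) = −α·e^{−β}(1−ρ)/(e^{−β} + (1−e^{−β})ρ), and setting t = ρ/(e^{−β} + (1−e^{−β})ρ), one has t ∈ (0,1) and F(β) − β·F'(β) = α(1−t)·log((1−ρ)/(1−t)) + α t·log(ρ/t). -/
open Real

/-- For `α > 0`, `ρ ∈ (0,1)`, `β ∈ ℝ` and
`F(β) = α log(e^{-β} + (1-e^{-β})ρ)`, the function `F` is differentiable at `β` with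
`F'(β) = -α e^{-β}(1-ρ)/(e^{-β} + (1-e^{-β})ρ)`, and with
`t = ρ/(e^{-β} + (1-e^{-β})ρ)` one has `t ∈ (0,1)` and
`F(β) - β F'(β) = α(1-t) log((1-ρ)/(1-t)) + α t log(ρ/t)`. -/
theorem free_energy_legendre (α ρ β : ℝ) (hα : 0 < α) (hρ0 : 0 < ρ) (hρ1 : ρ < 1) :
    HasDerivAt (fun b : ℝ => α * Real.log (Real.exp (-b) + (1 - Real.exp (-b)) * ρ))
      (-(α * Real.exp (-β) * (1 - ρ) / (Real.exp (-β) + (1 - Real.exp (-β)) * ρ))) β ∧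
    (0 < ρ / (Real.exp (-β) + (1 - Real.exp (-β)) * ρ) ∧
      ρ / (Real.exp (-β) + (1 - Real.exp (-β)) * ρ) < 1) ∧
    α * Real.log (Real.exp (-β) + (1 - Real.exp (-β)) * ρ)
        - β * (-(α * Real.exp (-β) * (1 - ρ) / (Real.exp (-β) + (1 - Real.exp (-β)) * ρ)))
      = α * (1 - ρ / (Real.exp (-β) + (1 - Real.exp (-β)) * ρ)) *
          Real.log ((1 - ρ) / (1 - ρ / (Real.exp (-β) + (1 - Real.exp (-β)) * ρ)))
        + α * (ρ / (Real.exp (-β) + (1 - Real.exp (-β)) * ρ)) *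
          Real.log (ρ / (ρ / (Real.exp (-β) + (1 - Real.exp (-β)) * ρ))) := by
  have he : 0 < Real.exp (-β) := Real.exp_pos _
  have hnum : 0 < Real.exp (-β) * (1 - ρ) := mul_pos he (sub_pos.2 hρ1)
  have hD : 0 < Real.exp (-β) + (1 - Real.exp (-β)) * ρ := by linarith
  refine ⟨?_, ⟨div_pos hρ0 hD, (div_lt_one hD).2 (by linarith)⟩, ?_⟩
  · have hexp : HasDerivAt (fun b : ℝ => Real.exp (-b)) (-Real.exp (-β)) β := by
      simpa using (hasDerivAt_neg β).exp
    have hinner := hexp.fun_add ((hexp.const_sub 1).mul_const ρ)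
    refine ((hinner.log hD.ne').const_mul α).congr_deriv ?_
    ring
  · have ht : 1 - ρ / (Real.exp (-β) + (1 - Real.exp (-β)) * ρ)
        = Real.exp (-β) * (1 - ρ) / (Real.exp (-β) + (1 - Real.exp (-β)) * ρ) := by
      rw [eq_div_iff hD.ne', sub_mul, div_mul_cancel₀ _ hD.ne']
      ring
    have hratio : (1 - ρ) / (1 - ρ / (Real.exp (-β) + (1 - Real.exp (-β)) * ρ))
        = (Real.exp (-β) + (1 - Real.exp (-β)) * ρ) / Real.exp (-β) := by
      rw [ht, div_div_eq_mul_div, div_eq_div_iff hnum.ne' he.ne']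
      ring
    rw [hratio, div_div_cancel₀ hρ0.ne', Real.log_div hD.ne' he.ne', Real.log_exp]
    linear_combination (-(α * β)) * ht
end
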